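/- Fix real numbers α, β ≥ 1 with (α, β) ≠ (1,1). Then for every ε > 0 there is a constant K = K(α,β,ε) > 0 such that for all R > 0, the number r_B(α,β;R) of B-reduced quadratic irrationals ω with ϱ_B(ω) ≤ R, ω ≥ α, and 0 < ω* ≤ 1/β satisfies |r_B(α,β;R) − (e^R/(2ζ(2)))·log(αβ/(αβ−1))| ≤ K·e^{(3/4+ε)R}. (Here ζ(2) = π²/6 and log(αβ/(αβ−1)) = ∬_{[α,∞)×[0,1/β]} du dv/(u−v)².) -/

import Mathlib

noncomputable section

/-- `ω'` is the conjugate of the quadratic irrational `ω`: both are roots of the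
minimal integer polynomial `A X^2 + B X + C` of `ω` (with `A > 0`, `gcd(A,B,C) = 1`),
and `ω' ≠ ω`. -/
def IsConjPair (ω ω' : ℝ) : Prop :=
  Irrational ω ∧ ∃ A B C : ℤ, 0 < A ∧ Int.gcd (Int.gcd A B : ℤ) C = 1 ∧
    (A : ℝ) * ω ^ 2 + B * ω + C = 0 ∧ (A : ℝ) * ω' ^ 2 + B * ω' + C = 0 ∧ ω' ≠ ω

/-- The quadratic irrational `ω` has discriminant `Δ = B^2 - 4AC`, where
`A X^2 + B X + C` is its minimal integer polynomial (`A > 0`, `gcd(A,B,C) = 1`). -/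
def HasDisc (ω : ℝ) (Δ : ℤ) : Prop :=
  Irrational ω ∧ ∃ A B C : ℤ, 0 < A ∧ Int.gcd (Int.gcd A B : ℤ) C = 1 ∧
    (A : ℝ) * ω ^ 2 + B * ω + C = 0 ∧ Δ = B ^ 2 - 4 * A * C

/-- The matrix `M(a,e) = (a, e; 1, 0)`. -/
def Mmat (a e : ℤ) : Matrix (Fin 2) (Fin 2) ℤ := !![a, e; 1, 0]

/-- The spectral radius of a 2x2 integer matrix with trace `t`, namely
`(t + sqrt (t^2 - 4)) / 2`. -/
def specRad (σ : Matrix (Fin 2) (Fin 2) ℤ) : ℝ :=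
  ((σ.trace : ℝ) + Real.sqrt ((σ.trace : ℝ) ^ 2 - 4)) / 2

/-- The BCF Gauss shift `T_B(u) = 1 / (1 + ⎣u⎦ - u)`. -/
def TB (u : ℝ) : ℝ := 1 / ((1 + ⌊u⌋ : ℤ) - u)

/-- The least period of `ω` under `T_B` (junk value `0` if `ω` is not periodic). -/
def perB (ω : ℝ) : ℕ := sInf {n : ℕ | 0 < n ∧ TB^[n] ω = ω}

/-- `Ω_B(ω) = M(a₁,-1) ⋯ M(aₙ,-1)`, where `n = per(ω)` and `aᵢ = 1 + ⎣T_B^{i-1}(ω)⎦`. -/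
def OmegaB (ω : ℝ) : Matrix (Fin 2) (Fin 2) ℤ :=
  ((List.range (perB ω)).map (fun i => Mmat (1 + ⌊TB^[i] ω⌋) (-1))).prod

/-- The length `ϱ_B(ω) = 2 log 𝔯(Ω_B(ω))`. -/
def rhoB (ω : ℝ) : ℝ := 2 * Real.log (specRad (OmegaB ω))




namespace Stepanov
open Polynomial Finset

variable {K : Type*} [Field K]

/-- the polynomial `x^{p^r} * sum_{i ≤ r} f(x)^{p^i}` -/
noncomputable def G (p r : ℕ) (a b γ : K) : K[X] :=
  ∑ i ∈ range (r + 1), (C a * X ^ (p ^ r + p ^ i) + C b * X ^ (p ^ r - p ^ i)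
    - C (γ ^ p ^ i) * X ^ (p ^ r))

/-- coefficient of `y^k` in the reduction of `x * y^l` -/
noncomputable def rho (p : ℕ) (a b γ : K) (l k : ℕ) : K[X] :=
  if l < p then (if k = l then X else 0) else
    (if k = l - p + 1 then X else 0) +
      (if k = l - p then (C a * X ^ 2 - C γ * X + C b) else 0)

noncomputable def Rc (p r : ℕ) (a b γ : K) (e j j' k : ℕ) : K[X] :=
  ∑ i ∈ range (j' + 1), X ^ e * (C (j'.choose i : K) * G p r a b γ ^ (j' - i) *
    X ^ (p ^ r * (p - 1 - j' + i)) * rho p a b γ (j + i) k)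

lemma G_natDegree (p r : ℕ) (hp : 1 < p) (a b γ : K) : (G p r a b γ).natDegree ≤ 2 * p ^ r := by
  unfold G
  refine natDegree_sum_le_of_forall_le _ _ fun i hi => ?_
  have : p ^ i ≤ p ^ r := Nat.pow_le_pow_right (by omega) (by simp at hi; omega)
  compute_degree
  exact max_le (by omega) (by omega)

lemma G_coeff (p r : ℕ) (hp : 1 < p) (a b γ : K) : (G p r a b γ).coeff (2 * p ^ r) = a := by
  unfold G
  have hpos : 0 < p ^ r := by positivity
  rw [finsetSum_coeff, Finset.sum_eq_single r]
  · simp only [coeff_sub, coeff_add, coeff_C_mul, coeff_X_pow]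
    rw [if_pos (by ring), if_neg (by omega), if_neg (by omega)]; simp
  · intro i hi hne
    have : p ^ i < p ^ r := Nat.pow_lt_pow_right hp (by simp at hi; omega)
    simp only [coeff_sub, coeff_add, coeff_C_mul, coeff_X_pow]
    rw [if_neg (by omega), if_neg (by omega), if_neg (by omega)]; simp
  · simp

lemma rho_natDegree (p : ℕ) (a b γ : K) (l k : ℕ) : (rho p a b γ l k).natDegree ≤ 2 := by
  unfold rho
  split_ifs <;> compute_degree <;> norm_num

lemma term_natDegree (p r : ℕ) (hp : 1 < p) (a b γ : K) (e j j' k i : ℕ) (hj' : j' < p) (hi : i ≤ j') :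
    (X ^ e * (C (j'.choose i : K) * G p r a b γ ^ (j' - i) *
    X ^ (p ^ r * (p - 1 - j' + i)) * rho p a b γ (j + i) k)).natDegree ≤
      e + (p ^ r * (p - 1) + p ^ r * (j' - i)) + 2 := by
  refine natDegree_mul_le.trans ?_
  rw [natDegree_X_pow, add_assoc]
  gcongr
  refine natDegree_mul_le.trans ?_
  gcongr
  · refine natDegree_mul_le.trans ?_
    rw [natDegree_X_pow]
    have h1 : (C (j'.choose i : K) * G p r a b γ ^ (j' - i)).natDegree ≤ (j' - i) * (2 * p ^ r) := by
      refine (natDegree_C_mul_le _ _).trans (natDegree_pow_le.trans ?_)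
      gcongr; exact G_natDegree p r hp a b γ
    obtain ⟨u, rfl⟩ := Nat.exists_eq_add_of_le hi
    obtain ⟨v, rfl⟩ : ∃ v, p = i + u + 1 + v := ⟨p - (i+u+1), by omega⟩
    have e1 : i + u - i = u := by omega
    have e2 : i + u + 1 + v - 1 - (i + u) + i = v + i := by omega
    have e3 : i + u + 1 + v - 1 = i + u + v := by omega
    rw [e1] at h1 
    rw [e1, e2, e3]
    refine (Nat.add_le_add_right h1 _).trans (le_of_eq ?_)
    ring
  · exact rho_natDegree ..

lemma Rc_natDegree (p r : ℕ) (hp : 1 < p) (a b γ : K) (e j j' k : ℕ) (hj' : j' < p) :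
    (Rc p r a b γ e j j' k).natDegree ≤ e + 2 * (p ^ r * (p - 1)) + 2 := by
  unfold Rc
  refine natDegree_sum_le_of_forall_le _ _ fun i hi => ?_
  have hi' : i ≤ j' := by simp at hi; omega
  refine (term_natDegree p r hp a b γ e j j' k i hj' hi').trans ?_
  have : p ^ r * (j' - i) ≤ p ^ r * (p - 1) := Nat.mul_le_mul_left _ (by omega)
  omega

lemma Rc_coeff_gt (p r : ℕ) (hp : 1 < p) (hr : 1 ≤ r) (a b γ : K) (e j j' k n : ℕ) (hj : j < p) (hj' : j' < p)
    (hn : e + p ^ r * j' + p ^ r * (p - 1) + 1 ≤ n) :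
    (Rc p r a b γ e j j' k).coeff n = if n = e + p ^ r * j' + p ^ r * (p - 1) + 1 ∧ k = j then a ^ j' else 0 := by
  have hQ1 : 2 ≤ p ^ r := by
    calc 2 ≤ p := hp
      _ = p ^ 1 := by simp
      _ ≤ p ^ r := Nat.pow_le_pow_right (by omega) hr
  unfold Rc
  rw [finsetSum_coeff, Finset.sum_eq_single 0]
  · -- i = 0
    simp only [Nat.choose_zero_right, Nat.cast_one, C_1, one_mul, Nat.sub_zero, add_zero, rho, hj, if_true]
    by_cases hk : k = j
    swap
    · simp [hk]
    simp only [hk, if_true, and_true]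
    have e2 : p - 1 - j' + j' = p - 1 := by omega
    have : X ^ e * (G p r a b γ ^ j' * X ^ (p ^ r * (p - 1 - j')) * X) =
      G p r a b γ ^ j' * X ^ (e + p ^ r * (p - 1 - j') + 1) := by ring
    rw [this, coeff_mul_X_pow']
    have e3 : p ^ r * (p - 1) = p ^ r * (p - 1 - j') + p ^ r * j' := by rw [← mul_add, e2]
    rw [if_pos (by omega)]
    have hd : (G p r a b γ ^ j').natDegree ≤ j' * (2 * p ^ r) := natDegree_pow_le.trans (by
      gcongr; exact G_natDegree p r hp a b γ)
    have e4 : j' * (2 * p ^ r) = 2 * (p ^ r * j') := by ring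
    split_ifs with h
    · rw [show n - (e + p ^ r * (p - 1 - j') + 1) = j' * (2 * p ^ r) by omega,
        coeff_pow_of_natDegree_le (G_natDegree p r hp a b γ), G_coeff p r hp]
    · exact coeff_eq_zero_of_natDegree_lt (by omega)
  · intro i hi hne
    have hi' : i ≤ j' := by simp at hi; omega
    apply coeff_eq_zero_of_natDegree_lt
    refine (term_natDegree p r hp a b γ e j j' k i hj' hi').trans_lt ?_
    have : p ^ r * (j' - i) + p ^ r * i = p ^ r * j' := by rw [← mul_add]; congr 1; omega
    have : p ^ r * 1 ≤ p ^ r * i := Nat.mul_le_mul_left _ (by omega)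
    omega
  · simp

lemma rho_eval (p : ℕ) (hp : 1 < p) (a b γ : K) (l : ℕ) (hl : l ≤ 2 * p - 2) (x y : K) (hx : x ≠ 0)
    (hy : y ^ p = y + (a * x + b * x⁻¹ - γ)) :
    ∑ k ∈ range p, (rho p a b γ l k).eval x * y ^ k = x * y ^ l := by
  unfold rho
  split_ifs with h
  · rw [Finset.sum_eq_single l]
    · simp
    · intro k _ hk; simp [hk]
    · simp [h]
  · simp only [eval_add, add_mul, Finset.sum_add_distrib]
    rw [Finset.sum_eq_single (l - p + 1), Finset.sum_eq_single (l - p)]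
    · simp only [if_true]
      obtain ⟨u, rfl⟩ := Nat.exists_eq_add_of_le (not_lt.mp h)
      simp only [Nat.add_sub_cancel_left, eval_add, eval_sub, eval_mul, eval_C, eval_X, eval_pow]
      rw [pow_add y p u, hy]
      field_simp
      ring
    · intro k _ hk; simp [hk]
    · intro h2; exfalso; apply h2; simp; omega
    · intro k _ hk; simp [hk]
    · intro h2; exfalso; apply h2; simp; omega

lemma G_eval (p r : ℕ) [Fact p.Prime] [CharP K p] (a b γ : K) (ha : a ^ p = a) (hb : b ^ p = b) (x : K) (hx : x ≠ 0) :
    (G p r a b γ).eval x = x ^ p ^ r * ∑ i ∈ range (r + 1), (a * x + b * x⁻¹ - γ) ^ p ^ i := by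
  have hp : 1 < p := (Fact.out : p.Prime).one_lt
  have frob : ∀ c : K, c ^ p = c → ∀ i, c ^ p ^ i = c := by
    intro c hc i
    induction i with
    | zero => simp
    | succ i ih => rw [pow_succ, pow_mul, ih, hc]
  unfold G
  rw [eval_finsetSum, Finset.mul_sum]
  refine Finset.sum_congr rfl fun i hi => ?_
  have hle : p ^ i ≤ p ^ r := Nat.pow_le_pow_right (by omega) (by simp at hi; omega)
  rw [sub_pow_char_pow, add_pow_char_pow, mul_pow, mul_pow, frob a ha, frob b hb]
  simp only [eval_add, eval_sub, eval_mul, eval_C, eval_X, eval_pow]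
  rw [pow_sub₀ _ hx hle, pow_add, inv_pow]
  ring

lemma y_pow (p : ℕ) [Fact p.Prime] [CharP K p] (y f : K) (hy : y ^ p = y + f) (m : ℕ) :
    y ^ p ^ m = y + ∑ i ∈ range m, f ^ p ^ i := by
  induction m with
  | zero => simp
  | succ m ih =>
    have : y ^ p ^ (m + 1) = (y ^ p) ^ p ^ m := by rw [← pow_mul, pow_succ']
    rw [this, hy, add_pow_char_pow, ih, Finset.sum_range_succ]; ring

lemma Rc_eval (p r : ℕ) [Fact p.Prime] [CharP K p] (a b γ : K) (ha : a ^ p = a) (hb : b ^ p = b)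
    (e j j' : ℕ) (hj : j < p) (hj' : j' < p) (x y : K) (hx : x ≠ 0)
    (hy : y ^ p = y + (a * x + b * x⁻¹ - γ)) :
    ∑ k ∈ range p, (Rc p r a b γ e j j' k).eval x * y ^ k =
      x ^ (1 + (p - 1) * p ^ r) * (x ^ e * y ^ j * (y ^ p ^ (r + 1)) ^ j') := by
  have hp : 1 < p := (Fact.out : p.Prime).one_lt
  unfold Rc
  simp_rw [eval_finsetSum, Finset.sum_mul]
  rw [Finset.sum_comm, y_pow p y _ hy, add_pow, Finset.mul_sum, Finset.mul_sum]
  refine Finset.sum_congr rfl fun i hi => ?_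
  have hi' : i ≤ j' := by simp at hi; omega
  simp only [eval_mul, eval_C, eval_X, eval_pow, G_eval p r a b γ ha hb x hx]
  have := rho_eval p hp a b γ (j + i) (by omega) x y hx hy
  simp_rw [mul_assoc]
  simp_rw [← Finset.mul_sum]
  rw [this]
  set s := ∑ i ∈ range (r + 1), (a * x + b * x⁻¹ - γ) ^ p ^ i
  have e1 : (p - 1) * p ^ r = p ^ r * (j' - i) + p ^ r * (p - 1 - j' + i) := by
    rw [← mul_add, mul_comm]; congr 1; omega
  rw [e1, mul_pow, ← pow_mul]
  ring


theorem main (p r : ℕ) [Fact p.Prime] [CharP K p] [Fintype K] [DecidableEq K] (hr : 1 ≤ r)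
    (hK : Fintype.card K = p ^ (2 * (r + 1))) (a b γ : K) (ha0 : a ≠ 0) (ha : a ^ p = a) (hb : b ^ p = b)
    (S : Finset K) (hS : ∀ x ∈ S, x ≠ 0 ∧ ∃ y, y ^ p = y + (a * x + b * x⁻¹ - γ)) :
    S.card ≤ p ^ (2 * r + 1) + 6 * p ^ (r + 1) := by
  have hp : 1 < p := (Fact.out : p.Prime).one_lt
  set Q1 := p ^ r with hQ1def
  set Q := p ^ (r + 1) with hQdef
  have hQQ : Q = Q1 * p := pow_succ _ _
  have hQ1 : 2 ≤ Q1 := by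
    calc 2 ≤ p := hp
      _ = p ^ 1 := by simp
      _ ≤ p ^ r := Nat.pow_le_pow_right (by omega) hr
  have hQ2 : 2 * Q1 ≤ Q := by rw [hQQ, mul_comm]; exact Nat.mul_le_mul_left _ hp
  set T := Q1 + 3 with hT
  set D := Q * (Q1 - 1) + T + 2 * (Q1 * (p - 1)) + 2 with hD
  have hq : ∀ z : K, z ^ (Q * Q) = z := by
    intro z
    have : Q * Q = Fintype.card K := by rw [hK, hQdef]; ring
    rw [this, FiniteField.pow_card]
  -- the linear map
  let ι := Fin Q1 × Fin p × Fin T × Fin p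
  let Δ : (ι → K) →ₗ[K] (Fin p × Fin D → K) :=
    { toFun := fun d kn => ∑ s : ι, d s * (Rc p r a b γ (s.1 * Q + s.2.2.1) s.2.2.2 s.2.1 kn.1).coeff kn.2
      map_add' := by
        intro d d'; ext kn; simp [add_mul, Finset.sum_add_distrib]
      map_smul' := by
        intro t d; ext kn; simp [Finset.mul_sum, mul_assoc] }
  have hker : LinearMap.ker Δ ≠ ⊥ := by
    apply LinearMap.ker_ne_bot_of_finrank_lt
    simp only [Module.finrank_fintype_fun_eq_card, Fintype.card_prod, Fintype.card_fin, ι]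
    have h1 : Q1 * (p * (T * p)) = p * (Q * T) := by rw [hQQ]; ring
    rw [h1]
    apply Nat.mul_lt_mul_of_pos_left _ (by omega)
    have h2 : Q1 * (p - 1) + Q1 = Q := by
      rw [hQQ]; obtain ⟨v, rfl⟩ : ∃ v, p = v + 1 := ⟨p - 1, by omega⟩
      simp; ring
    have h3 : Q * (Q1 - 1) + Q = Q * Q1 := by
      obtain ⟨v, hv⟩ : ∃ v, Q1 = v + 1 := ⟨Q1 - 1, by omega⟩
      rw [hv]; simp; ring
    have h4 : Q * T = Q * Q1 + 3 * Q := by rw [hT]; ring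
    omega
  obtain ⟨d, hdk, hd0⟩ := (Submodule.ne_bot_iff _).mp hker
  have hdk' : Δ d = 0 := hdk
  -- q-th roots
  let c : ι → K := fun s => d s ^ Q
  have hcd : ∀ s, c s ^ Q = d s := fun s => by simp only [c]; rw [← pow_mul, hq]
  let Ψ : ℕ → K[X] := fun k => ∑ s : ι, C (c s) * Rc p r a b γ (s.1 + Q * s.2.2.1) s.2.1 s.2.2.2 k
  have hDz : ∀ k < p, (∑ s : ι, C (d s) * Rc p r a b γ (s.1 * Q + s.2.2.1) s.2.2.2 s.2.1 k) = 0 := by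
    intro k hk
    ext n
    rw [finsetSum_coeff, coeff_zero]
    simp_rw [coeff_C_mul]
    by_cases hn : n < D
    · exact congrFun hdk' (⟨k, hk⟩, ⟨n, hn⟩)
    · refine Finset.sum_eq_zero fun s _ => ?_
      rw [coeff_eq_zero_of_natDegree_lt, mul_zero]
      refine (Rc_natDegree p r hp a b γ _ _ _ _ s.2.1.2).trans_lt ?_
      have h1 : (s.1 : ℕ) * Q ≤ Q * (Q1 - 1) := by
        rw [mul_comm]; exact Nat.mul_le_mul_left _ (by have := s.1.2; omega)
      have h2 := s.2.2.1.2
      rw [← hQ1def]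
      omega
  -- vanishing
  have hvan : ∀ x ∈ S, ∀ y, y ^ p = y + (a * x + b * x⁻¹ - γ) → ∑ k ∈ range p, (Ψ k).eval x * y ^ k = 0 := by
    intro x hxS y hy
    have hx := (hS x hxS).1
    have e1 : ∑ k ∈ range p, (Ψ k).eval x * y ^ k = x ^ (1 + (p - 1) * p ^ r) *
        ∑ s : ι, c s * (x ^ ((s.1 : ℕ) + Q * s.2.2.1) * y ^ (s.2.1 : ℕ) * (y ^ Q) ^ (s.2.2.2 : ℕ)) := by
      simp only [Ψ, eval_finsetSum, Finset.sum_mul, eval_mul, eval_C]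
      rw [Finset.sum_comm, Finset.mul_sum]
      refine Finset.sum_congr rfl fun s _ => ?_
      simp_rw [mul_assoc]
      rw [← Finset.mul_sum, Rc_eval p r a b γ ha hb _ _ _ s.2.1.2 s.2.2.2.2 x y hx hy]
      ring
    have e2 : (0 : K) = x ^ (1 + (p - 1) * p ^ r) *
        ∑ s : ι, d s * (x ^ ((s.1 : ℕ) * Q + s.2.2.1) * y ^ (s.2.2.2 : ℕ) * (y ^ Q) ^ (s.2.1 : ℕ)) := by
      have : ∑ k ∈ range p, (∑ s : ι, C (d s) * Rc p r a b γ (s.1 * Q + s.2.2.1) s.2.2.2 s.2.1 k).eval x * y ^ k = 0 :=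
        Finset.sum_eq_zero fun k hk => by rw [hDz k (by simpa using hk)]; simp
      rw [← this]
      simp only [eval_finsetSum, Finset.sum_mul, eval_mul, eval_C]
      rw [Finset.sum_comm, Finset.mul_sum]
      refine Finset.sum_congr rfl fun s _ => ?_
      simp_rw [mul_assoc]
      rw [← Finset.mul_sum, Rc_eval p r a b γ ha hb _ _ _ s.2.2.2.2 s.2.1.2 x y hx hy]
      ring
    have e3 : (∑ s : ι, c s * (x ^ ((s.1 : ℕ) + Q * s.2.2.1) * y ^ (s.2.1 : ℕ) * (y ^ Q) ^ (s.2.2.2 : ℕ))) ^ Q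
       = ∑ s : ι, d s * (x ^ ((s.1 : ℕ) * Q + s.2.2.1) * y ^ (s.2.2.2 : ℕ) * (y ^ Q) ^ (s.2.1 : ℕ)) := by
      rw [hQdef, sum_pow_char_pow, ← hQdef]
      refine Finset.sum_congr rfl fun s _ => ?_
      rw [mul_pow, hcd, mul_pow, mul_pow]
      congr 1
      rw [← pow_mul, ← pow_mul, ← pow_mul, ← pow_mul]
      have t1 : x ^ (((s.1 : ℕ) + Q * s.2.2.1) * Q) = x ^ ((s.1 : ℕ) * Q + s.2.2.1) := by
        rw [add_mul, pow_add, show Q * (s.2.2.1 : ℕ) * Q = (Q * Q) * s.2.2.1 by ring, pow_mul x (Q * Q), hq, ← pow_add]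
      have t2 : y ^ (Q * ((s.2.2.2 : ℕ) * Q)) = y ^ (s.2.2.2 : ℕ) := by
        rw [show Q * ((s.2.2.2 : ℕ) * Q) = (Q * Q) * s.2.2.2 by ring, pow_mul y (Q * Q), hq]
      rw [t1, t2]; ring
    rw [e1]
    have e4 := (mul_eq_zero.mp e2.symm).resolve_left (pow_ne_zero _ hx)
    rw [← e3] at e4
    rw [eq_zero_of_pow_eq_zero e4, mul_zero]
  have hcoef : ∀ x ∈ S, ∀ k < p, (Ψ k).eval x = 0 := by
    intro x hxS k hk
    obtain ⟨hx, y, hy⟩ := hS x hxS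
    let P : K[X] := ∑ k ∈ range p, C ((Ψ k).eval x) * X ^ k
    have hPd : P.degree < p := by
      refine (degree_sum_le _ _).trans_lt ?_
      rw [Finset.sup_lt_iff (by exact WithBot.bot_lt_coe p)]
      intro i hi
      exact (degree_C_mul_X_pow_le _ _).trans_lt (by exact_mod_cast Finset.mem_range.mp hi)
    have hP0 : P = 0 := by
      have hinj : Function.Injective (fun i : ZMod p => y + ZMod.castHom (dvd_refl p) K i) := by
        intro i i' h
        exact (ZMod.castHom (dvd_refl p) K).injective (add_left_cancel h)
      refine Polynomial.eq_zero_of_natDegree_lt_card_of_eval_eq_zero P hinj ?_ ?_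
      · intro i
        have := hvan x hxS (y + ZMod.castHom (dvd_refl p) K i) (by
          rw [add_pow_char, hy, ← map_pow, ZMod.pow_card]; ring)
        simpa [P, eval_finsetSum] using this
      · rw [ZMod.card]
        by_cases h0 : P = 0
        · rw [h0]; simp; omega
        · exact (natDegree_lt_iff_degree_lt h0).mpr hPd
    have : P.coeff k = 0 := by rw [hP0]; simp
    simpa [P, finsetSum_coeff, coeff_C_mul, coeff_X_pow, hk] using this
  -- nonvanishing
  obtain ⟨s0, hs0⟩ : ∃ s, c s ≠ 0 := by
    by_contra! h
    apply hd0
    ext s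
    rw [← hcd, h s]; simp; omega
  let dg : ι → ℕ := fun s => s.1 + Q * s.2.2.1 + Q1 * s.2.2.2
  obtain ⟨t, htm, htmax⟩ := Finset.exists_max_image (univ.filter fun s => c s ≠ 0) dg ⟨s0, by simp [hs0]⟩
  have ht0 : c t ≠ 0 := by simpa using htm
  have hne : (Ψ t.2.1).coeff (dg t + Q1 * (p - 1) + 1) ≠ 0 := by
    simp only [Ψ, finsetSum_coeff, coeff_C_mul]
    rw [Finset.sum_eq_single t]
    · rw [Rc_coeff_gt p r hp hr a b γ _ _ _ _ _ t.2.1.2 t.2.2.2.2 (le_refl _), if_pos ⟨rfl, rfl⟩]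
      exact mul_ne_zero ht0 (pow_ne_zero _ ha0)
    · intro s _ hst
      by_cases hs : c s = 0
      · simp [hs]
      have hle := htmax s (by simp [hs])
      rw [Rc_coeff_gt p r hp hr a b γ _ _ _ _ _ s.2.1.2 s.2.2.2.2, if_neg, mul_zero]
      · rintro ⟨h1, h2⟩
        apply hst
        have h3 : (t.1 : ℕ) + Q * t.2.2.1 + Q1 * t.2.2.2 = s.1 + Q * s.2.2.1 + Q1 * s.2.2.2 := by
          simp only [dg, ← hQ1def] at h1; omega
        have key : ∀ u : ι, ((u.1 : ℕ) + Q * u.2.2.1 + Q1 * u.2.2.2) % Q1 = u.1 ∧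
            ((u.1 : ℕ) + Q * u.2.2.1 + Q1 * u.2.2.2) / Q1 = p * u.2.2.1 + u.2.2.2 := by
          intro u
          have : (u.1 : ℕ) + Q * u.2.2.1 + Q1 * u.2.2.2 = u.1 + Q1 * (p * u.2.2.1 + u.2.2.2) := by
            rw [hQQ]; ring
          rw [this]
          constructor
          · rw [Nat.add_mul_mod_self_left, Nat.mod_eq_of_lt u.1.2]
          · rw [Nat.add_mul_div_left _ _ (by omega), Nat.div_eq_of_lt u.1.2, zero_add]
        have k1 := key t
        have k2 := key s
        rw [h3] at k1
        have a1 : (t.1 : ℕ) = s.1 := k1.1.symm.trans k2.1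
        have a2 : p * (t.2.2.1 : ℕ) + t.2.2.2 = p * s.2.2.1 + s.2.2.2 := k1.2.symm.trans k2.2
        have a3 : (t.2.2.2 : ℕ) = s.2.2.2 := by
          have := congrArg (· % p) a2
          simpa [Nat.mul_add_mod, Nat.mod_eq_of_lt t.2.2.2.2, Nat.mod_eq_of_lt s.2.2.2.2] using this
        have a4 : (t.2.2.1 : ℕ) = s.2.2.1 := by
          rw [a3] at a2
          exact Nat.eq_of_mul_eq_mul_left (by omega : 0 < p) (Nat.add_right_cancel a2)
        exact Prod.ext (Fin.ext a1.symm) (Prod.ext (Fin.ext h2.symm) (Prod.ext (Fin.ext a4.symm) (Fin.ext a3.symm)))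
      · simp only [dg, ← hQ1def] at hle ⊢; omega
    · simp
  have hΨ0 : Ψ t.2.1 ≠ 0 := fun h => hne (by rw [h]; simp)
  have hcard : S.card ≤ (Ψ t.2.1).natDegree := by
    have hsub : S ⊆ (Ψ t.2.1).roots.toFinset := by
      intro x hx
      simp only [Multiset.mem_toFinset, mem_roots hΨ0, IsRoot.def]
      exact hcoef x hx _ t.2.1.2
    exact (Finset.card_le_card hsub).trans ((Multiset.toFinset_card_le _).trans (card_roots' _))
  refine hcard.trans ?_
  refine natDegree_sum_le_of_forall_le _ _ fun s _ => ?_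
  refine (natDegree_C_mul_le _ _).trans ((Rc_natDegree p r hp a b γ _ _ _ _ s.2.2.2.2).trans ?_)
  have h1 := s.1.2
  have h2 : Q * (s.2.2.1 : ℕ) ≤ Q * (Q1 + 2) := Nat.mul_le_mul_left _ (by have := s.2.2.1.2; omega)
  have h3 : p ^ (2 * r + 1) = Q * Q1 := by rw [hQdef, hQ1def]; ring
  have h4 : Q * (Q1 + 2) = Q * Q1 + 2 * Q := by ring
  have h5 : Q1 * (p - 1) ≤ Q := by rw [hQQ]; exact Nat.mul_le_mul_left _ (by omega)
  rw [h3]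
  change (s.1 : ℕ) + Q * s.2.2.1 + 2 * (Q1 * (p - 1)) + 2 ≤ _
  omega

end Stepanov


namespace Stepanov
open Polynomial Finset

variable {K : Type*} [Field K]

lemma trace_pow_p (p : ℕ) [Fact p.Prime] [Fintype K] [Algebra (ZMod p) K] (y : K) :
    Algebra.trace (ZMod p) K (y ^ p) = Algebra.trace (ZMod p) K y := by
  have h := Algebra.trace_eq_of_algEquiv (FiniteField.frobeniusAlgEquivOfAlgebraic (ZMod p) K) y
  rw [← h, FiniteField.coe_frobeniusAlgEquivOfAlgebraic]
  simp [ZMod.card]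

lemma hilbert90 (p : ℕ) [Fact p.Prime] [Fintype K] [Algebra (ZMod p) K] (z : K)
    (hz : Algebra.trace (ZMod p) K z = 0) : ∃ y : K, y ^ p = y + z := by
  classical
  have hp : 1 < p := (Fact.out : p.Prime).one_lt
  let φ : K →ₗ[ZMod p] K := (FiniteField.frobeniusAlgHom (ZMod p) K).toLinearMap - LinearMap.id
  have hφ : ∀ y, φ y = y ^ p - y := by
    intro y; simp [φ, ZMod.card]
  have hle : LinearMap.range φ ≤ LinearMap.ker (Algebra.trace (ZMod p) K) := by
    rintro _ ⟨y, rfl⟩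
    rw [LinearMap.mem_ker, hφ, map_sub, trace_pow_p, sub_self]
  have h1 := LinearMap.finrank_range_add_finrank_ker φ
  have h2 := LinearMap.finrank_range_add_finrank_ker (Algebra.trace (ZMod p) K)
  rw [LinearMap.range_eq_top.mpr (Algebra.trace_surjective (ZMod p) K), finrank_top, Module.finrank_self] at h2
  have h3 : Module.finrank (ZMod p) (LinearMap.ker φ) ≤ 1 := by
    have hc : Fintype.card (LinearMap.ker φ) ≤ p := by
      have hne : (X ^ p - X : K[X]) ≠ 0 := FiniteField.X_pow_card_sub_X_ne_zero K hp
      have : Fintype.card (LinearMap.ker φ) ≤ (X ^ p - X : K[X]).roots.toFinset.card := by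
        rw [← Fintype.card_coe]
        refine Fintype.card_le_of_injective (fun y => ⟨y.1, ?_⟩) ?_
        · have := y.2
          rw [LinearMap.mem_ker, hφ] at this
          rw [Multiset.mem_toFinset, mem_roots hne, IsRoot.def, eval_sub, eval_pow, eval_X, this]
        · intro y y' h
          exact Subtype.ext (Subtype.mk.inj h)
      refine this.trans ((Multiset.toFinset_card_le _).trans ((card_roots' _).trans ?_))
      rw [FiniteField.X_pow_card_sub_X_natDegree_eq K hp]
    rw [Module.card_eq_pow_finrank (K := ZMod p), ZMod.card] at hc
    by_contra hcon
    have : p ^ 2 ≤ p ^ Module.finrank (ZMod p) (LinearMap.ker φ) := Nat.pow_le_pow_right (by omega) (by omega)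
    nlinarith
  have heq := Submodule.eq_of_le_of_finrank_le hle (by omega)
  have : z ∈ LinearMap.range φ := by rw [heq]; exact hz
  obtain ⟨y, hy⟩ := this
  exact ⟨y, by rw [← hy, hφ]; ring⟩

theorem sum_bound (p r : ℕ) [Fact p.Prime] [Fintype K] [DecidableEq K] [Algebra (ZMod p) K] (hr : 1 ≤ r)
    (hK : Fintype.card K = p ^ (2 * (r + 1))) (ψ : AddChar (ZMod p) ℂ) (hψ : ψ ≠ 1) (a b : ZMod p) (ha : a ≠ 0) :
    ‖∑ x : Kˣ, ψ (Algebra.trace (ZMod p) K (algebraMap (ZMod p) K a * (x : K) + algebraMap (ZMod p) K b * ((x : K)⁻¹)))‖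
      ≤ 7 * p ^ (r + 2) := by
  classical
  have hp : 1 < p := (Fact.out : p.Prime).one_lt
  have : CharP K p := charP_of_injective_algebraMap (algebraMap (ZMod p) K).injective p
  set f : Kˣ → ZMod p := fun x => Algebra.trace (ZMod p) K (algebraMap (ZMod p) K a * (x : K) + algebraMap (ZMod p) K b * ((x : K)⁻¹)) with hf
  let N : ZMod p → ℕ := fun τ => (univ.filter fun x : Kˣ => f x = τ).card
  have hN : ∀ τ, N τ ≤ p ^ (2 * r + 1) + 6 * p ^ (r + 1) := by
    intro τ
    obtain ⟨γ, hγ⟩ := Algebra.trace_surjective (ZMod p) K τ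
    have := main (K := K) p r hr hK (algebraMap (ZMod p) K a) (algebraMap (ZMod p) K b) γ
      (by simpa using ha) (by rw [← map_pow, ZMod.pow_card]) (by rw [← map_pow, ZMod.pow_card])
      ((univ.filter fun x : Kˣ => f x = τ).map ⟨Units.val, Units.val_injective⟩) (by
        intro x hx
        simp only [mem_map, mem_filter, mem_univ, true_and, Function.Embedding.coeFn_mk] at hx
        obtain ⟨u, hu, rfl⟩ := hx
        refine ⟨u.ne_zero, hilbert90 p _ ?_⟩
        rw [map_sub, hγ, ← hu, hf, sub_self])
    rwa [card_map] at this
  have hsumN : ∑ τ, N τ = p ^ (2 * (r + 1)) - 1 := by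
    have := Finset.card_eq_sum_card_fiberwise (s := (univ : Finset Kˣ)) (t := univ) (f := f) (by simp)
    rw [← hK, ← Fintype.card_units, ← Finset.card_univ, this]
  have hsum : ∑ x : Kˣ, ψ (f x) = ∑ τ, (N τ : ℂ) * ψ τ := by
    rw [← Finset.sum_fiberwise (s := univ) (g := f)]
    refine Finset.sum_congr rfl fun τ _ => ?_
    rw [Finset.sum_congr rfl (g := fun _ => ψ τ) (by intro x hx; rw [(mem_filter.mp hx).2])]
    simp [N]
  rw [hsum]
  set M : ℕ := p ^ (2 * r + 1) + 6 * p ^ (r + 1)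
  have h0 : ∑ τ, ψ τ = 0 := AddChar.sum_eq_zero_of_ne_one hψ
  have : ∑ τ, (N τ : ℂ) * ψ τ = - ∑ τ, ((M : ℂ) - N τ) * ψ τ := by
    simp_rw [sub_mul, Finset.sum_sub_distrib, ← Finset.mul_sum, h0]; simp
  rw [this, norm_neg]
  have hb : ‖∑ τ, ((M : ℂ) - N τ) * ψ τ‖ ≤ ∑ τ, ((M : ℝ) - N τ) := by
    refine (norm_sum_le _ _).trans (Finset.sum_le_sum fun τ _ => ?_)
    rw [norm_mul, AddChar.norm_apply, mul_one, ← Complex.ofReal_natCast, ← Complex.ofReal_natCast, ← Complex.ofReal_sub,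
      Complex.norm_real, Real.norm_of_nonneg]
    have : (N τ : ℝ) ≤ M := by exact_mod_cast hN τ
    linarith
  refine hb.trans ?_
  have hs : (∑ τ, (N τ : ℝ)) = (p : ℝ) ^ (2 * (r + 1)) - 1 := by
    have h1 : 1 ≤ p ^ (2 * (r + 1)) := Nat.one_le_pow _ _ (by omega)
    rw [← Nat.cast_sum, hsumN, Nat.cast_sub h1]; simp
  rw [Finset.sum_sub_distrib, hs]
  simp only [sum_const, card_univ, ZMod.card, nsmul_eq_mul, M]
  push_cast
  have h1 : (1 : ℝ) ≤ (p : ℝ) ^ (r + 2) := one_le_pow₀ (by exact_mod_cast hp.le)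
  have : (p : ℝ) * (p ^ (2 * r + 1) + 6 * p ^ (r + 1)) - (p ^ (2 * (r + 1)) - 1) = 6 * p ^ (r + 2) + 1 := by ring
  rw [this]; linarith

end Stepanov


namespace Weil
open Polynomial Finset

variable {p : ℕ} [Fact p.Prime]

/-- monic polynomials of degree n -/
noncomputable def monicOf (p n : ℕ) [Fact p.Prime] : Finset (ZMod p)[X] :=
  (univ : Finset (Fin n → ZMod p)).image fun c => X ^ n + ∑ i : Fin n, C (c i) * X ^ (i : ℕ)

lemma monicOf_aux (n : ℕ) (c : Fin n → ZMod p) : (∑ i : Fin n, C (c i) * X ^ (i : ℕ)).degree < (n : WithBot ℕ) :=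
  degree_sum_fin_lt c

lemma monicOf_coeff (n : ℕ) (c : Fin n → ZMod p) (i : Fin n) :
    (X ^ n + ∑ i : Fin n, C (c i) * X ^ (i : ℕ)).coeff i = c i := by
  rw [coeff_add, coeff_X_pow, if_neg (by have := i.2; omega), zero_add, finsetSum_coeff]
  rw [Finset.sum_eq_single i]
  · simp
  · intro j _ hj
    rw [coeff_C_mul_X_pow, if_neg]
    intro h; exact hj (Fin.ext h.symm)
  · simp

lemma mem_monicOf {n : ℕ} {h : (ZMod p)[X]} : h ∈ monicOf p n ↔ h.Monic ∧ h.natDegree = n := by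
  constructor
  · intro hh
    obtain ⟨c, -, rfl⟩ := Finset.mem_image.mp hh
    refine ⟨monic_X_pow_add (monicOf_aux n c), ?_⟩
    rw [natDegree_add_eq_left_of_degree_lt, natDegree_X_pow]
    rw [degree_X_pow]; exact monicOf_aux n c
  · rintro ⟨h1, h2⟩
    refine Finset.mem_image.mpr ⟨fun i => h.coeff i, Finset.mem_univ _, ?_⟩
    conv_rhs => rw [h1.as_sum, h2]
    rw [← Fin.sum_univ_eq_sum_range (fun i => C (h.coeff i) * X ^ i)]

lemma sum_monicOf (n : ℕ) (f : (ZMod p)[X] → ℂ) :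
    ∑ h ∈ monicOf p n, f h = ∑ c : Fin n → ZMod p, f (X ^ n + ∑ i : Fin n, C (c i) * X ^ (i : ℕ)) := by
  refine Finset.sum_image ?_
  intro c _ c' _ hcc
  funext i
  have := congrArg (fun q => coeff q (i : ℕ)) hcc
  simpa only [monicOf_coeff] using this

/-- the multiplicative function attached to the Kloosterman sum -/
noncomputable def eta (ψ : AddChar (ZMod p) ℂ) (a b : ZMod p) (h : (ZMod p)[X]) : ℂ :=
  if h.coeff 0 = 0 then 0 else ψ (-(a * h.nextCoeff) - b * (h.coeff 1 / h.coeff 0))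

variable (ψ : AddChar (ZMod p) ℂ) (a b : ZMod p)

lemma eta_mul {g h : (ZMod p)[X]} (hg : g.Monic) (hh : h.Monic) :
    eta ψ a b (g * h) = eta ψ a b g * eta ψ a b h := by
  unfold eta
  rw [mul_coeff_zero]
  by_cases h1 : g.coeff 0 = 0
  · simp [h1]
  by_cases h2 : h.coeff 0 = 0
  · simp [h2]
  rw [if_neg (mul_ne_zero h1 h2), if_neg h1, if_neg h2, ← AddChar.map_add_eq_mul, hg.nextCoeff_mul hh, mul_coeff_one]
  congr 1
  field_simp
  ring

lemma eta_one : eta ψ a b 1 = 1 := by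
  simp [eta, nextCoeff, coeff_one]

lemma eta_pow {g : (ZMod p)[X]} (hg : g.Monic) (n : ℕ) : eta ψ a b (g ^ n) = eta ψ a b g ^ n := by
  induction n with
  | zero => simp [eta_one]
  | succ n ih => rw [pow_succ, eta_mul ψ a b (hg.pow n) hg, ih, pow_succ]

noncomputable def Asum (n : ℕ) : ℂ := ∑ h ∈ monicOf p n, eta ψ a b h

lemma Asum_zero : Asum ψ a b 0 = 1 := by
  rw [Asum, sum_monicOf]; simp [eta_one]

lemma Asum_one : Asum ψ a b 1 = ∑ x : (ZMod p)ˣ, ψ (a * (x : ZMod p) + b * ((x : ZMod p)⁻¹)) := by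
  classical
  rw [Asum, sum_monicOf, ← Equiv.sum_comp (Equiv.funUnique (Fin 1) (ZMod p)).symm]
  have h1 : ∀ c : ZMod p, eta ψ a b (X ^ 1 + ∑ i : Fin 1, C (((Equiv.funUnique (Fin 1) (ZMod p)).symm c) i) * X ^ (i:ℕ))
      = if c = 0 then 0 else ψ (a * (-c) + b * (-c)⁻¹) := by
    intro c
    simp only [Fin.sum_univ_one, Equiv.funUnique_symm_apply, Fin.val_zero, pow_zero, mul_one, pow_one, uniqueElim_const]
    unfold eta
    simp only [coeff_add, coeff_X_zero, coeff_C_zero, zero_add, coeff_X_one, nextCoeff_X_add_C]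
    split_ifs with h
    · rfl
    · congr 1
      rw [coeff_C_ne_zero one_ne_zero]
      field_simp
      ring
  rw [Finset.sum_congr rfl (fun c _ => h1 c)]
  rw [← Equiv.sum_comp (Equiv.neg (ZMod p))]
  simp only [Equiv.neg_apply, neg_eq_zero, neg_neg]
  rw [← Finset.sum_filter_ne_zero] 
  rw [Finset.sum_filter_ne_zero, Finset.sum_ite, Finset.sum_const_zero, zero_add]
  symm
  refine Finset.sum_nbij (fun x : (ZMod p)ˣ => (x : ZMod p)) ?_ ?_ ?_ ?_
  · intro x _; simp
  · intro x _ y _ h; exact Units.ext h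
  · intro x hx
    have : x ≠ 0 := by simpa using hx
    exact ⟨Units.mk0 x this, by simp, rfl⟩
  · intro x _; rfl

lemma Asum_two (hψ : ψ ≠ 1) (ha : a ≠ 0) (hb : b ≠ 0) : Asum ψ a b 2 = p := by
  classical
  rw [Asum, sum_monicOf, ← Equiv.sum_comp (finTwoArrowEquiv (ZMod p)).symm, Fintype.sum_prod_type]
  have h1 : ∀ c d : ZMod p, eta ψ a b (X ^ 2 + ∑ i : Fin 2, C (((finTwoArrowEquiv (ZMod p)).symm (c, d)) i) * X ^ (i:ℕ))
      = if c = 0 then 0 else ψ (-(a + b / c) * d) := by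
    intro c d
    have e0 := monicOf_coeff 2 ((finTwoArrowEquiv (ZMod p)).symm (c, d)) 0
    have e1 := monicOf_coeff 2 ((finTwoArrowEquiv (ZMod p)).symm (c, d)) 1
    have hm : (X ^ 2 + ∑ i : Fin 2, C (((finTwoArrowEquiv (ZMod p)).symm (c, d)) i) * X ^ (i:ℕ)) ∈ monicOf p 2 :=
      Finset.mem_image_of_mem _ (Finset.mem_univ _)
    have hn := (mem_monicOf.mp hm).2
    rw [Fin.val_zero] at e0
    rw [Fin.val_one] at e1
    unfold eta
    rw [nextCoeff_of_natDegree_pos (by omega), hn, e0, e1]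
    simp only [finTwoArrowEquiv_symm_apply, Matrix.cons_val_zero, Matrix.cons_val_one]
    split_ifs with h
    · rfl
    · congr 1; field_simp; ring
  have h2 : ∀ c : ZMod p, ∑ d : ZMod p, (if c = 0 then 0 else ψ (-(a + b / c) * d)) = if c = -b / a then (p:ℂ) else 0 := by
    intro c
    by_cases hc : c = 0
    · subst hc
      rw [if_neg]
      · simp
      · intro h
        exact (div_ne_zero (neg_ne_zero.mpr hb) ha) h.symm
    · simp only [if_neg hc]
      have hprim : ψ.IsPrimitive := AddChar.IsPrimitive.of_ne_one hψ
      have := AddChar.sum_mulShift (-(a + b / c)) hprim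
      simp only [mul_comm _ (-(a + b / c)), ZMod.card] at this
      rw [this]
      have : -(a + b/c) = 0 ↔ c = -b / a := by
        rw [neg_eq_zero, eq_div_iff ha]
        constructor
        · intro h; field_simp at h; linear_combination h
        · intro h; field_simp; linear_combination h
      simp only [this]
      split_ifs <;> simp
  simp only [h1, h2]
  simp

lemma Asum_ge_three (hψ : ψ ≠ 1) (ha : a ≠ 0) (n : ℕ) (hn : 3 ≤ n) : Asum ψ a b n = 0 := by
  classical
  obtain ⟨t, ht⟩ : ∃ t, ψ t ≠ 1 := by
    by_contra hcon; push Not at hcon; exact hψ (by ext x; simp [hcon x])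
  set s : ZMod p := -(t / a) with hs
  have key : Asum ψ a b n = ψ t * Asum ψ a b n := by
    unfold Asum
    rw [Finset.mul_sum]
    symm
    have hmap : ∀ s : ZMod p, ∀ h ∈ monicOf p n, h + C s * X ^ (n - 1) ∈ monicOf p n := by
      intro s h hh
      obtain ⟨h1, h2⟩ := mem_monicOf.mp hh
      have hd : (C s * X ^ (n-1)).degree < h.degree := by
        rw [degree_eq_natDegree h1.ne_zero, h2]
        refine (degree_C_mul_X_pow_le _ _).trans_lt ?_
        exact_mod_cast (by omega : n - 1 < n)
      rw [mem_monicOf]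
      exact ⟨h1.add_of_left hd, by rw [natDegree_add_eq_left_of_degree_lt hd, h2]⟩
    refine Finset.sum_nbij' (fun h => h + C s * X ^ (n-1)) (fun h => h + C (-s) * X ^ (n-1)) (hmap s) (hmap (-s)) ?_ ?_ ?_
    · intro h _; simp
    · intro h _; simp
    · intro h hh
      obtain ⟨h1, h2⟩ := mem_monicOf.mp hh
      obtain ⟨h3, h4⟩ := mem_monicOf.mp (hmap s h hh)
      unfold eta
      rw [nextCoeff_of_natDegree_pos (p := h) (by omega), nextCoeff_of_natDegree_pos (p := h + C s * X ^ (n-1)) (by omega), h2, h4]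
      simp only [coeff_add, coeff_C_mul_X_pow, if_neg (show ¬ (0 = n - 1) by omega), if_neg (show ¬ (1 = n - 1) by omega), if_true, add_zero]
      split_ifs with h0
      · simp
      · rw [← AddChar.map_add_eq_mul]
        congr 1
        rw [hs]; field_simp; ring
  have : (ψ t - 1) * Asum ψ a b n = 0 := by linear_combination -key
  rcases mul_eq_zero.mp this with h | h
  · exact absurd (sub_eq_zero.mp h) ht
  · exact h

/-- monic irreducibles of degree in [1,n] -/
noncomputable def irr (p n : ℕ) [Fact p.Prime] : Finset (ZMod p)[X] := by
  classical exact ((Finset.range (n+1)).biUnion fun k => monicOf p k).filter Irreducible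

lemma mem_irr {n : ℕ} {P : (ZMod p)[X]} : P ∈ irr p n ↔ P.Monic ∧ Irreducible P ∧ P.natDegree ≤ n := by
  classical
  unfold irr
  simp only [Finset.mem_filter, Finset.mem_biUnion, Finset.mem_range, mem_monicOf]
  constructor
  · rintro ⟨⟨k, hk, h1, h2⟩, h3⟩; exact ⟨h1, h3, by omega⟩
  · rintro ⟨h1, h2, h3⟩; exact ⟨⟨_, by omega, h1, rfl⟩, h2⟩

noncomputable def Tsum (k : ℕ) : ℂ :=
  ∑ P ∈ irr p k, if P.natDegree ∣ k then (P.natDegree : ℂ) * eta ψ a b P ^ (k / P.natDegree) else 0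

lemma natDegree_eq_sum {n : ℕ} {h : (ZMod p)[X]} (hm : h.Monic) (hn : h.natDegree = n) [DecidableEq (ZMod p)[X]]
    [DecidableRel (fun x y : (ZMod p)[X] => x ∣ y)] :
    n = ∑ P ∈ irr p n, ∑ j ∈ Finset.Icc 1 n, if P ^ j ∣ h then P.natDegree else 0 := by
  have h0 := hm.ne_zero
  have hP : ∀ P ∈ irr p n, ∑ j ∈ Finset.Icc 1 n, (if P ^ j ∣ h then P.natDegree else 0)
      = (UniqueFactorizationMonoid.normalizedFactors h).count P * P.natDegree := by
    intro P hP
    obtain ⟨h1, h2, h3⟩ := mem_irr.mp hP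
    rw [← Finset.sum_filter, Finset.sum_const, smul_eq_mul]
    congr 1
    have : (Finset.Icc 1 n).filter (fun j => P ^ j ∣ h) = Finset.Icc 1 ((UniqueFactorizationMonoid.normalizedFactors h).count P) := by
      ext j
      rw [Finset.mem_filter, Finset.mem_Icc, Finset.mem_Icc]
      have e1 : P ^ j ∣ h ↔ j ≤ (UniqueFactorizationMonoid.normalizedFactors h).count P := by
        rw [pow_dvd_iff_le_emultiplicity, UniqueFactorizationMonoid.emultiplicity_eq_count_normalizedFactors h2 h0, h1.normalize_eq_self]
        exact Nat.cast_le
      rw [← e1]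
      constructor
      · rintro ⟨⟨a, b⟩, c⟩; exact ⟨a, c⟩
      · rintro ⟨a, c⟩
        refine ⟨⟨a, ?_⟩, c⟩
        have := natDegree_le_of_dvd c h0
        rw [natDegree_pow, hn] at this
        have := h2.natDegree_pos
        nlinarith
    rw [this, Nat.card_Icc]; omega
  rw [Finset.sum_congr rfl hP]
  have hmon : ∀ f ∈ UniqueFactorizationMonoid.normalizedFactors h, f.Monic := by
    intro f hf
    have := UniqueFactorizationMonoid.normalize_normalized_factor f hf
    rw [← this]
    exact monic_normalize (UniqueFactorizationMonoid.ne_zero_of_mem_normalizedFactors hf)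
  have hprod : (UniqueFactorizationMonoid.normalizedFactors h).prod = h := by
    have := UniqueFactorizationMonoid.prod_normalizedFactors_eq h0
    rw [this, hm.normalize_eq_self]
  have hd : n = ((UniqueFactorizationMonoid.normalizedFactors h).map natDegree).sum := by
    rw [← natDegree_multiset_prod_of_monic _ hmon, hprod, hn]
  rw [Finset.sum_multiset_map_count] at hd
  simp only [smul_eq_mul] at hd
  conv_lhs => rw [hd]
  refine Finset.sum_subset ?_ ?_
  · intro f hf
    rw [Multiset.mem_toFinset] at hf
    exact mem_irr.mpr ⟨hmon f hf, UniqueFactorizationMonoid.irreducible_of_normalized_factor f hf,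
      hn ▸ natDegree_le_of_dvd (UniqueFactorizationMonoid.dvd_of_mem_normalizedFactors hf) h0⟩
  · intro f _ hf
    rw [Multiset.mem_toFinset] at hf
    rw [Multiset.count_eq_zero_of_notMem hf, zero_mul]

lemma newton (n : ℕ) : (n : ℂ) * Asum ψ a b n = ∑ k ∈ Finset.Icc 1 n, Tsum ψ a b k * Asum ψ a b (n - k) := by
  classical
  have hL : (n : ℂ) * Asum ψ a b n = ∑ P ∈ irr p n, ∑ j ∈ Finset.Icc 1 n,
      if j * P.natDegree ≤ n then (P.natDegree : ℂ) * eta ψ a b P ^ j * Asum ψ a b (n - j * P.natDegree) else 0 := by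
    have : (n : ℂ) * Asum ψ a b n = ∑ h ∈ monicOf p n, ∑ P ∈ irr p n, ∑ j ∈ Finset.Icc 1 n,
        if P ^ j ∣ h then (P.natDegree : ℂ) * eta ψ a b h else 0 := by
      unfold Asum
      rw [Finset.mul_sum]
      refine Finset.sum_congr rfl fun h hh => ?_
      obtain ⟨h1, h2⟩ := mem_monicOf.mp hh
      conv_lhs => rw [natDegree_eq_sum h1 h2]
      push_cast
      rw [Finset.sum_mul]
      refine Finset.sum_congr rfl fun P _ => ?_
      rw [Finset.sum_mul]
      refine Finset.sum_congr rfl fun j _ => ?_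
      split_ifs <;> simp
    rw [this, Finset.sum_comm]
    refine Finset.sum_congr rfl fun P hP => ?_
    rw [Finset.sum_comm]
    refine Finset.sum_congr rfl fun j hj => ?_
    obtain ⟨hP1, hP2, hP3⟩ := mem_irr.mp hP
    have hPj := hP1.pow j
    split_ifs with hjn
    · unfold Asum
      rw [Finset.mul_sum, ← Finset.sum_filter]
      symm
      refine Finset.sum_nbij (fun g => P ^ j * g) ?_ ?_ ?_ ?_
      · intro g hg
        obtain ⟨g1, g2⟩ := mem_monicOf.mp hg
        rw [Finset.mem_filter, mem_monicOf]
        refine ⟨⟨hPj.mul g1, ?_⟩, dvd_mul_right _ _⟩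
        rw [hPj.natDegree_mul g1, natDegree_pow, g2]; omega
      · intro g _ g' _ hgg
        exact mul_left_cancel₀ hPj.ne_zero hgg
      · intro h hh
        rw [Finset.mem_coe, Finset.mem_filter, mem_monicOf] at hh
        obtain ⟨⟨h1, h2⟩, g, rfl⟩ := hh
        have hg : g.Monic := hPj.of_mul_monic_left h1
        refine ⟨g, ?_, rfl⟩
        rw [Finset.mem_coe, mem_monicOf]
        refine ⟨hg, ?_⟩
        rw [hPj.natDegree_mul hg, natDegree_pow] at h2
        omega
      · intro g hg
        obtain ⟨g1, g2⟩ := mem_monicOf.mp hg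
        rw [eta_mul ψ a b hPj g1, eta_pow ψ a b hP1]; ring
    · refine Finset.sum_eq_zero fun h hh => ?_
      obtain ⟨h1, h2⟩ := mem_monicOf.mp hh
      rw [if_neg]
      intro hd
      have := natDegree_le_of_dvd hd h1.ne_zero
      rw [natDegree_pow, h2] at this
      exact hjn this
  have hR : ∑ k ∈ Finset.Icc 1 n, Tsum ψ a b k * Asum ψ a b (n - k) = ∑ P ∈ irr p n, ∑ k ∈ Finset.Icc 1 n,
      if P.natDegree ∣ k then (P.natDegree : ℂ) * eta ψ a b P ^ (k / P.natDegree) * Asum ψ a b (n - k) else 0 := by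
    rw [Finset.sum_comm]
    refine Finset.sum_congr rfl fun k hk => ?_
    rw [Finset.mem_Icc] at hk
    unfold Tsum
    rw [Finset.sum_mul]
    rw [Finset.sum_subset (s₁ := irr p k) (s₂ := irr p n)]
    · refine Finset.sum_congr rfl fun P _ => ?_
      split_ifs <;> simp
    · intro P hP
      rw [mem_irr] at hP ⊢
      exact ⟨hP.1, hP.2.1, hP.2.2.trans hk.2⟩
    · intro P hP hP'
      rw [mem_irr] at hP hP'
      rw [if_neg, zero_mul]
      intro hd
      exact hP' ⟨hP.1, hP.2.1, Nat.le_of_dvd (by omega) hd⟩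
  rw [hL, hR]
  refine Finset.sum_congr rfl fun P hP => ?_
  obtain ⟨hP1, hP2, hP3⟩ := mem_irr.mp hP
  have hpos := hP2.natDegree_pos
  rw [← Finset.sum_filter, ← Finset.sum_filter]
  refine Finset.sum_nbij (fun j => j * P.natDegree) ?_ ?_ ?_ ?_
  · intro j hj
    simp only [Finset.mem_filter, Finset.mem_Icc] at hj ⊢
    refine ⟨⟨?_, hj.2⟩, dvd_mul_left _ _⟩
    nlinarith
  · intro j _ j' _ h
    exact Nat.eq_of_mul_eq_mul_right hpos h
  · intro k hk
    simp only [Finset.coe_filter, Finset.mem_Icc, Set.mem_setOf_eq] at hk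
    obtain ⟨⟨hk1, hk2⟩, m, rfl⟩ := hk
    refine ⟨m, ?_, mul_comm _ _⟩
    simp only [Finset.coe_filter, Finset.mem_Icc, Set.mem_setOf_eq]
    refine ⟨⟨?_, ?_⟩, by rw [mul_comm]; exact hk2⟩
    · rcases m with _ | m
      · simp at hk1
      · omega
    · nlinarith
  · intro j _
    rw [Nat.mul_div_cancel _ hpos]

end Weil


namespace Weil
open Polynomial Finset IntermediateField

variable {p : ℕ} [Fact p.Prime]

section field
variable {K : Type*} [Field K] [Fintype K] [Algebra (ZMod p) K]

lemma adjoin_inv_eq (x : K) : (ZMod p)⟮x⁻¹⟯ = (ZMod p)⟮x⟯ := by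
  apply le_antisymm
  · rw [adjoin_simple_le_iff]; exact inv_mem (mem_adjoin_simple_self _ _)
  · rw [adjoin_simple_le_iff]
    have := inv_mem (mem_adjoin_simple_self (ZMod p) x⁻¹)
    rwa [inv_inv] at this

lemma minpoly_coeff_zero {x : K} (hx : x ≠ 0) : (minpoly (ZMod p) x).coeff 0 ≠ 0 := by
  intro h
  exact hx ((minpoly.coeff_zero_eq_zero (IsIntegral.of_finite (ZMod p) x)).mp h)

lemma minpoly_inv {x : K} (hx : x ≠ 0) :
    minpoly (ZMod p) x⁻¹ = C ((minpoly (ZMod p) x).coeff 0)⁻¹ * (minpoly (ZMod p) x).reverse := by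
  have h0 := minpoly_coeff_zero (p := p) hx
  set P := minpoly (ZMod p) x with hP
  have hi := IsIntegral.of_finite (ZMod p) x
  have hi' := IsIntegral.of_finite (ZMod p) x⁻¹
  have hlead : P.reverse.leadingCoeff = P.coeff 0 := by
    rw [reverse_leadingCoeff, trailingCoeff, natTrailingDegree_eq_zero.mpr (Or.inr h0)]
  have hnd : P.reverse.natDegree = P.natDegree := by
    rw [reverse_natDegree, natTrailingDegree_eq_zero.mpr (Or.inr h0), Nat.sub_zero]
  have hmon : (C (P.coeff 0)⁻¹ * P.reverse).Monic := by
    rw [Monic, leadingCoeff_mul, leadingCoeff_C, hlead, inv_mul_cancel₀ h0]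
  have hroot : aeval x⁻¹ (C (P.coeff 0)⁻¹ * P.reverse) = 0 := by
    rw [map_mul]
    have : aeval x⁻¹ P.reverse = 0 := by
      have hI : Invertible x := invertibleOfNonzero hx
      have := eval₂_reverse_eq_zero_iff (algebraMap (ZMod p) K) x P
      rw [invOf_eq_inv] at this
      exact this.mpr (minpoly.aeval _ _)
    rw [this, mul_zero]
  symm
  apply eq_of_monic_of_dvd_of_natDegree_le (minpoly.monic hi') hmon (minpoly.dvd _ _ hroot)
  rw [natDegree_C_mul (inv_ne_zero h0), hnd, hP, ← adjoin.finrank hi, ← adjoin.finrank hi', adjoin_inv_eq]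

lemma char_eq (ψ : AddChar (ZMod p) ℂ) (a b : ZMod p) (x : K) (hx : x ≠ 0) :
    ψ (Algebra.trace (ZMod p) K (algebraMap (ZMod p) K a * x + algebraMap (ZMod p) K b * x⁻¹))
     = eta ψ a b (minpoly (ZMod p) x) ^ (Module.finrank (ZMod p) K / (minpoly (ZMod p) x).natDegree) := by
  have h0 := minpoly_coeff_zero (p := p) hx
  have hi := IsIntegral.of_finite (ZMod p) x
  have hdeg : Module.finrank (ZMod p) K / (minpoly (ZMod p) x).natDegree = Module.finrank (ZMod p)⟮x⟯ K := by
    rw [← adjoin.finrank hi]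
    rw [← Module.finrank_mul_finrank (ZMod p) (ZMod p)⟮x⟯ K]
    exact Nat.mul_div_cancel_left _ Module.finrank_pos
  have hinv : (minpoly (ZMod p) x⁻¹).nextCoeff = (minpoly (ZMod p) x).coeff 1 / (minpoly (ZMod p) x).coeff 0 := by
    rw [minpoly_inv hx, nextCoeff_C_mul]
    have : (minpoly (ZMod p) x).reverse.nextCoeff = (minpoly (ZMod p) x).coeff 1 := by
      have hnd : (minpoly (ZMod p) x).reverse.natDegree = (minpoly (ZMod p) x).natDegree := by
        rw [reverse_natDegree, natTrailingDegree_eq_zero.mpr (Or.inr h0), Nat.sub_zero]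
      have hpos := minpoly.natDegree_pos hi
      rw [nextCoeff_of_natDegree_pos (by omega), hnd, coeff_reverse, revAt_le (by omega)]
      congr 1; omega
    rw [this]; field_simp
  rw [hdeg, map_add, ← Algebra.smul_def, ← Algebra.smul_def, map_smul, map_smul, trace_eq_finrank_mul_minpoly_nextCoeff, trace_eq_finrank_mul_minpoly_nextCoeff,
    hinv, adjoin_inv_eq]
  unfold eta
  rw [if_neg h0, ← AddChar.map_nsmul_eq_pow]
  congr 1
  simp only [smul_eq_mul, nsmul_eq_mul]
  ring

lemma card_fiber [DecidableEq K] [DecidableEq (ZMod p)[X]] (k : ℕ) (hk : Module.finrank (ZMod p) K = k) (P : (ZMod p)[X]) (h1 : P.Monic) (h2 : Irreducible P)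
    (hd : P.natDegree ∣ k) : (univ.filter fun x : K => minpoly (ZMod p) x = P).card = P.natDegree := by
  have hcard : Fintype.card K = p ^ k := by
    rw [Module.card_eq_pow_finrank (K := ZMod p), ZMod.card, hk]
  have hdvd : P ∣ X ^ (Nat.card (ZMod p)) ^ k - X := h2.natDegree_dvd_iff_dvd_X_pow_card_pow_sub_X.mp hd
  have hset : (univ.filter fun x : K => minpoly (ZMod p) x = P) = (P.map (algebraMap (ZMod p) K)).roots.toFinset := by
    ext x
    rw [Finset.mem_filter, Multiset.mem_toFinset, mem_roots (Polynomial.map_ne_zero h1.ne_zero), IsRoot.def, eval_map_algebraMap]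
    constructor
    · rintro ⟨_, rfl⟩; exact minpoly.aeval _ _
    · intro h; exact ⟨Finset.mem_univ _, (minpoly.eq_of_irreducible_of_monic h2 h h1).symm⟩
  have hdvd' : P.map (algebraMap (ZMod p) K) ∣ (X ^ Fintype.card K - X : K[X]) := by
    have := Polynomial.map_dvd (algebraMap (ZMod p) K) hdvd
    simpa [Nat.card_eq_fintype_card, ZMod.card, hcard] using this
  have hne : (X ^ Fintype.card K - X : K[X]) ≠ 0 := FiniteField.X_pow_card_sub_X_ne_zero K Fintype.one_lt_card
  have hroots := FiniteField.roots_X_pow_card_sub_X K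
  have hsplit : (X ^ Fintype.card K - X : K[X]).Splits := by
    rw [splits_iff_card_roots, hroots, FiniteField.X_pow_card_sub_X_natDegree_eq K Fintype.one_lt_card]
    simp
  have hs : (P.map (algebraMap (ZMod p) K)).Splits := hsplit.of_dvd hne hdvd'
  have hnodup : (P.map (algebraMap (ZMod p) K)).roots.Nodup := by
    refine Multiset.nodup_of_le (roots.le_of_dvd hne hdvd') ?_
    rw [hroots]; exact Finset.univ.nodup
  rw [hset, Multiset.toFinset_card_of_nodup hnodup, ← hs.natDegree_eq_card_roots, natDegree_map]

lemma sum_eq_Tsum [DecidableEq K] (k : ℕ) (hk1 : 1 ≤ k) (hk : Module.finrank (ZMod p) K = k) (ψ : AddChar (ZMod p) ℂ) (a b : ZMod p) :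
    ∑ x : Kˣ, ψ (Algebra.trace (ZMod p) K (algebraMap (ZMod p) K a * (x : K) + algebraMap (ZMod p) K b * ((x : K)⁻¹)))
      = Tsum ψ a b k := by
  classical
  have hdvd : ∀ x : K, (minpoly (ZMod p) x).natDegree ∣ k := by
    intro x
    rw [← adjoin.finrank (IsIntegral.of_finite (ZMod p) x), ← hk]
    exact ⟨_, (Module.finrank_mul_finrank (ZMod p) (ZMod p)⟮x⟯ K).symm⟩
  have e1 : ∑ x : Kˣ, ψ (Algebra.trace (ZMod p) K (algebraMap (ZMod p) K a * (x : K) + algebraMap (ZMod p) K b * ((x : K)⁻¹)))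
      = ∑ x : K, eta ψ a b (minpoly (ZMod p) x) ^ (k / (minpoly (ZMod p) x).natDegree) := by
    rw [← Finset.sum_subset (Finset.subset_univ (univ.filter fun x : K => x ≠ 0))]
    · refine Finset.sum_nbij (fun x : Kˣ => (x : K)) ?_ ?_ ?_ ?_
      · intro x _; simp
      · intro x _ y _ h; exact Units.ext h
      · intro x hx
        have : x ≠ 0 := by simpa using hx
        exact ⟨Units.mk0 x this, by simp, rfl⟩
      · intro x _
        rw [char_eq ψ a b (x:K) x.ne_zero, hk]
    · intro x _ hx
      have : x = 0 := by simpa using hx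
      subst this
      rw [minpoly.zero, natDegree_X, Nat.div_one]
      simp [eta]; omega
  rw [e1, ← Finset.sum_fiberwise_of_maps_to (s := univ) (t := irr p k) (g := fun x : K => minpoly (ZMod p) x)]
  · unfold Tsum
    refine Finset.sum_congr rfl fun P hP => ?_
    obtain ⟨h1, h2, h3⟩ := mem_irr.mp hP
    rw [Finset.sum_congr rfl (g := fun _ => eta ψ a b P ^ (k / P.natDegree)) (by intro x hx; rw [(Finset.mem_filter.mp hx).2])]
    rw [Finset.sum_const, nsmul_eq_mul]
    split_ifs with hd
    · rw [card_fiber k hk P h1 h2 hd]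
    · rw [Finset.filter_eq_empty_iff.mpr]
      · simp
      · rintro x _ rfl
        exact hd (hdvd x)
  · intro x _
    have hi := IsIntegral.of_finite (ZMod p) x
    exact mem_irr.mpr ⟨minpoly.monic hi, minpoly.irreducible hi, Nat.le_of_dvd (by omega) (hdvd x)⟩

end field

lemma Tsum_bound (ψ : AddChar (ZMod p) ℂ) (hψ : ψ ≠ 1) (a b : ZMod p) (ha : a ≠ 0) (r : ℕ) (hr : 1 ≤ r) :
    ‖Tsum ψ a b (2 * (r + 1))‖ ≤ 7 * p ^ (r + 2) := by
  classical
  have := Fintype.ofFinite (GaloisField p (2 * (r + 1)))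
  have hc : Fintype.card (GaloisField p (2 * (r + 1))) = p ^ (2 * (r + 1)) := by
    rw [← Nat.card_eq_fintype_card, GaloisField.card _ _ (by omega)]
  have h := Stepanov.sum_bound (K := GaloisField p (2 * (r + 1))) p r hr hc ψ hψ a b ha
  rwa [sum_eq_Tsum (K := GaloisField p (2 * (r + 1))) (2 * (r+1)) (by omega) (GaloisField.finrank p (by omega))] at h

lemma exists_roots (s q : ℂ) : ∃ u v : ℂ, u + v = s ∧ u * v = q := by
  obtain ⟨d, hd⟩ := IsAlgClosed.exists_pow_nat_eq (s^2 - 4*q) (n := 2) (by norm_num)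
  exact ⟨(s + d)/2, (s - d)/2, by ring, by linear_combination (-1/4) * hd⟩

lemma norm_le_of (p : ℕ) (hp : 1 ≤ p) (u v : ℂ) (huv : u * v = p)
    (h : ∀ r : ℕ, 1 ≤ r → ‖u ^ (2 * (r + 1)) + v ^ (2 * (r + 1))‖ ≤ 7 * p ^ (r + 2)) : ‖u‖ ^ 2 ≤ p := by
  by_contra hcon
  push Not at hcon
  have hp' : (1:ℝ) ≤ p := by exact_mod_cast hp
  have huv' : ‖u‖ * ‖v‖ = p := by rw [← norm_mul, huv]; simp
  have hv : ‖v‖ ^ 2 ≤ p := by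
    have h1 : ‖u‖^2 * ‖v‖^2 = p^2 := by rw [← mul_pow, huv']
    by_contra hv
    push Not at hv
    nlinarith
  have hb : ∀ r : ℕ, 1 ≤ r → (‖u‖ ^ 2 / p) ^ (r + 1) ≤ 7 * p + 1 := by
    intro r hr
    have h1 := h r hr
    have h2 : ‖u ^ (2 * (r + 1))‖ ≤ ‖u ^ (2 * (r + 1)) + v ^ (2 * (r + 1))‖ + ‖v ^ (2 * (r + 1))‖ := by
      have := norm_sub_le (u ^ (2 * (r + 1)) + v ^ (2 * (r + 1))) (v ^ (2 * (r + 1)))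
      rwa [add_sub_cancel_right] at this
    rw [norm_pow, norm_pow v, pow_mul, pow_mul ‖v‖] at h2
    have h3 : (‖v‖^2)^(r+1) ≤ (p:ℝ)^(r+1) := pow_le_pow_left₀ (by positivity) hv _
    rw [div_pow, div_le_iff₀ (by positivity)]
    calc _ ≤ _ := h2
      _ ≤ 7 * (p:ℝ)^(r+2) + (p:ℝ)^(r+1) := by linarith
      _ = _ := by ring
  have hgt : 1 < ‖u‖^2 / p := by rw [lt_div_iff₀ (by linarith)]; linarith
  obtain ⟨n, hn⟩ := pow_unbounded_of_one_lt (7 * (p:ℝ) + 1) hgt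
  have h1 := hb (n+1) (by omega)
  have h2 : (‖u‖^2 / p)^n ≤ (‖u‖^2/p)^(n+1+1) := pow_le_pow_right₀ hgt.le (by omega)
  linarith

theorem weil (ψ : AddChar (ZMod p) ℂ) (hψ : ψ ≠ 1) (a b : ZMod p) (ha : a ≠ 0) (hb : b ≠ 0) :
    ‖∑ x : (ZMod p)ˣ, ψ (a * (x : ZMod p) + b * ((x : ZMod p)⁻¹))‖ ≤ 2 * Real.sqrt p := by
  have hp : 1 ≤ p := (Fact.out : p.Prime).one_lt.le
  rw [← Asum_one]
  set S := Asum ψ a b 1 with hS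
  have hA0 := Asum_zero ψ a b
  have hA2 := Asum_two ψ a b hψ ha hb
  have hA3 := Asum_ge_three ψ a b hψ ha
  have hT1 : Tsum ψ a b 1 = S := by
    have := newton ψ a b 1
    simp [hA0] at this; rw [hS, this]
  have hT2 : Tsum ψ a b 2 = 2 * p - S ^ 2 := by
    have := newton ψ a b 2
    rw [hA2, Finset.sum_Icc_succ_top (by norm_num)] at this
    simp [hA0, hT1, ← hS] at this
    linear_combination -this
  have hT3 : ∀ n, Tsum ψ a b (n + 3) = - (S * Tsum ψ a b (n+2) + p * Tsum ψ a b (n+1)) := by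
    intro n
    have := newton ψ a b (n+3)
    rw [hA3 (n+3) (by omega), mul_zero, Finset.sum_Icc_succ_top (by omega), Finset.sum_Icc_succ_top (by omega), Finset.sum_Icc_succ_top (by omega),
      Finset.sum_eq_zero] at this
    · rw [show n + 3 - (n+1) = 2 by omega, show n + 3 - (n + 1 + 1) = 1 by omega, show n + 3 - (n+2+1) = 0 by omega, hA0, hA2, ← hS] at this
      linear_combination -this
    · intro k hk
      rw [Finset.mem_Icc] at hk
      rw [hA3 _ (by omega), mul_zero]
  obtain ⟨u, v, huv, huv'⟩ := exists_roots (-S) p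
  have hT : ∀ n, Tsum ψ a b (n+1) = -(u^(n+1) + v^(n+1)) ∧ Tsum ψ a b (n+2) = -(u^(n+2) + v^(n+2)) := by
    intro n
    have hSe : S = -(u+v) := by rw [huv, neg_neg]
    induction n with
    | zero =>
      refine ⟨by rw [zero_add, hT1, hSe]; ring, ?_⟩
      rw [zero_add, hT2, hSe, ← huv']; ring
    | succ n ih =>
      refine ⟨ih.2, ?_⟩
      rw [show n + 1 + 2 = n + 3 by ring, hT3, ih.1, ih.2, hSe, ← huv']; ring
  have hbd : ∀ r : ℕ, 1 ≤ r → ‖u ^ (2 * (r + 1)) + v ^ (2 * (r + 1))‖ ≤ 7 * p ^ (r + 2) := by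
    intro r hr
    have h1 := Tsum_bound ψ hψ a b ha r hr
    have h2 := (hT (2 * r + 1)).1
    rw [show 2 * r + 1 + 1 = 2 * (r+1) by ring] at h2
    rwa [h2, norm_neg] at h1
  have h1 := norm_le_of p hp u v huv' hbd
  have h2 := norm_le_of p hp v u (by rw [mul_comm]; exact huv') (by intro r hr; rw [add_comm]; exact hbd r hr)
  have h3 : ‖S‖ ≤ ‖u‖ + ‖v‖ := by
    rw [← norm_neg, ← huv]; exact norm_add_le _ _
  have := Real.le_sqrt_of_sq_le h1
  have := Real.le_sqrt_of_sq_le h2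
  linarith

end Weil


namespace Kloo
open Finset

/-- Kloosterman sum over a finite commutative ring -/
noncomputable def Kl {R : Type*} [CommRing R] [Fintype R] [DecidableEq R] (ψ : AddChar R ℂ) (m n : R) : ℂ :=
  ∑ x : Rˣ, ψ (m * (x : R) + n * ((x⁻¹ : Rˣ) : R))

lemma Kl_trivial {R : Type*} [CommRing R] [Fintype R] [DecidableEq R] (ψ : AddChar R ℂ) (m n : R) :
    ‖Kl ψ m n‖ ≤ Fintype.card R := by
  unfold Kl
  refine (norm_sum_le _ _).trans ?_
  simp only [AddChar.norm_apply, Finset.sum_const, smul_eq_mul, mul_one, nsmul_eq_mul, Finset.card_univ]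
  exact_mod_cast Fintype.card_le_of_injective _ Units.val_injective

section prod
variable {R S T : Type*} [CommRing R] [Fintype R] [DecidableEq R] [CommRing S] [Fintype S] [DecidableEq S] 
  [CommRing T] [Fintype T] [DecidableEq T]

noncomputable def resL (e : R ≃+* S × T) (ψ : AddChar R ℂ) : AddChar S ℂ :=
  ψ.compAddMonoidHom (e.symm.toAddMonoidHom.comp (AddMonoidHom.inl S T))
noncomputable def resR (e : R ≃+* S × T) (ψ : AddChar R ℂ) : AddChar T ℂ :=
  ψ.compAddMonoidHom (e.symm.toAddMonoidHom.comp (AddMonoidHom.inr S T))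

lemma resL_apply (e : R ≃+* S × T) (ψ : AddChar R ℂ) (s : S) : resL e ψ s = ψ (e.symm (s, 0)) := rfl
lemma resR_apply (e : R ≃+* S × T) (ψ : AddChar R ℂ) (s : T) : resR e ψ s = ψ (e.symm (0, s)) := rfl

lemma res_mul (e : R ≃+* S × T) (ψ : AddChar R ℂ) (x : S × T) : ψ (e.symm x) = resL e ψ x.1 * resR e ψ x.2 := by
  rw [resL_apply, resR_apply, ← AddChar.map_add_eq_mul, ← map_add]
  simp

lemma resL_prim (e : R ≃+* S × T) (ψ : AddChar R ℂ) (h : ψ.IsPrimitive) : (resL e ψ).IsPrimitive := by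
  intro s hs hcon
  refine h (a := e.symm (s, 0)) ?_ ?_
  · intro h0
    have : (s, (0:T)) = 0 := by
      rw [← e.apply_symm_apply (s, 0), h0, map_zero]
    exact hs (congrArg Prod.fst this)
  · ext x
    have := DFunLike.congr_fun hcon (e x).1
    rw [AddChar.mulShift_apply, resL_apply] at this
    rw [AddChar.mulShift_apply]
    conv_lhs => rw [← e.symm_apply_apply x, ← map_mul]
    rw [show ((s, (0:T)) * e x) = (s * (e x).1, 0) by ext <;> simp]
    rw [this]; rfl

lemma resR_prim (e : R ≃+* S × T) (ψ : AddChar R ℂ) (h : ψ.IsPrimitive) : (resR e ψ).IsPrimitive := by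
  intro s hs hcon
  refine h (a := e.symm (0, s)) ?_ ?_
  · intro h0
    have : ((0:S), s) = 0 := by
      rw [← e.apply_symm_apply (0, s), h0, map_zero]
    exact hs (congrArg Prod.snd this)
  · ext x
    have := DFunLike.congr_fun hcon (e x).2
    rw [AddChar.mulShift_apply, resR_apply] at this
    rw [AddChar.mulShift_apply]
    conv_lhs => rw [← e.symm_apply_apply x, ← map_mul]
    rw [show (((0:S), s) * e x) = (0, s * (e x).2) by ext <;> simp]
    rw [this]; rfl

lemma Kl_prod (e : R ≃+* S × T) (ψ : AddChar R ℂ) (m n : R) :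
    Kl ψ m n = Kl (resL e ψ) (e m).1 (e n).1 * Kl (resR e ψ) (e m).2 (e n).2 := by
  unfold Kl
  rw [Finset.sum_mul_sum, ← Fintype.sum_prod_type']
  rw [← Equiv.sum_comp ((Units.mapEquiv e.toMulEquiv).trans MulEquiv.prodUnits).toEquiv]
  refine Finset.sum_congr rfl fun x _ => ?_
  have h := res_mul e ψ (e (m * (x : R) + n * ((x⁻¹ : Rˣ) : R)))
  rw [e.symm_apply_apply] at h
  rw [h]
  simp [MulEquiv.prodUnits, map_add, map_mul]
  rfl

end prod

/-- the bound predicate -/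
def Good (c : ℕ) : Prop := ∃ u v s : ℕ, c = u ^ 2 * v ^ 3 * s ∧
  ∀ (_ : NeZero c) (ψ : AddChar (ZMod c) ℂ), ψ.IsPrimitive → ∀ m n : ZMod c,
    ‖Kl ψ m n‖ ≤ c.divisors.card * Real.sqrt (c * (u ^ 2 * v ^ 3 : ℕ)) * Nat.gcd n.val c

lemma good_trivial (c u v : ℕ) (h : c = u ^ 2 * v ^ 3) : Good c := by
  refine ⟨u, v, 1, by simpa using h, ?_⟩
  intro _ ψ hψ m n
  have hc := NeZero.pos c
  rw [← h]
  refine (Kl_trivial ψ m n).trans ?_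
  rw [ZMod.card, Real.sqrt_mul_self (by positivity)]
  have h1 : 1 ≤ c.divisors.card := Finset.card_pos.mpr ⟨1, by simp; omega⟩
  have h2 : 1 ≤ Nat.gcd n.val c := Nat.gcd_pos_of_pos_right _ hc
  have h1' : (1:ℝ) ≤ c.divisors.card := by exact_mod_cast h1
  have h2' : (1:ℝ) ≤ Nat.gcd n.val c := by exact_mod_cast h2
  have hc' : (0:ℝ) ≤ c := by positivity
  calc (c:ℝ) = 1 * c * 1 := by ring
    _ ≤ _ := by gcongr

lemma Kl_zero_left {R : Type*} [CommRing R] [Fintype R] [DecidableEq R] (ψ : AddChar R ℂ) (n : R) :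
    Kl ψ 0 n = Kl ψ n 0 := by
  unfold Kl
  rw [← Equiv.sum_comp (Equiv.inv Rˣ)]
  simp

lemma good_prime (p : ℕ) (hp : p.Prime) : Good p := by
  refine ⟨1, 1, p, by simp, ?_⟩
  intro _ ψ hψ m n
  have : Fact p.Prime := ⟨hp⟩
  have hp1 : (1:ℝ) ≤ p := by exact_mod_cast hp.one_lt.le
  have hs1 : 1 ≤ Real.sqrt p := Real.one_le_sqrt.mpr hp1
  have hd : (p.divisors.card : ℝ) = 2 := by
    rw [hp.divisors, Finset.card_pair hp.one_lt.ne]; norm_num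
  rw [hd, show ((p:ℝ) * ((1 ^ 2 * 1 ^ 3 : ℕ) : ℝ)) = p by simp]
  by_cases hn : n = 0
  · subst hn
    refine (Kl_trivial ψ m 0).trans ?_
    rw [ZMod.card, ZMod.val_zero, Nat.gcd_zero_left]
    nlinarith
  have hg : (1:ℝ) ≤ Nat.gcd n.val p := by exact_mod_cast Nat.gcd_pos_of_pos_right _ hp.pos
  suffices h : ‖Kl ψ m n‖ ≤ 2 * Real.sqrt p by
    refine h.trans ?_
    nlinarith
  by_cases hm : m = 0
  · subst hm
    rw [Kl_zero_left]
    have h1 : Kl ψ n 0 = -1 := by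
      unfold Kl
      have e := AddChar.sum_mulShift n hψ
      rw [if_neg hn, ← Finset.sum_erase_add _ _ (Finset.mem_univ (0 : ZMod p))] at e
      rw [zero_mul, AddChar.map_zero_eq_one] at e
      have e2 : ∑ x : (ZMod p)ˣ, ψ (n * (x:ZMod p) + 0 * ((x⁻¹ : (ZMod p)ˣ) : ZMod p)) = ∑ x ∈ univ.erase (0 : ZMod p), ψ (x * n) := by
        refine Finset.sum_nbij (fun x : (ZMod p)ˣ => (x : ZMod p)) ?_ ?_ ?_ ?_
        · intro x _; simp
        · intro x _ y _ h; exact Units.ext h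
        · intro x hx
          have : x ≠ 0 := by simpa using hx
          exact ⟨Units.mk0 x this, by simp, rfl⟩
        · intro x _; rw [zero_mul, add_zero, mul_comm]
      rw [e2]
      have e' : ∑ x ∈ univ.erase (0 : ZMod p), ψ (x * n) + 1 = 0 := by rw [e]; simp
      linear_combination e'
    rw [h1]; simp; linarith
  · have hne : ψ ≠ 1 := by
      rintro rfl
      exact hψ (a := 1) one_ne_zero (by ext x; simp)
    have := Weil.weil ψ hne m n hm hn
    unfold Kl
    refine le_trans (le_of_eq ?_) this
    congr 1
    refine Finset.sum_congr rfl fun x _ => ?_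
    rw [Units.val_inv_eq_inv_val]

lemma good_mul (a b : ℕ) (ha : 1 < a) (hb : 1 < b) (hab : a.Coprime b) (h1 : Good a) (h2 : Good b) : Good (a * b) := by
  obtain ⟨u1, v1, s1, e1, B1⟩ := h1
  obtain ⟨u2, v2, s2, e2, B2⟩ := h2
  refine ⟨u1 * u2, v1 * v2, s1 * s2, by rw [e1, e2]; ring, ?_⟩
  intro _ ψ hψ m n
  have ha0 : NeZero a := ⟨by omega⟩
  have hb0 : NeZero b := ⟨by omega⟩
  let e := ZMod.chineseRemainder hab
  rw [Kl_prod e, norm_mul]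
  have C1 := B1 ha0 _ (resL_prim e ψ hψ) (e m).1 (e n).1
  have C2 := B2 hb0 _ (resR_prim e ψ hψ) (e m).2 (e n).2
  have g1 : Nat.gcd (e n).1.val a = Nat.gcd n.val a := by
    have : (e n).1 = ((n.val : ℕ) : ZMod a) := by
      conv_lhs => rw [← ZMod.natCast_zmod_val n, map_natCast]
      rfl
    rw [this, ZMod.val_natCast, ← Nat.gcd_rec, Nat.gcd_comm]
  have g2 : Nat.gcd (e n).2.val b = Nat.gcd n.val b := by
    have : (e n).2 = ((n.val : ℕ) : ZMod b) := by
      conv_lhs => rw [← ZMod.natCast_zmod_val n, map_natCast]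
      rfl
    rw [this, ZMod.val_natCast, ← Nat.gcd_rec, Nat.gcd_comm]
  rw [g1] at C1
  rw [g2] at C2
  refine (mul_le_mul C1 C2 (norm_nonneg _) (by positivity)).trans (le_of_eq ?_)
  rw [Nat.Coprime.gcd_mul _ hab, hab.card_divisors_mul]
  rw [show ((a * b : ℕ) : ℝ) * (((u1 * u2)^2 * (v1 * v2)^3 : ℕ):ℝ) = ((a:ℝ) * (u1 ^ 2 * v1 ^ 3 : ℕ)) * ((b:ℝ) * (u2 ^ 2 * v2 ^ 3 : ℕ)) by push_cast; ring]
  rw [Real.sqrt_mul (x := (a:ℝ) * (u1 ^ 2 * v1 ^ 3 : ℕ)) (by positivity) ((b:ℝ) * (u2 ^ 2 * v2 ^ 3 : ℕ))]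
  rw [Nat.cast_mul (n.val.gcd a), Nat.cast_mul (a.divisors.card)]
  ring

theorem good (c : ℕ) (hc : 1 ≤ c) : Good c := by
  induction c using Nat.recOnPosPrimePosCoprime with
  | zero => omega
  | one => exact good_trivial 1 1 1 (by norm_num)
  | prime_pow p n hp hn =>
    rcases Nat.even_or_odd' n with ⟨k, hk | hk⟩
    · exact good_trivial _ (p^k) 1 (by rw [hk]; ring)
    · rcases k with _ | k
      · rw [hk]; simpa using good_prime p hp
      · exact good_trivial _ (p^k) p (by rw [hk]; ring)
  | coprime a b ha hb hab h1 h2 => exact good_mul a b ha hb hab (h1 (by omega)) (h2 (by omega))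

end Kloo


namespace Four
open Finset Kloo

variable {c : ℕ} [NeZero c]


noncomputable def ft (f : ZMod c → ℂ) (k : ZMod c) : ℂ := ∑ z, f z * (ZMod.stdAddChar : AddChar (ZMod c) ℂ) (-(k * z))

lemma inversion (f : ZMod c → ℂ) (y : ZMod c) : (c:ℂ) * f y = ∑ k, ft f k * (ZMod.stdAddChar : AddChar (ZMod c) ℂ) (k * y) := by
  unfold ft
  simp_rw [Finset.sum_mul]
  rw [Finset.sum_comm]
  have h : ∀ z, ∑ k : ZMod c, f z * (ZMod.stdAddChar : AddChar (ZMod c) ℂ) (-(k * z)) * (ZMod.stdAddChar : AddChar (ZMod c) ℂ) (k * y) = f z * (if y - z = 0 then (c:ℂ) else 0) := by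
    intro z
    have := AddChar.sum_mulShift (y - z) (ZMod.isPrimitive_stdAddChar c)
    rw [ZMod.card] at this
    rw [show (if y - z = 0 then (c:ℂ) else 0) = ((if y - z = 0 then c else 0 : ℕ) : ℂ) by split_ifs <;> simp]
    rw [← this, Finset.mul_sum]
    refine Finset.sum_congr rfl fun k _ => ?_
    rw [mul_assoc, ← AddChar.map_add_eq_mul]
    congr 2; ring
  rw [Finset.sum_congr rfl fun z _ => h z, Finset.sum_eq_single y]
  · simp [mul_comm]
  · intro z _ hz
    rw [if_neg (sub_ne_zero.mpr hz.symm), mul_zero]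
  · simp

lemma sum_val (f : ℕ → ℝ) : ∑ k ∈ univ.filter (fun k : ZMod c => k ≠ 0), f k.val = ∑ j ∈ Ico 1 c, f j := by
  refine Finset.sum_nbij (fun k : ZMod c => k.val) ?_ ?_ ?_ ?_
  · intro k hk
    have : k ≠ 0 := by simpa using hk
    rw [Finset.mem_Ico]
    refine ⟨?_, ZMod.val_lt k⟩
    have := (ZMod.val_ne_zero k).mpr this
    omega
  · intro k _ k' _ h; exact ZMod.val_injective c h
  · intro j hj
    rw [Finset.mem_coe, Finset.mem_Ico] at hj
    refine ⟨(j : ZMod c), ?_, ZMod.val_cast_of_lt hj.2⟩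
    rw [Finset.mem_coe, Finset.mem_filter]
    refine ⟨Finset.mem_univ _, ?_⟩
    intro h
    have := ZMod.val_cast_of_lt hj.2
    rw [h, ZMod.val_zero] at this
    omega
  · intros; rfl

lemma norm_lower (k : ZMod c) (hk : k ≠ 0) :
    0 < ‖1 - (ZMod.stdAddChar : AddChar (ZMod c) ℂ) k‖ ∧ 1 / ‖1 - (ZMod.stdAddChar : AddChar (ZMod c) ℂ) k‖ ≤ (c:ℝ) / 4 * (1 / (k.val:ℝ) + 1 / ((c:ℝ) - k.val)) := by
  have hc : (0:ℝ) < c := by exact_mod_cast NeZero.pos c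
  have h1 : k.val < c := ZMod.val_lt k
  have h0 : 0 < k.val := Nat.pos_of_ne_zero ((ZMod.val_ne_zero k).mpr hk)
  have h1' : (k.val:ℝ) < c := by exact_mod_cast h1
  have h0' : (0:ℝ) < k.val := by exact_mod_cast h0
  have e : ‖1 - (ZMod.stdAddChar : AddChar (ZMod c) ℂ) k‖ = 2 * Real.sin (Real.pi * k.val / c) := by
    rw [ZMod.stdAddChar_apply, ZMod.toCircle_apply, norm_sub_rev]
    rw [show (2 * (Real.pi:ℂ) * Complex.I * (k.val:ℂ) / (c:ℂ)) = Complex.I * ((2 * (Real.pi * k.val / c) : ℝ) : ℂ) by push_cast; ring]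
    rw [Complex.norm_exp_I_mul_ofReal_sub_one, Real.norm_of_nonneg]
    · congr 2; ring
    · apply mul_nonneg (by norm_num)
      apply Real.sin_nonneg_of_nonneg_of_le_pi
      · positivity
      · rw [show 2 * (Real.pi * k.val / c) / 2 = Real.pi * (k.val / c) by ring]
        have : (k.val:ℝ)/c ≤ 1 := by rw [div_le_one hc]; exact h1'.le
        nlinarith [Real.pi_pos]
  have hpi := Real.pi_pos
  set a : ℝ := ((k.val : ℕ) : ℝ)
  have hb : 0 < (c:ℝ) - a := by linarith
  have key : ∀ x : ℝ, 0 < x → x ≤ c/2 → 4 * x / c ≤ 2 * Real.sin (Real.pi * x / c) := by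
    intro x hx hx2
    have := Real.mul_le_sin (x := Real.pi * x / c) (by positivity) (by
      rw [div_le_div_iff₀ hc (by norm_num)]; nlinarith)
    have e2 : 2 / Real.pi * (Real.pi * x / c) = 2 * x / c := by field_simp
    rw [e2] at this
    calc 4 * x / c = 2 * (2 * x / c) := by ring
      _ ≤ _ := by linarith
  rw [e]
  have main : ∀ x : ℝ, 0 < x → x ≤ c/2 → 4 * x / c ≤ 2 * Real.sin (Real.pi * a / c) → 
      0 < 2 * Real.sin (Real.pi * a / c) ∧ 1 / (2 * Real.sin (Real.pi * a / c)) ≤ c / 4 * (1 / x) := by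
    intro x hx _ h
    have hp : 0 < 4 * x / c := by positivity
    refine ⟨by linarith, ?_⟩
    calc 1 / (2 * Real.sin (Real.pi * a / c)) ≤ 1 / (4 * x / c) := one_div_le_one_div_of_le hp h
      _ = _ := by field_simp
  rcases le_total a (c/2) with h | h
  · obtain ⟨m1, m2⟩ := main a h0' h (key a h0' h)
    refine ⟨m1, m2.trans ?_⟩
    apply mul_le_mul_of_nonneg_left _ (by positivity)
    have : 0 < 1 / ((c:ℝ) - a) := by positivity
    linarith
  · have e3 : Real.sin (Real.pi * a / c) = Real.sin (Real.pi * (c - a) / c) := by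
      rw [← Real.sin_pi_sub]; congr 1; field_simp
    obtain ⟨m1, m2⟩ := main (c - a) hb (by linarith) (by rw [e3]; exact key _ hb (by linarith))
    refine ⟨m1, m2.trans ?_⟩
    apply mul_le_mul_of_nonneg_left _ (by positivity)
    have : 0 < 1 / a := by positivity
    linarith

/-- sum of 1/‖1-(ZMod.stdAddChar : AddChar (ZMod c) ℂ) k‖ times a symmetric weight -/
lemma sum_inv_bound (w : ℕ → ℝ) (hw : ∀ j, 0 ≤ w j) (hsym : ∀ j ∈ Ico 1 c, w (c - j) = w j) :
    ∑ k ∈ univ.filter (fun k : ZMod c => k ≠ 0), 1 / ‖1 - (ZMod.stdAddChar : AddChar (ZMod c) ℂ) k‖ * w k.val ≤ (c:ℝ) / 2 * ∑ j ∈ Ico 1 c, w j / j := by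
  have h1 : ∑ k ∈ univ.filter (fun k : ZMod c => k ≠ 0), 1 / ‖1 - (ZMod.stdAddChar : AddChar (ZMod c) ℂ) k‖ * w k.val
      ≤ ∑ k ∈ univ.filter (fun k : ZMod c => k ≠ 0), (c:ℝ) / 4 * (1 / (k.val:ℝ) + 1 / ((c:ℝ) - k.val)) * w k.val := by
    refine Finset.sum_le_sum fun k hk => ?_
    have : k ≠ 0 := by simpa using hk
    exact mul_le_mul_of_nonneg_right (norm_lower k this).2 (hw _)
  refine h1.trans (le_of_eq ?_)
  rw [sum_val (fun j => (c:ℝ) / 4 * (1 / (j:ℝ) + 1 / ((c:ℝ) - j)) * w j)]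
  have h2 : ∑ j ∈ Ico 1 c, w j / ((c:ℝ) - j) = ∑ j ∈ Ico 1 c, w j / j := by
    refine Finset.sum_nbij' (fun j => c - j) (fun j => c - j) ?_ ?_ ?_ ?_ ?_
    · intro j hj; rw [Finset.mem_Ico] at *; omega
    · intro j hj; rw [Finset.mem_Ico] at *; omega
    · intro j hj; rw [Finset.mem_Ico] at *; omega
    · intro j hj; rw [Finset.mem_Ico] at *; omega
    · intro j hj
      rw [hsym j hj]
      rw [Finset.mem_Ico] at hj
      rw [Nat.cast_sub hj.2.le]
  calc _ = (c:ℝ)/4 * (∑ j ∈ Ico 1 c, w j / j + ∑ j ∈ Ico 1 c, w j / ((c:ℝ) - j)) := by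
        rw [← Finset.sum_add_distrib, Finset.mul_sum]
        refine Finset.sum_congr rfl fun j _ => ?_
        ring
    _ = _ := by rw [h2]; ring

lemma harm_le (n : ℕ) : ∑ j ∈ Ico 1 n, 1 / (j:ℝ) ≤ 1 + Real.log n := by
  rcases n with _ | n
  · simp
  · have h := harmonic_le_one_add_log n
    rw [harmonic_eq_sum_Icc] at h
    push_cast at h
    have e : Ico 1 (n+1) = Icc 1 n := by ext; simp [Finset.mem_Ico, Finset.mem_Icc]
    rw [e]
    simp only [one_div]
    refine h.trans ?_
    rcases Nat.eq_zero_or_pos n with h0 | h0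
    · subst h0; simp
    · have : Real.log n ≤ Real.log ((n+1 : ℕ):ℝ) := Real.log_le_log (by exact_mod_cast h0) (by push_cast; linarith)
      linarith

lemma gcd_sum (n : ℕ) (hn : 1 ≤ n) : ∑ j ∈ Ico 1 n, (Nat.gcd j n : ℝ) / j ≤ n.divisors.card * (1 + Real.log n) := by
  have h1 : ∀ j ∈ Ico 1 n, (Nat.gcd j n : ℝ) / j ≤ ∑ g ∈ n.divisors, if g ∣ j then (g:ℝ) / j else 0 := by
    intro j hj
    have hm : Nat.gcd j n ∈ n.divisors := by
      rw [Nat.mem_divisors]; exact ⟨Nat.gcd_dvd_right _ _, by omega⟩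
    have := Finset.single_le_sum (f := fun g : ℕ => if g ∣ j then (g:ℝ) / j else 0) (s := n.divisors)
      (fun g _ => by split_ifs <;> positivity) hm
    rwa [if_pos (Nat.gcd_dvd_left j n)] at this
  refine (Finset.sum_le_sum h1).trans ?_
  rw [Finset.sum_comm, ← nsmul_eq_mul]
  refine Finset.sum_le_card_nsmul _ _ _ fun g hg => ?_
  have hg0 : 0 < g := Nat.pos_of_mem_divisors hg
  rw [← Finset.sum_filter]
  refine le_trans ?_ (harm_le n)
  have : ∑ j ∈ (Ico 1 n).filter (fun j => g ∣ j), (g:ℝ) / j = ∑ i ∈ ((Ico 1 n).filter (fun j => g ∣ j)).image (fun j => j / g), 1 / (i:ℝ) := by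
    rw [Finset.sum_image]
    · refine Finset.sum_congr rfl fun j hj => ?_
      obtain ⟨h1, i, rfl⟩ := Finset.mem_filter.mp hj
      rw [Nat.mul_div_cancel_left _ hg0]
      push_cast
      have : (g:ℝ) ≠ 0 := by positivity
      rw [div_mul_eq_div_div, div_self this]
    · intro j hj j' hj' h
      obtain ⟨_, i, rfl⟩ := Finset.mem_filter.mp hj
      obtain ⟨_, i', rfl⟩ := Finset.mem_filter.mp hj'
      dsimp only at h
      rw [Nat.mul_div_cancel_left _ hg0, Nat.mul_div_cancel_left _ hg0] at h
      rw [h]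
  rw [this]
  refine Finset.sum_le_sum_of_subset_of_nonneg ?_ (fun _ _ _ => by positivity)
  intro i hi
  obtain ⟨j, hj, rfl⟩ := Finset.mem_image.mp hi
  obtain ⟨h1, i, rfl⟩ := Finset.mem_filter.mp hj
  rw [Nat.mul_div_cancel_left _ hg0]
  rw [Finset.mem_Ico] at *
  refine ⟨?_, ?_⟩
  · rcases i with _ | i
    · simp at h1
    · omega
  · nlinarith

/-- Fourier transform of val -/
lemma ft_val (k : ZMod c) (hk : k ≠ 0) : ‖ft (fun z : ZMod c => (z.val : ℂ)) k‖ = c * (1 / ‖1 - (ZMod.stdAddChar : AddChar (ZMod c) ℂ) k‖) := by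
  set V := ft (fun z : ZMod c => (z.val : ℂ)) k with hV
  have hval : ∀ z : ZMod c, (((z + 1).val : ℕ) : ℂ) = (z.val : ℂ) + 1 - (if z = -1 then (c:ℂ) else 0) := by
    intro z
    split_ifs with h
    · subst h
      rw [neg_add_cancel, ZMod.val_zero]
      have : (-1 : ZMod c).val + 1 = c := by
        obtain ⟨m, hm⟩ : ∃ m, c = m + 1 := ⟨c - 1, by have := NeZero.pos c; omega⟩
        subst hm
        rw [ZMod.val_neg_one]
      have h2 : (((-1 : ZMod c).val : ℕ) : ℂ) + 1 = c := by exact_mod_cast this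
      rw [h2]; simp
    · rcases Nat.lt_or_ge 1 c with hc1 | hc1
      · have : Fact (1 < c) := ⟨hc1⟩
        have hlt : z.val + (1 : ZMod c).val < c := by
          rw [ZMod.val_one]
          have h1 := ZMod.val_lt z
          by_contra hcon
          have h2 : z.val + 1 = c := by omega
          apply h
          have : ((z.val + 1 : ℕ) : ZMod c) = 0 := by rw [h2]; exact ZMod.natCast_self c
          push_cast at this
          rw [ZMod.natCast_zmod_val] at this
          exact eq_neg_of_add_eq_zero_left this
        rw [ZMod.val_add_of_lt hlt, ZMod.val_one]; push_cast; ring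
      · exfalso
        have h1 : c = 1 := by have := NeZero.pos c; omega
        subst h1
        exact h (Subsingleton.elim _ _)
  have e1 : V = ∑ z : ZMod c, ((z + 1).val : ℂ) * (ZMod.stdAddChar : AddChar (ZMod c) ℂ) (-(k * (z+1))) := by
    rw [hV]; unfold ft
    exact (Equiv.sum_comp (Equiv.addRight (1 : ZMod c)) (fun z => ((z.val : ℕ) : ℂ) * (ZMod.stdAddChar : AddChar (ZMod c) ℂ) (-(k * z)))).symm
  have e2 : ∑ z : ZMod c, (ZMod.stdAddChar : AddChar (ZMod c) ℂ) (-(k * (z+1))) = 0 := by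
    have := AddChar.sum_mulShift (-k) (ZMod.isPrimitive_stdAddChar c)
    rw [if_neg (neg_ne_zero.mpr hk)] at this
    rw [← Equiv.sum_comp (Equiv.addRight (1 : ZMod c))] at this
    simp only [Equiv.coe_addRight] at this
    rw [Nat.cast_zero] at this
    rw [← this]
    refine Finset.sum_congr rfl fun z _ => ?_
    congr 1; ring
  have e3 : V = (ZMod.stdAddChar : AddChar (ZMod c) ℂ) (-k) * V + 0 - c := by
    conv_lhs => rw [e1]
    simp_rw [hval, sub_mul, add_mul, one_mul]
    rw [Finset.sum_sub_distrib, Finset.sum_add_distrib, e2]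
    congr 1
    · congr 1
      rw [hV]; unfold ft
      rw [Finset.mul_sum]
      refine Finset.sum_congr rfl fun z _ => ?_
      rw [mul_left_comm, ← AddChar.map_add_eq_mul]
      congr 2; ring
    · rw [Finset.sum_eq_single (-1)]
      · simp
      · intro z _ hz; simp [hz]
      · simp
  have hne := (norm_lower k hk).1
  have e4 : (1 - (ZMod.stdAddChar : AddChar (ZMod c) ℂ) k) * V = (ZMod.stdAddChar : AddChar (ZMod c) ℂ) k * c := by
    have h1 : (ZMod.stdAddChar : AddChar (ZMod c) ℂ) k * (ZMod.stdAddChar : AddChar (ZMod c) ℂ) (-k) = 1 := by rw [← AddChar.map_add_eq_mul, add_neg_cancel, AddChar.map_zero_eq_one]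
    linear_combination (-(ZMod.stdAddChar : AddChar (ZMod c) ℂ) k) * e3 - V * h1
  have e5 : ‖1 - (ZMod.stdAddChar : AddChar (ZMod c) ℂ) k‖ * ‖V‖ = c := by
    rw [← norm_mul, e4, norm_mul, AddChar.norm_apply]; simp
  rw [← e5]; field_simp

noncomputable def ind (d0 d1 : ℕ) (z : ZMod c) : ℂ := if d0 ≤ z.val ∧ z.val < d1 then 1 else 0

lemma ft_ind (d0 d1 : ℕ) (hd : d1 ≤ c) (k : ZMod c) (hk : k ≠ 0) : ‖ft (ind (c := c) d0 d1) k‖ ≤ 2 * (1 / ‖1 - (ZMod.stdAddChar : AddChar (ZMod c) ℂ) k‖) := by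
  have e1 : ft (ind (c := c) d0 d1) k = ∑ j ∈ Ico d0 d1, (ZMod.stdAddChar : AddChar (ZMod c) ℂ) (-k) ^ j := by
    unfold ft ind
    simp_rw [ite_mul, one_mul, zero_mul]
    rw [← Finset.sum_filter]
    refine Finset.sum_nbij (fun z => z.val) ?_ ?_ ?_ ?_
    · intro z hz; simpa using hz
    · intro z _ z' _ h; exact ZMod.val_injective c h
    · intro j hj
      rw [Finset.mem_coe, Finset.mem_Ico] at hj
      have := ZMod.val_cast_of_lt (lt_of_lt_of_le hj.2 hd)
      refine ⟨(j : ZMod c), ?_, this⟩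
      simp [this, hj.1, hj.2]
    · intro z _
      rw [← AddChar.map_nsmul_eq_pow]
      congr 1
      rw [nsmul_eq_mul, ZMod.natCast_zmod_val]; ring
  have hne := (norm_lower k hk).1
  have hn : ‖1 - (ZMod.stdAddChar : AddChar (ZMod c) ℂ) (-k)‖ = ‖1 - (ZMod.stdAddChar : AddChar (ZMod c) ℂ) k‖ := by
    have : 1 - (ZMod.stdAddChar : AddChar (ZMod c) ℂ) (-k) = - (ZMod.stdAddChar : AddChar (ZMod c) ℂ) (-k) * (1 - (ZMod.stdAddChar : AddChar (ZMod c) ℂ) k) := by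
      have h1 : (ZMod.stdAddChar : AddChar (ZMod c) ℂ) k * (ZMod.stdAddChar : AddChar (ZMod c) ℂ) (-k) = 1 := by rw [← AddChar.map_add_eq_mul, add_neg_cancel, AddChar.map_zero_eq_one]
      linear_combination -h1
    rw [this, norm_mul, norm_neg, AddChar.norm_apply, one_mul]
  rw [e1]
  rcases le_total d0 d1 with h | h
  · have := geom_sum_Ico_mul ((ZMod.stdAddChar : AddChar (ZMod c) ℂ) (-k)) h
    have h2 : ‖∑ j ∈ Ico d0 d1, (ZMod.stdAddChar : AddChar (ZMod c) ℂ) (-k) ^ j‖ * ‖1 - (ZMod.stdAddChar : AddChar (ZMod c) ℂ) k‖ ≤ 2 := by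
      rw [← hn, norm_sub_rev, ← norm_mul, this]
      refine (norm_sub_le _ _).trans ?_
      rw [norm_pow, norm_pow, AddChar.norm_apply]; norm_num
    rw [← div_eq_mul_one_div, le_div_iff₀ hne]; exact h2
  · rw [Finset.Ico_eq_empty_of_le h]; simp

lemma ft_ind_zero (d0 d1 : ℕ) : ‖ft (ind (c := c) d0 d1) 0‖ ≤ c := by
  unfold ft ind
  refine (norm_sum_le _ _).trans ?_
  calc _ ≤ ∑ z : ZMod c, (1:ℝ) := by
        refine Finset.sum_le_sum fun z _ => ?_
        split_ifs <;> simp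
    _ = c := by simp [ZMod.card]

lemma ft_ind_sum (d0 d1 : ℕ) (hd : d1 ≤ c) : ∑ l, ‖ft (ind (c := c) d0 d1) l‖ ≤ c * (2 + Real.log c) := by
  rw [← Finset.sum_filter_add_sum_filter_not univ (fun k : ZMod c => k ≠ 0)]
  have h2 : ∑ k ∈ univ.filter (fun k : ZMod c => ¬ (k ≠ 0)), ‖ft (ind (c := c) d0 d1) k‖ ≤ c := by
    have : univ.filter (fun k : ZMod c => ¬ (k ≠ 0)) = {0} := by ext; simp
    rw [this, Finset.sum_singleton]; exact ft_ind_zero d0 d1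
  have h1 : ∑ k ∈ univ.filter (fun k : ZMod c => k ≠ 0), ‖ft (ind (c := c) d0 d1) k‖ ≤ c * (1 + Real.log c) := by
    have := sum_inv_bound (c := c) (fun _ => 2) (by norm_num) (by simp)
    calc _ ≤ ∑ k ∈ univ.filter (fun k : ZMod c => k ≠ 0), 1 / ‖1 - (ZMod.stdAddChar : AddChar (ZMod c) ℂ) k‖ * 2 := by
          refine Finset.sum_le_sum fun k hk => ?_
          have : k ≠ 0 := by simpa using hk
          rw [mul_comm]
          exact ft_ind d0 d1 hd k this
      _ ≤ _ := this
      _ = c * ∑ j ∈ Ico 1 c, 1 / (j:ℝ) := by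
          rw [Finset.mul_sum, Finset.mul_sum]; refine Finset.sum_congr rfl fun j _ => ?_; ring
      _ ≤ _ := by gcongr; exact harm_le c
  linarith

theorem exp_bound (d0 d1 : ℕ) (hd : d1 ≤ c) (s B0 : ZMod c) (G : ℝ) (hG0 : 0 ≤ G)
    (hG : ∀ m n : ZMod c, ‖Kl (ZMod.stdAddChar : AddChar (ZMod c) ℂ) m n‖ ≤ G * Nat.gcd n.val c) :
    |∑ x : (ZMod c)ˣ, if d0 ≤ (x : ZMod c).val ∧ (x : ZMod c).val < d1 then
      ((((-((x⁻¹ : (ZMod c)ˣ) : ZMod c) - s * (x : ZMod c) - B0).val : ℝ)) - (∑ z : ZMod c, (z.val:ℝ)) / c) else 0|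
      ≤ c * G * c.divisors.card * (2 + Real.log c) ^ 2 := by
  have hc : (0:ℝ) < c := by exact_mod_cast NeZero.pos c
  have hc' : (c:ℂ) ≠ 0 := by exact_mod_cast (NeZero.ne c)
  set v : ZMod c → ℂ := fun z => (z.val : ℂ) with hv
  set J := ft (ind (c := c) d0 d1) with hJ
  set NZ := univ.filter (fun k : ZMod c => k ≠ 0) with hNZ
  have hv0 : ∀ y, (c:ℂ) * (v y - (∑ z : ZMod c, (z.val:ℂ)) / c) = ∑ k ∈ NZ, ft v k * (ZMod.stdAddChar : AddChar (ZMod c) ℂ) (k * y) := by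
    intro y
    have h1 := inversion v y
    rw [← Finset.sum_filter_add_sum_filter_not univ (fun k : ZMod c => k ≠ 0)] at h1
    have : univ.filter (fun k : ZMod c => ¬ (k ≠ 0)) = {0} := by ext; simp
    rw [this, Finset.sum_singleton] at h1
    have h2 : ft v 0 = ∑ z : ZMod c, (z.val:ℂ) := by simp [ft, hv]
    rw [h2, zero_mul, AddChar.map_zero_eq_one, mul_one] at h1
    rw [mul_sub, h1]; field_simp; ring
  have key : (c:ℂ)^2 * ((∑ x : (ZMod c)ˣ, if d0 ≤ (x : ZMod c).val ∧ (x : ZMod c).val < d1 then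
      ((((-((x⁻¹ : (ZMod c)ˣ) : ZMod c) - s * (x : ZMod c) - B0).val : ℝ)) - (∑ z : ZMod c, (z.val:ℝ)) / c) else 0 : ℝ) : ℂ)
      = ∑ k ∈ NZ, ∑ l, ft v k * J l * (ZMod.stdAddChar : AddChar (ZMod c) ℂ) (-(k * B0)) * Kl (ZMod.stdAddChar : AddChar (ZMod c) ℂ) (l - k * s) (-k) := by
    have e1 : ∀ x : (ZMod c)ˣ, (c:ℂ)^2 * (((if d0 ≤ (x : ZMod c).val ∧ (x : ZMod c).val < d1 then
      ((((-((x⁻¹ : (ZMod c)ˣ) : ZMod c) - s * (x : ZMod c) - B0).val : ℝ)) - (∑ z : ZMod c, (z.val:ℝ)) / c) else 0 : ℝ)) : ℂ)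
       = ∑ k ∈ NZ, ∑ l, ft v k * J l * (ZMod.stdAddChar : AddChar (ZMod c) ℂ) (-(k * B0)) * (ZMod.stdAddChar : AddChar (ZMod c) ℂ) ((l - k * s) * (x : ZMod c) + (-k) * ((x⁻¹ : (ZMod c)ˣ) : ZMod c)) := by
      intro x
      have h1 := hv0 (-((x⁻¹ : (ZMod c)ˣ) : ZMod c) - s * (x : ZMod c) - B0)
      have h2 := inversion (ind (c := c) d0 d1) (x : ZMod c)
      have h3 : (c:ℂ)^2 * (((if d0 ≤ (x : ZMod c).val ∧ (x : ZMod c).val < d1 then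
        ((((-((x⁻¹ : (ZMod c)ˣ) : ZMod c) - s * (x : ZMod c) - B0).val : ℝ)) - (∑ z : ZMod c, (z.val:ℝ)) / c) else 0 : ℝ)) : ℂ)
        = ((c:ℂ) * (v (-((x⁻¹ : (ZMod c)ˣ) : ZMod c) - s * (x : ZMod c) - B0) - (∑ z : ZMod c, (z.val:ℂ)) / c)) * ((c:ℂ) * ind (c := c) d0 d1 x) := by
        unfold ind
        split_ifs
        · push_cast; ring
        · simp
      rw [h3, h1, h2, Finset.sum_mul_sum]
      refine Finset.sum_congr rfl fun k _ => Finset.sum_congr rfl fun l _ => ?_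
      rw [show ft v k * J l * (ZMod.stdAddChar : AddChar (ZMod c) ℂ) (-(k * B0)) * (ZMod.stdAddChar : AddChar (ZMod c) ℂ) ((l - k * s) * (x : ZMod c) + (-k) * ((x⁻¹ : (ZMod c)ˣ) : ZMod c))
        = ft v k * J l * ((ZMod.stdAddChar : AddChar (ZMod c) ℂ) (-(k * B0)) * (ZMod.stdAddChar : AddChar (ZMod c) ℂ) ((l - k * s) * (x : ZMod c) + (-k) * ((x⁻¹ : (ZMod c)ˣ) : ZMod c))) by ring, ← AddChar.map_add_eq_mul]
      rw [show ft v k * (ZMod.stdAddChar : AddChar (ZMod c) ℂ) (k * (-((x⁻¹ : (ZMod c)ˣ) : ZMod c) - s * (x : ZMod c) - B0)) * (ft (ind (c := c) d0 d1) l * (ZMod.stdAddChar : AddChar (ZMod c) ℂ) (l * x))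
        = ft v k * ft (ind (c := c) d0 d1) l * ((ZMod.stdAddChar : AddChar (ZMod c) ℂ) (k * (-((x⁻¹ : (ZMod c)ˣ) : ZMod c) - s * (x : ZMod c) - B0)) * (ZMod.stdAddChar : AddChar (ZMod c) ℂ) (l * x)) by ring, ← AddChar.map_add_eq_mul]
      congr 2; ring
    rw [Complex.ofReal_sum, Finset.mul_sum, Finset.sum_congr rfl fun x _ => e1 x, Finset.sum_comm]
    refine Finset.sum_congr rfl fun k _ => ?_
    rw [Finset.sum_comm]
    refine Finset.sum_congr rfl fun l _ => ?_
    unfold Kl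
    rw [Finset.mul_sum]
  set W : ℝ := ∑ x : (ZMod c)ˣ, if d0 ≤ (x : ZMod c).val ∧ (x : ZMod c).val < d1 then
      ((((-((x⁻¹ : (ZMod c)ˣ) : ZMod c) - s * (x : ZMod c) - B0).val : ℝ)) - (∑ z : ZMod c, (z.val:ℝ)) / c) else 0 with hW
  have hlog : 0 ≤ Real.log c := Real.log_natCast_nonneg c
  have hbound : (c:ℝ)^2 * |W| ≤ (∑ k ∈ NZ, ‖ft v k‖ * Nat.gcd (-k).val c) * G * ∑ l, ‖J l‖ := by
    have : (c:ℝ)^2 * |W| = ‖(c:ℂ)^2 * (W:ℂ)‖ := by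
      rw [norm_mul, norm_pow, Complex.norm_natCast, Complex.norm_real, Real.norm_eq_abs]
    rw [this, key, Finset.sum_mul, Finset.sum_mul]
    refine (norm_sum_le _ _).trans (Finset.sum_le_sum fun k _ => ?_)
    rw [Finset.mul_sum]
    refine (norm_sum_le _ _).trans (Finset.sum_le_sum fun l _ => ?_)
    rw [norm_mul, norm_mul, norm_mul, AddChar.norm_apply, mul_one]
    calc _ ≤ ‖ft v k‖ * ‖J l‖ * (G * Nat.gcd (-k).val c) := by gcongr; exact hG _ _
      _ = _ := by ring
  have h1 : ∑ k ∈ NZ, ‖ft v k‖ * Nat.gcd (-k).val c ≤ c * ((c:ℝ)/2 * (c.divisors.card * (1 + Real.log c))) := by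
    have hg : ∀ j ∈ Ico 1 c, Nat.gcd (c - j) c = Nat.gcd j c := by
      intro j hj
      rw [Finset.mem_Ico] at hj
      rw [Nat.gcd_comm, Nat.gcd_self_sub_right hj.2.le, Nat.gcd_comm]
    have := sum_inv_bound (c := c) (fun j => (Nat.gcd j c : ℝ)) (fun _ => by positivity) (by intro j hj; rw [hg j hj])
    calc _ = c * ∑ k ∈ NZ, 1 / ‖1 - (ZMod.stdAddChar : AddChar (ZMod c) ℂ) k‖ * Nat.gcd k.val c := by
          rw [Finset.mul_sum]
          refine Finset.sum_congr rfl fun k hk => ?_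
          have hk0 : k ≠ 0 := by simpa [hNZ] using hk
          have : NeZero k := ⟨hk0⟩
          rw [ft_val k hk0, ZMod.val_neg_of_ne_zero, hg]
          · ring
          · rw [Finset.mem_Ico]
            exact ⟨Nat.pos_of_ne_zero ((ZMod.val_ne_zero k).mpr hk0), ZMod.val_lt k⟩
      _ ≤ _ := by
          gcongr
          refine this.trans ?_
          gcongr
          exact gcd_sum c (NeZero.pos c)
  have h2 := ft_ind_sum (c := c) d0 d1 hd
  have h3 : (c:ℝ)^2 * |W| ≤ (c * ((c:ℝ)/2 * (c.divisors.card * (1 + Real.log c)))) * G * (c * (2 + Real.log c)) := by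
    refine hbound.trans ?_
    gcongr
  have h4 : (c:ℝ)^2 * |W| ≤ (c:ℝ)^2 * (c * G * c.divisors.card * (2 + Real.log c) ^ 2) := by
    refine h3.trans ?_
    have : (c * ((c:ℝ)/2 * (c.divisors.card * (1 + Real.log c)))) * G * (c * (2 + Real.log c))
      = (c:ℝ)^2 * (c * G * c.divisors.card * ((1 + Real.log c) / 2 * (2 + Real.log c))) := by ring
    rw [this]
    gcongr
    nlinarith
  exact le_of_mul_le_mul_left h4 (by positivity)

end Four


namespace Four
open Finset Kloo

lemma val_succ {c : ℕ} [NeZero c] (z : ZMod c) : (((z + 1).val : ℕ) : ℤ) = (z.val : ℤ) + 1 - (if z = -1 then (c:ℤ) else 0) := by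
  split_ifs with h
  · subst h
    rw [neg_add_cancel, ZMod.val_zero]
    have : (-1 : ZMod c).val + 1 = c := by
      obtain ⟨m, hm⟩ : ∃ m, c = m + 1 := ⟨c - 1, by have := NeZero.pos c; omega⟩
      subst hm
      rw [ZMod.val_neg_one]
    omega
  · rcases Nat.lt_or_ge 1 c with hc1 | hc1
    · have : Fact (1 < c) := ⟨hc1⟩
      have hlt : z.val + (1 : ZMod c).val < c := by
        rw [ZMod.val_one]
        have h1 := ZMod.val_lt z
        by_contra hcon
        have h2 : z.val + 1 = c := by omega
        apply h
        have : ((z.val + 1 : ℕ) : ZMod c) = 0 := by rw [h2]; exact ZMod.natCast_self c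
        push_cast at this
        rw [ZMod.natCast_zmod_val] at this
        exact eq_neg_of_add_eq_zero_left this
      rw [ZMod.val_add_of_lt hlt, ZMod.val_one]; push_cast; ring
    · exfalso
      have h1 : c = 1 := by have := NeZero.pos c; omega
      subst h1
      exact h (Subsingleton.elim _ _)

lemma count_ap {c : ℕ} [NeZero c] (x : ZMod c) (A B : ℤ) (h : A ≤ B) :
    (c:ℤ) * (((Ico A B).filter fun a : ℤ => (a : ZMod c) = x).card : ℤ) = (B - A) + (x - (B : ZMod c)).val - (x - (A : ZMod c)).val := by
  induction B, h using Int.leInduction with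
  | base => simp
  | succ B hB ih =>
    rw [← insert_Ico_right_eq_Ico_add_one hB, Finset.filter_insert]
    have hv := val_succ (x - ((B + 1 : ℤ) : ZMod c))
    have e1 : x - ((B + 1 : ℤ) : ZMod c) + 1 = x - (B : ZMod c) := by push_cast; ring
    have e2 : x - ((B + 1 : ℤ) : ZMod c) = -1 ↔ (B : ZMod c) = x := by
      push_cast
      constructor
      · intro h; linear_combination -h
      · intro h; rw [h]; ring
    rw [e1] at hv
    by_cases h : (B : ZMod c) = x
    · rw [if_pos h, Finset.card_insert_of_notMem (by simp)]
      rw [if_pos (e2.mpr h)] at hv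
      push_cast at ih hv ⊢
      linarith
    · rw [if_neg h]
      rw [if_neg (fun h' => h (e2.mp h'))] at hv
      push_cast at ih hv ⊢
      linarith

lemma sum_units {c : ℕ} [NeZero c] (d0 d1 : ℕ) (hd : d1 ≤ c) (F : ℕ → ℝ) :
    ∑ d ∈ (Ico d0 d1).filter (fun d => Nat.Coprime d c), F d
      = ∑ x : (ZMod c)ˣ, if d0 ≤ (x : ZMod c).val ∧ (x : ZMod c).val < d1 then F (x : ZMod c).val else 0 := by
  rw [← Finset.sum_filter]
  symm
  refine Finset.sum_nbij (fun x : (ZMod c)ˣ => (x : ZMod c).val) ?_ ?_ ?_ ?_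
  · intro x hx
    rw [Finset.mem_filter] at hx ⊢
    rw [Finset.mem_Ico]
    exact ⟨hx.2, ZMod.val_coe_unit_coprime x⟩
  · intro x _ y _ h
    exact Units.ext (ZMod.val_injective c h)
  · intro d hd'
    rw [Finset.mem_coe, Finset.mem_filter, Finset.mem_Ico] at hd'
    have hv : ((d : ZMod c)).val = d := ZMod.val_cast_of_lt (by omega)
    refine ⟨ZMod.unitOfCoprime d hd'.2, ?_, ?_⟩
    · rw [Finset.mem_coe, Finset.mem_filter, ZMod.coe_unitOfCoprime, hv]
      exact ⟨Finset.mem_univ _, hd'.1⟩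
    · dsimp only
      rw [ZMod.coe_unitOfCoprime, hv]
  · intros; rfl

theorem count_main {c : ℕ} [NeZero c] (d0 d1 : ℕ) (hd : d1 ≤ c) (A N' : ℤ) (hA : ∀ d ∈ Ico d0 d1, A ≤ N' + (d:ℤ))
    (G : ℝ) (hG0 : 0 ≤ G) (hG : ∀ m n : ZMod c, ‖Kl (ZMod.stdAddChar : AddChar (ZMod c) ℂ) m n‖ ≤ G * Nat.gcd n.val c) :
    |∑ d ∈ Ico d0 d1, (((Ico A (N' + (d:ℤ))).filter fun a : ℤ => (c:ℤ) ∣ a * d + 1).card : ℝ)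
      - ∑ d ∈ (Ico d0 d1).filter (fun d => Nat.Coprime d c), ((N' + (d:ℤ) - A : ℤ) : ℝ) / c|
      ≤ 2 * G * c.divisors.card * (2 + Real.log c) ^ 2 := by
  have hc : (0:ℝ) < c := by exact_mod_cast NeZero.pos c
  have e1 : ∑ d ∈ Ico d0 d1, (((Ico A (N' + (d:ℤ))).filter fun a : ℤ => (c:ℤ) ∣ a * d + 1).card : ℝ)
     = ∑ d ∈ (Ico d0 d1).filter (fun d => Nat.Coprime d c), (((Ico A (N' + (d:ℤ))).filter fun a : ℤ => (c:ℤ) ∣ a * d + 1).card : ℝ) := by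
    symm
    refine Finset.sum_subset (Finset.filter_subset _ _) ?_
    intro d hd' hnc
    rw [Nat.cast_eq_zero, Finset.card_eq_zero, Finset.filter_eq_empty_iff]
    intro a _ hdvd
    apply hnc
    rw [Finset.mem_filter]
    refine ⟨hd', ?_⟩
    have : IsCoprime (d:ℤ) (c:ℤ) := by
      obtain ⟨k, hk⟩ := hdvd
      exact ⟨-a, k, by linarith⟩
    exact Nat.isCoprime_iff_coprime.mp this
  rw [e1, sum_units d0 d1 hd, sum_units d0 d1 hd, ← Finset.sum_sub_distrib]
  have e2 : ∀ x : (ZMod c)ˣ, ((if d0 ≤ (x : ZMod c).val ∧ (x : ZMod c).val < d1 then 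
      (((Ico A (N' + (((x : ZMod c).val : ℕ):ℤ))).filter fun a : ℤ => (c:ℤ) ∣ a * (((x : ZMod c).val : ℕ):ℤ) + 1).card : ℝ) else 0)
      - (if d0 ≤ (x : ZMod c).val ∧ (x : ZMod c).val < d1 then ((N' + (((x : ZMod c).val : ℕ):ℤ) - A : ℤ) : ℝ) / c else 0))
      = 1 / c * (if d0 ≤ (x : ZMod c).val ∧ (x : ZMod c).val < d1 then
      ((((-((x⁻¹ : (ZMod c)ˣ) : ZMod c) - 1 * (x : ZMod c) - (N' : ZMod c)).val : ℝ)) - (∑ z : ZMod c, (z.val:ℝ)) / c) else 0)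
      - 1 / c * (if d0 ≤ (x : ZMod c).val ∧ (x : ZMod c).val < d1 then
      ((((-((x⁻¹ : (ZMod c)ˣ) : ZMod c) - 0 * (x : ZMod c) - (A : ZMod c)).val : ℝ)) - (∑ z : ZMod c, (z.val:ℝ)) / c) else 0) := by
    intro x
    split_ifs with h
    · have hcount := count_ap (-((x⁻¹ : (ZMod c)ˣ) : ZMod c)) A (N' + (((x : ZMod c).val : ℕ):ℤ)) (hA _ (by rw [Finset.mem_Ico]; exact h))
      have hset : ((Ico A (N' + (((x : ZMod c).val : ℕ):ℤ))).filter fun a : ℤ => (c:ℤ) ∣ a * (((x : ZMod c).val : ℕ):ℤ) + 1)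
        = ((Ico A (N' + (((x : ZMod c).val : ℕ):ℤ))).filter fun a : ℤ => (a : ZMod c) = -((x⁻¹ : (ZMod c)ˣ) : ZMod c)) := by
        refine Finset.filter_congr fun a _ => ?_
        rw [← ZMod.intCast_zmod_eq_zero_iff_dvd]
        push_cast
        rw [ZMod.natCast_zmod_val]
        have hxx : (x : ZMod c) * ((x⁻¹ : (ZMod c)ˣ) : ZMod c) = 1 := Units.mul_inv x
        constructor
        · intro h'
          linear_combination ((x⁻¹ : (ZMod c)ˣ) : ZMod c) * h' - (a : ZMod c) * hxx
        · intro h'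
          rw [h']; linear_combination -hxx
      rw [hset]
      have e3 : (-((x⁻¹ : (ZMod c)ˣ) : ZMod c) - ((N' + (((x : ZMod c).val : ℕ):ℤ) : ℤ) : ZMod c)) = -((x⁻¹ : (ZMod c)ˣ) : ZMod c) - 1 * (x : ZMod c) - (N' : ZMod c) := by
        push_cast
        rw [ZMod.natCast_zmod_val]; ring
      have e4 : (-((x⁻¹ : (ZMod c)ˣ) : ZMod c) - (A : ZMod c)) = -((x⁻¹ : (ZMod c)ˣ) : ZMod c) - 0 * (x : ZMod c) - (A : ZMod c) := by ring
      rw [e3, e4] at hcount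
      have hcount' := congrArg (fun z : ℤ => (z:ℝ)) hcount
      push_cast at hcount' ⊢
      field_simp
      linear_combination (c:ℝ) * hcount'
    · simp
  rw [Finset.sum_congr rfl fun x _ => e2 x, Finset.sum_sub_distrib, ← Finset.mul_sum, ← Finset.mul_sum]
  have b1 := exp_bound (c := c) d0 d1 hd 1 (N' : ZMod c) G hG0 hG
  have b2 := exp_bound (c := c) d0 d1 hd 0 (A : ZMod c) G hG0 hG
  refine (abs_sub _ _).trans ?_
  rw [abs_mul, abs_mul, abs_of_pos (by positivity : (0:ℝ) < 1 / c)]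
  have : 2 * G * c.divisors.card * (2 + Real.log c) ^ 2 = 1 / c * (c * G * c.divisors.card * (2 + Real.log c) ^ 2)
     + 1 / c * (c * G * c.divisors.card * (2 + Real.log c) ^ 2) := by field_simp; ring
  rw [this]
  gcongr

end Four


namespace Four
open Finset Kloo

lemma tau_aux (δ : ℝ) (hδ : 0 < δ) (M : ℝ) (hM : M = 1 + 1 / (δ * Real.log 2)) (P : ℕ) (hP : (2:ℝ) ≤ (P:ℝ) ^ δ) (n : ℕ) (hn : 1 ≤ n) :
    (n.divisors.card : ℝ) ≤ M ^ ((n.primeFactors.filter (fun p => p < P)).card) * (n:ℝ) ^ δ := by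
  have hl : 0 < δ * Real.log 2 := mul_pos hδ (Real.log_pos (by norm_num))
  have hM1 : 1 ≤ M := by rw [hM]; have : 0 < 1 / (δ * Real.log 2) := by positivity
                         linarith
  induction n using Nat.recOnPosPrimePosCoprime with
  | zero => omega
  | one => simp
  | prime_pow p k hp hk =>
    rw [Nat.divisors_prime_pow hp, Finset.card_map, Finset.card_range, Nat.primeFactors_prime_pow (by omega) hp]
    have hp0 : (0:ℝ) ≤ p := by positivity
    have hpk : ((p ^ k : ℕ) : ℝ) ^ δ = ((p:ℝ) ^ δ) ^ k := by
      rw [Nat.cast_pow, ← Real.rpow_natCast, ← Real.rpow_mul hp0, mul_comm, Real.rpow_mul hp0, Real.rpow_natCast]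
    rw [hpk]
    by_cases h : p < P
    · have : Finset.filter (fun q => q < P) {p} = {p} := by
        rw [Finset.filter_eq_self]; intro q hq; rw [Finset.mem_singleton] at hq; rw [hq]; exact h
      rw [this, Finset.card_singleton, pow_one]
      have h2 : (2:ℝ)^δ ≤ (p:ℝ)^δ := Real.rpow_le_rpow (by norm_num) (by exact_mod_cast hp.two_le) hδ.le
      have h3 : 1 + δ * Real.log 2 ≤ (2:ℝ)^δ := by
        rw [Real.rpow_def_of_pos (by norm_num)]
        have := Real.add_one_le_exp (Real.log 2 * δ)
        linarith
      have h4 : 1 + (k:ℝ) * (δ * Real.log 2) ≤ ((p:ℝ)^δ)^k := by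
        calc _ ≤ (1 + δ * Real.log 2)^k := one_add_mul_le_pow (by linarith) k
          _ ≤ _ := pow_le_pow_left₀ (by linarith) (h3.trans h2) k
      push_cast
      calc (k:ℝ) + 1 ≤ M * (1 + (k:ℝ) * (δ * Real.log 2)) := by
            rw [hM]
            have : (1 + 1 / (δ * Real.log 2)) * (1 + (k:ℝ) * (δ * Real.log 2)) = 1 + k + (k * (δ * Real.log 2) + 1 / (δ * Real.log 2)) := by
              field_simp; ring
            rw [this]
            have : 0 < 1 / (δ * Real.log 2) := by positivity
            have : 0 ≤ k * (δ * Real.log 2) := by positivity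
            linarith
        _ ≤ _ := by gcongr
    · have : Finset.filter (fun q => q < P) {p} = ∅ := by
        rw [Finset.filter_eq_empty_iff]; intro q hq; rw [Finset.mem_singleton] at hq; rw [hq]; exact h
      rw [this, Finset.card_empty, pow_zero, one_mul]
      have h2 : (2:ℝ) ≤ (p:ℝ)^δ := hP.trans (Real.rpow_le_rpow (by positivity) (by exact_mod_cast not_lt.mp h) hδ.le)
      calc ((k+1 : ℕ):ℝ) ≤ ((2^k : ℕ):ℝ) := by exact_mod_cast Nat.lt_two_pow_self
        _ = 2^k := by push_cast; rfl
        _ ≤ _ := pow_le_pow_left₀ (by norm_num) h2 k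
  | coprime a b ha hb hab h1 h2 =>
    have h1 := h1 (by omega)
    have h2 := h2 (by omega)
    rw [hab.card_divisors_mul, hab.primeFactors_mul, Finset.filter_union, Finset.card_union_of_disjoint, pow_add]
    · push_cast
      rw [Real.mul_rpow (by positivity) (by positivity)]
      calc _ ≤ (M ^ ((a.primeFactors.filter (fun p => p < P)).card) * (a:ℝ) ^ δ) * (M ^ ((b.primeFactors.filter (fun p => p < P)).card) * (b:ℝ) ^ δ) := by
            gcongr
        _ = _ := by ring
    · exact Finset.disjoint_filter_filter hab.disjoint_primeFactors

theorem tau_bound (δ : ℝ) (hδ : 0 < δ) : ∃ K : ℝ, 0 < K ∧ ∀ n : ℕ, 1 ≤ n → (n.divisors.card : ℝ) ≤ K * (n:ℝ) ^ δ := by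
  set M := 1 + 1 / (δ * Real.log 2) with hM
  have hl : 0 < δ * Real.log 2 := mul_pos hδ (Real.log_pos (by norm_num))
  have hM1 : 1 ≤ M := by
    have : 0 < 1 / (δ * Real.log 2) := by positivity
    linarith
  obtain ⟨P, hP⟩ := exists_nat_ge ((2:ℝ) ^ (1/δ))
  have hP' : (2:ℝ) ≤ (P:ℝ)^δ := by
    calc (2:ℝ) = ((2:ℝ)^(1/δ))^δ := by rw [← Real.rpow_mul (by norm_num)]; field_simp; simp
      _ ≤ _ := Real.rpow_le_rpow (by positivity) hP hδ.le
  refine ⟨M ^ P, by positivity, fun n hn => ?_⟩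
  refine (tau_aux δ hδ M hM P hP' n hn).trans ?_
  gcongr
  · calc _ ≤ (Finset.range P).card := Finset.card_le_card (by intro q hq; simp at hq ⊢; omega)
      _ = P := Finset.card_range P

lemma sum_sq_part (u v s : ℕ → ℕ) (h : ∀ c, 1 ≤ c → c = u c ^ 2 * v c ^ 3 * s c) (Y : ℕ) :
    ∑ c ∈ Icc 1 Y, Real.sqrt ((u c ^ 2 * v c ^ 3 : ℕ) : ℝ) ≤ Y * (1 + Real.log (Y+1)) ^ 2 := by
  have hH := harm_le (Y+1)
  have hI : Ico 1 (Y+1) = Icc 1 Y := by ext; simp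
  rw [hI] at hH
  push_cast at hH
  have step1 : ∑ c ∈ Icc 1 Y, Real.sqrt ((u c ^ 2 * v c ^ 3 : ℕ) : ℝ)
     ≤ ∑ x ∈ (Icc 1 Y ×ˢ Icc 1 Y).sigma (fun q => Icc 1 (Y / (q.1 ^ 2 * q.2 ^ 3))), Real.sqrt ((x.1.1 ^ 2 * x.1.2 ^ 3 : ℕ) : ℝ) := by
    have : ∑ c ∈ Icc 1 Y, Real.sqrt ((u c ^ 2 * v c ^ 3 : ℕ) : ℝ) = 
       ∑ x ∈ (Icc 1 Y).image (fun c => (⟨(u c, v c), s c⟩ : Σ _ : ℕ × ℕ, ℕ)), Real.sqrt ((x.1.1 ^ 2 * x.1.2 ^ 3 : ℕ) : ℝ) := by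
      rw [Finset.sum_image]
      intro c hc c' hc' hcc
      rw [Finset.mem_coe, Finset.mem_Icc] at hc hc'
      simp only [Sigma.mk.injEq, Prod.mk.injEq, heq_eq_eq] at hcc
      rw [h c hc.1, h c' hc'.1, hcc.1.1, hcc.1.2, hcc.2]
    rw [this]
    refine Finset.sum_le_sum_of_subset_of_nonneg ?_ (fun _ _ _ => by positivity)
    intro x hx
    obtain ⟨c, hc, rfl⟩ := Finset.mem_image.mp hx
    rw [Finset.mem_Icc] at hc
    have hh := h c hc.1
    have hu : u c ≠ 0 := by intro h0; rw [h0] at hh; simp at hh; omega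
    have hv : v c ≠ 0 := by intro h0; rw [h0] at hh; simp at hh; omega
    have hs : s c ≠ 0 := by intro h0; rw [h0] at hh; simp at hh; omega
    have hu1 : 1 ≤ u c := by omega
    have hv1 : 1 ≤ v c := by omega
    have hs1 : 1 ≤ s c := by omega
    have hdu : u c ∣ c := by conv_rhs => rw [hh]
                             exact Dvd.dvd.mul_right (Dvd.dvd.mul_right (dvd_pow_self _ (by norm_num)) _) _
    have hdv : v c ∣ c := by conv_rhs => rw [hh]
                             exact Dvd.dvd.mul_right (Dvd.dvd.mul_left (dvd_pow_self _ (by norm_num)) _) _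
    have := Nat.le_of_dvd hc.1 hdu
    have := Nat.le_of_dvd hc.1 hdv
    simp only [Finset.mem_sigma, Finset.mem_product, Finset.mem_Icc]
    refine ⟨⟨⟨hu1, by omega⟩, ⟨hv1, by omega⟩⟩, hs1, ?_⟩
    rw [Nat.le_div_iff_mul_le (by positivity), mul_comm, ← hh]; exact hc.2
  refine step1.trans ?_
  rw [Finset.sum_sigma]
  calc _ ≤ ∑ q ∈ Icc 1 Y ×ˢ Icc 1 Y, (Y:ℝ) * ((1 / (q.1:ℝ)) * (1 / (q.2:ℝ))) := by
        refine Finset.sum_le_sum fun q hq => ?_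
        rw [Finset.mem_product, Finset.mem_Icc, Finset.mem_Icc] at hq
        have h1 : (1:ℝ) ≤ q.1 := by exact_mod_cast hq.1.1
        have h2 : (1:ℝ) ≤ q.2 := by exact_mod_cast hq.2.1
        simp only [Finset.sum_const, Nat.card_Icc, Nat.add_sub_cancel, nsmul_eq_mul]
        push_cast
        set w : ℝ := (q.1:ℝ)^2 * (q.2:ℝ)^3 with hw
        have hwpos : 0 < w := by positivity
        have h3 : ((Y / (q.1 ^ 2 * q.2 ^ 3) : ℕ):ℝ) ≤ Y / w := by
          have := @Nat.cast_div_le ℝ _ _ _ Y (q.1 ^ 2 * q.2 ^ 3)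
          push_cast at this
          exact this
        have h4 : (q.1:ℝ) * q.2 ≤ Real.sqrt w := by
          apply Real.le_sqrt_of_sq_le
          rw [hw, mul_pow]
          have : (q.2:ℝ)^2 ≤ (q.2:ℝ)^3 := pow_le_pow_right₀ h2 (by norm_num)
          gcongr
        have hsq : 0 < Real.sqrt w := Real.sqrt_pos.mpr hwpos
        calc ((Y / (q.1 ^ 2 * q.2 ^ 3) : ℕ):ℝ) * Real.sqrt w ≤ Y / w * Real.sqrt w := by gcongr
          _ = Y * (1 / Real.sqrt w) := by
              rw [div_mul_eq_mul_div, mul_div_assoc]; congr 1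
              rw [div_eq_div_iff hwpos.ne' hsq.ne', Real.mul_self_sqrt hwpos.le, one_mul]
          _ ≤ Y * (1 / ((q.1:ℝ) * q.2)) := by gcongr
          _ = _ := by congr 1; field_simp
    _ = Y * ((∑ j ∈ Icc 1 Y, 1 / (j:ℝ)) * (∑ j ∈ Icc 1 Y, 1 / (j:ℝ))) := by
        rw [← Finset.mul_sum, Finset.sum_mul_sum, Finset.sum_product]
    _ ≤ _ := by
        rw [sq]
        have : 0 ≤ ∑ j ∈ Icc 1 Y, 1 / (j:ℝ) := Finset.sum_nonneg fun _ _ => by positivity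
        exact mul_le_mul_of_nonneg_left (mul_le_mul hH hH this (this.trans hH)) (by positivity)

lemma log_bound (δ : ℝ) (hδ : 0 < δ) (Y : ℝ) (hY : 1 ≤ Y) : 2 + Real.log (Y + 1) ≤ (3 + 1 / δ) * Y ^ δ := by
  have h1 := Real.log_le_rpow_div (x := Y) (by linarith) hδ
  have h2 : 1 ≤ Y ^ δ := Real.one_le_rpow hY hδ.le
  have h3 : Real.log (Y + 1) ≤ Real.log 2 + Real.log Y := by
    rw [← Real.log_mul (by norm_num) (by linarith)]
    exact Real.log_le_log (by linarith) (by linarith)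
  have h4 : Real.log 2 ≤ 1 := by have := Real.log_two_lt_d9; linarith
  calc _ ≤ 3 + Y ^ δ / δ := by linarith
    _ ≤ 3 * Y ^ δ + Y ^ δ / δ := by linarith
    _ = _ := by ring

lemma gmono (t t' l l' q q' w : ℝ) (h0 : 0 ≤ t) (h1 : t ≤ t') (h2 : 0 ≤ l) (h3 : l ≤ l') (h4 : 0 ≤ q) (h5 : q ≤ q') (h6 : 0 ≤ w) :
    2 * t ^ 2 * l ^ 2 * q * w ≤ 2 * t' ^ 2 * l' ^ 2 * q' * w := by
  have := h0.trans h1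
  gcongr

theorem exists_G : ∃ G : ℕ → ℝ, (∀ c, 0 ≤ G c) ∧
    (∀ (c : ℕ) (_ : NeZero c) (m n : ZMod c), ‖Kl (ZMod.stdAddChar : AddChar (ZMod c) ℂ) m n‖ ≤ G c * Nat.gcd n.val c) ∧
    ∀ ε > (0:ℝ), ∃ K > (0:ℝ), ∀ Y : ℕ, 1 ≤ Y →
      ∑ c ∈ Icc 1 Y, 2 * G c * c.divisors.card * (2 + Real.log c) ^ 2 ≤ K * (Y:ℝ) ^ (3/2 + ε) := by
  have hg : ∀ c : ℕ, ∃ u v s : ℕ, 1 ≤ c → (c = u ^ 2 * v ^ 3 * s ∧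
    ∀ (_ : NeZero c) (ψ : AddChar (ZMod c) ℂ), ψ.IsPrimitive → ∀ m n : ZMod c,
    ‖Kl ψ m n‖ ≤ c.divisors.card * Real.sqrt (c * (u ^ 2 * v ^ 3 : ℕ)) * Nat.gcd n.val c) := by
    intro c
    rcases Nat.eq_zero_or_pos c with h | h
    · exact ⟨0, 0, 0, by omega⟩
    · obtain ⟨u, v, s, h⟩ := good c h
      exact ⟨u, v, s, fun _ => h⟩
  choose u v s hs using hg
  refine ⟨fun c => c.divisors.card * Real.sqrt (c * (u c ^ 2 * v c ^ 3 : ℕ)), fun c => by positivity, ?_, ?_⟩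
  · intro c hc m n
    exact (hs c (NeZero.pos c)).2 hc _ (ZMod.isPrimitive_stdAddChar c) m n
  · intro ε hε
    set δ := ε / 6 with hδ
    have hδ0 : 0 < δ := by positivity
    obtain ⟨K, hK, hτ⟩ := tau_bound δ hδ0
    refine ⟨2 * K ^ 2 * (3 + 1/δ)^4, by positivity, fun Y hY => ?_⟩
    have hY1 : (1:ℝ) ≤ Y := by exact_mod_cast hY
    set L := (3 + 1/δ) * (Y:ℝ) ^ δ with hL
    have hlog := log_bound δ hδ0 Y hY1
    have hlogpos : 0 ≤ Real.log ((Y:ℝ)+1) := Real.log_nonneg (by linarith)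
    have hLpos : 0 ≤ L := by linarith
    calc _ ≤ ∑ c ∈ Icc 1 Y, (2 * (K * (Y:ℝ)^δ)^2 * L ^ 2 * Real.sqrt Y) * Real.sqrt ((u c ^ 2 * v c ^ 3 : ℕ) : ℝ) := by
          refine Finset.sum_le_sum fun c hc => ?_
          rw [Finset.mem_Icc] at hc
          have hc1 : (1:ℝ) ≤ c := by exact_mod_cast hc.1
          have hcY : (c:ℝ) ≤ Y := by exact_mod_cast hc.2
          have h1 : (c.divisors.card:ℝ) ≤ K * (Y:ℝ)^δ := (hτ c hc.1).trans (by gcongr)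
          have h2 : 2 + Real.log c ≤ L := by
            have : Real.log c ≤ Real.log ((Y:ℝ)+1) := Real.log_le_log (by linarith) (by linarith)
            linarith
          have h20 : 0 ≤ 2 + Real.log c := by have := Real.log_nonneg hc1; linarith
          have h3 : Real.sqrt c ≤ Real.sqrt Y := Real.sqrt_le_sqrt hcY
          beta_reduce
          rw [Real.sqrt_mul (by positivity)]
          calc _ = 2 * (c.divisors.card:ℝ)^2 * (2 + Real.log c)^2 * Real.sqrt c * Real.sqrt ((u c ^ 2 * v c ^ 3 : ℕ) : ℝ) := by ring
            _ ≤ _ := gmono _ _ _ _ _ _ _ (Nat.cast_nonneg _) h1 h20 h2 (Real.sqrt_nonneg _) h3 (Real.sqrt_nonneg _)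
      _ = (2 * (K * (Y:ℝ)^δ)^2 * L ^ 2 * Real.sqrt Y) * ∑ c ∈ Icc 1 Y, Real.sqrt ((u c ^ 2 * v c ^ 3 : ℕ) : ℝ) := by rw [Finset.mul_sum]
      _ ≤ (2 * (K * (Y:ℝ)^δ)^2 * L ^ 2 * Real.sqrt Y) * (Y * L ^ 2) := by
          have := sum_sq_part u v s (fun c hc => (hs c hc).1) Y
          have h5 : (1 + Real.log ((Y:ℝ)+1))^2 ≤ L^2 := by
            apply pow_le_pow_left₀ <;> linarith
          have h6 : Y * (1 + Real.log ((Y:ℝ)+1))^2 ≤ Y * L^2 := by gcongr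
          gcongr
          linarith
      _ = 2 * K^2 * (3 + 1/δ)^4 * (((Y:ℝ)^δ)^6 * (Real.sqrt Y * Y)) := by rw [hL]; ring
      _ = _ := by
          congr 1
          have hY0 : (0:ℝ) < Y := by linarith
          rw [Real.sqrt_eq_rpow, ← Real.rpow_natCast, ← Real.rpow_mul hY0.le]
          conv_lhs => rw [← Real.rpow_one (Y:ℝ)]
          rw [Real.rpow_one, ← Real.rpow_add_one hY0.ne', ← Real.rpow_add hY0]
          congr 1
          rw [hδ]; push_cast; ring

end Four


namespace MainT
open Finset

lemma g_lower (y h : ℝ) (hh : 0 ≤ h) : h * max 0 y ≤ (max 0 (y+h))^2/2 - (max 0 y)^2/2 := by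
  rcases max_cases 0 y with ⟨h1, h2⟩ | ⟨h1, h2⟩ <;> rcases max_cases 0 (y+h) with ⟨h3, h4⟩ | ⟨h3, h4⟩ <;> rw [h1, h3] <;> nlinarith

lemma g_upper (y h : ℝ) (hh : 0 ≤ h) : (max 0 (y+h))^2/2 - (max 0 y)^2/2 ≤ h * max 0 (y+h) := by
  rcases max_cases 0 y with ⟨h1, h2⟩ | ⟨h1, h2⟩ <;> rcases max_cases 0 (y+h) with ⟨h3, h4⟩ | ⟨h3, h4⟩ <;> rw [h1, h3] <;> nlinarith

lemma g_deriv (y : ℝ) : HasDerivAt (fun y : ℝ => (max 0 y)^2/2) (max 0 y) y := by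
  rw [hasDerivAt_iff_isLittleO_nhds_zero]
  have : (fun h : ℝ => (max 0 (y+h))^2/2 - (max 0 y)^2/2 - h • max 0 y) =O[nhds 0] fun h : ℝ => h ^ 2 := by
    apply Asymptotics.IsBigO.of_bound 1
    filter_upwards with h
    rw [Real.norm_eq_abs, Real.norm_eq_abs, abs_of_nonneg (sq_nonneg h), abs_le, smul_eq_mul]
    rcases max_cases 0 y with ⟨h1, h2⟩ | ⟨h1, h2⟩ <;> rcases max_cases 0 (y+h) with ⟨h3, h4⟩ | ⟨h3, h4⟩ <;> rw [h1, h3] <;> constructor <;> nlinarith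
  refine this.trans_isLittleO ?_
  exact Asymptotics.isLittleO_pow_id (by norm_num)

lemma sum_c (x a : ℝ) (hx : 0 ≤ x) (ha : 0 < a) (M : ℕ) (hM : x ≤ a * M) :
    ∑ c ∈ Icc 1 M, max 0 (x - a * c) ≤ x^2/(2*a) ∧ x^2/(2*a) - x ≤ ∑ c ∈ Icc 1 M, max 0 (x - a * c) := by
  have key : ∀ m : ℕ, a * ∑ c ∈ Icc 1 m, max 0 (x - a * c) ≤ x^2/2 - (max 0 (x - a*m))^2/2 ∧
      x^2/2 - (max 0 (x - a*m))^2/2 ≤ a * ∑ c ∈ Icc 1 m, max 0 (x - a * c) + a * x - a * max 0 (x - a * m) := by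
    intro m
    induction m with
    | zero => simp [hx]
    | succ m ih =>
      rw [Finset.sum_Icc_succ_top (by omega)]
      have h1 := g_lower (x - a * (m+1:ℕ)) a ha.le
      have h2 := g_upper (x - a * (m+1:ℕ)) a ha.le
      have : x - a * (m+1:ℕ) + a = x - a * m := by push_cast; ring
      rw [this] at h1 h2
      constructor
      · rw [mul_add]; linarith [ih.1]
      · rw [mul_add]; linarith [ih.2]
  have := key M
  have h0 : max 0 (x - a * M) = 0 := max_eq_left (by linarith)
  rw [h0] at this
  have e : x^2/(2*a) = (x^2/2)/a := by field_simp
  rw [e]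
  constructor
  · rw [le_div_iff₀ ha]; linarith [this.1]
  · rw [sub_le_iff_le_add, div_le_iff₀ ha]; linarith [this.2]

lemma log_part (x κ α : ℝ) (hx : 0 ≤ x) (hκ : 0 < κ) (hα : κ ≤ α) (M : ℕ) (hM : x ≤ κ * M) :
    |∑ c ∈ Icc 1 M, ((max 0 (x - κ * c))^2/2 - (max 0 (x - α * c))^2/2) / c - x^2/2 * Real.log (α/κ)| ≤ x * (α - κ) := by
  set Φ : ℝ → ℝ := fun a => ∑ c ∈ Icc 1 M, ((max 0 (x - a * c))^2/2) / c + x^2/2 * Real.log a with hΦ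
  have hd : ∀ a ∈ Set.Icc κ α, HasDerivAt Φ (∑ c ∈ Icc 1 M, (- max 0 (x - a * c)) + x^2/2 * a⁻¹) a := by
    intro a ha
    have ha0 : 0 < a := lt_of_lt_of_le hκ ha.1
    apply HasDerivAt.add
    · apply HasDerivAt.fun_sum
      intro c hc
      rw [Finset.mem_Icc] at hc
      have hc0 : (c:ℝ) ≠ 0 := by have := hc.1; positivity
      have h1 : HasDerivAt (fun a : ℝ => x - a * c) (-(c:ℝ)) a := by
        have := ((hasDerivAt_id a).mul_const (c:ℝ)).const_sub x
        simpa using this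
      have := ((g_deriv (x - a * c)).comp a h1).div_const (c:ℝ)
      rw [mul_neg, neg_div, mul_div_cancel_right₀ _ hc0] at this
      exact this
    · exact (Real.hasDerivAt_log ha0.ne').const_mul _
  have hbd : ∀ a ∈ Set.Icc κ α, 0 ≤ (∑ c ∈ Icc 1 M, (- max 0 (x - a * c)) + x^2/2 * a⁻¹) ∧ (∑ c ∈ Icc 1 M, (- max 0 (x - a * c)) + x^2/2 * a⁻¹) ≤ x := by
    intro a ha
    have ha0 : 0 < a := lt_of_lt_of_le hκ ha.1
    have := sum_c x a hx ha0 M (hM.trans (by have := ha.1; gcongr))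
    have e : x^2/2 * a⁻¹ = x^2/(2*a) := by field_simp
    rw [Finset.sum_neg_distrib, e]
    constructor <;> linarith [this.1, this.2]
  have hn : ∀ a ∈ Set.Icc κ α, ‖(∑ c ∈ Icc 1 M, (- max 0 (x - a * c)) + x^2/2 * a⁻¹)‖ ≤ x := by
    intro a ha
    rw [Real.norm_eq_abs, abs_of_nonneg (hbd a ha).1]; exact (hbd a ha).2
  have := Convex.norm_image_sub_le_of_norm_hasDerivWithin_le (fun a ha => (hd a ha).hasDerivWithinAt) hn (convex_Icc κ α) (Set.left_mem_Icc.mpr hα) (Set.right_mem_Icc.mpr hα)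
  rw [Real.norm_eq_abs, Real.norm_eq_abs, abs_of_nonneg (sub_nonneg.mpr hα)] at this
  refine le_trans (le_of_eq ?_) this
  rw [abs_sub_comm, hΦ]
  congr 1
  rw [Real.log_div (by linarith) hκ.ne']
  simp only [sub_div, Finset.sum_sub_distrib]
  ring

lemma u_part (x α z : ℝ) (D c : ℕ) (h1 : z ≤ D) (h2 : (D:ℝ) ≤ z + 1) :
    |∑ d ∈ range D, max 0 (x + d - α * c) - ((max 0 (x + z - α * c))^2/2 - (max 0 (x - α * c))^2/2)| ≤ max 0 (x + z - α * c) + 1 := by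
  have key : ∀ m : ℕ, ∑ d ∈ range m, max 0 (x + d - α * c) ≤ (max 0 (x + m - α * c))^2/2 - (max 0 (x - α * c))^2/2 ∧
     (max 0 (x + m - α * c))^2/2 - (max 0 (x - α * c))^2/2 ≤ ∑ d ∈ range m, max 0 (x + d - α * c) + max 0 (x + m - α * c) - max 0 (x - α * c) := by
    intro m
    induction m with
    | zero => simp
    | succ m ih =>
      rw [Finset.sum_range_succ]
      have g1 := g_lower (x + m - α * c) 1 zero_le_one
      have g2 := g_upper (x + m - α * c) 1 zero_le_one
      have : x + m - α * c + 1 = x + (m+1:ℕ) - α * c := by push_cast; ring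
      rw [this] at g1 g2
      constructor
      · linarith [ih.1]
      · linarith [ih.2]
  have hk := key D
  set A := ∑ d ∈ range D, max 0 (x + d - α * c)
  set y := x + z - α * c with hy
  have e : x + (D:ℝ) - α * c = y + (D - z) := by rw [hy]; ring
  rw [e] at hk
  have p0 : 0 ≤ max 0 (x - α * c) := le_max_left _ _
  have g1 := g_lower y (D - z) (by linarith)
  have g2 := g_upper y (D - z) (by linarith)
  have m1 : max 0 (y + (D - z)) ≤ max 0 y + 1 := by
    apply max_le (by have := le_max_left 0 y; linarith)
    have := le_max_right 0 y; linarith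
  have m0 : 0 ≤ max 0 (y + (D-z)) := le_max_left _ _
  have m2 : (D - z) * max 0 (y + (D - z)) ≤ max 0 y + 1 := by
    nlinarith [mul_le_mul_of_nonneg_right (show (D:ℝ) - z ≤ 1 by linarith) m0]
  have m3 : 0 ≤ (D - z) * max 0 y := mul_nonneg (by linarith) (le_max_left _ _)
  rw [abs_le]
  constructor
  · linarith [hk.2]
  · linarith [hk.1]

/-- number of admissible `d` -/
noncomputable def Dn (β : ℝ) (c : ℕ) : ℕ := min c (⌊(c:ℝ)/β⌋₊ + 1)

lemma mem_Dn (β : ℝ) (hβ : 1 ≤ β) (c d : ℕ) : d < Dn β c ↔ d < c ∧ (d:ℝ) * β ≤ c := by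
  unfold Dn
  rw [lt_min_iff, Nat.lt_add_one_iff, Nat.le_floor_iff (by positivity), le_div_iff₀ (by linarith)]

lemma Dn_le (β : ℝ) (hβ : 1 ≤ β) (c : ℕ) : (c:ℝ)/β ≤ Dn β c ∧ (Dn β c : ℝ) ≤ c/β + 1 := by
  unfold Dn
  push_cast
  constructor
  · apply le_min (div_le_self (by positivity) hβ) (Nat.lt_floor_add_one _).le
  · apply (min_le_right _ _).trans
    have := Nat.floor_le (show 0 ≤ (c:ℝ)/β by positivity)
    linarith

lemma U_bound (x α β κ : ℝ) (hx : 0 ≤ x) (hβ : 1 ≤ β) (hκ : κ = α - 1/β) (hκ0 : 0 < κ) (M : ℕ) (hM : x ≤ κ * M)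
    (hH : ∑ j ∈ Ico 1 (M+1), 1/(j:ℝ) ≤ 1 + Real.log (M+1:ℕ)) :
    |∑ c ∈ Icc 1 M, (∑ d ∈ range (Dn β c), max 0 (x + d - α * c)) / c - x^2/2 * Real.log (α/κ)| ≤ x + (x+1) * (1 + Real.log (M+1:ℕ)) := by
  have hb : 0 < 1/β := by positivity
  have hb1 : 1/β ≤ 1 := by rw [div_le_one (by linarith)]; exact hβ
  have h1 := log_part x κ α hx hκ0 (by linarith) M hM
  have h2 : |∑ c ∈ Icc 1 M, (∑ d ∈ range (Dn β c), max 0 (x + d - α * c)) / c - ∑ c ∈ Icc 1 M, ((max 0 (x - κ * c))^2/2 - (max 0 (x - α * c))^2/2) / c|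
     ≤ (x + 1) * (1 + Real.log (M+1:ℕ)) := by
    rw [← Finset.sum_sub_distrib]
    refine (Finset.abs_sum_le_sum_abs _ _).trans ?_
    calc _ ≤ ∑ c ∈ Icc 1 M, (x+1) * (1/(c:ℝ)) := by
          refine Finset.sum_le_sum fun c hc => ?_
          rw [Finset.mem_Icc] at hc
          have hc0 : (0:ℝ) < c := by have := hc.1; positivity
          have := u_part x α (c/β) (Dn β c) c (Dn_le β hβ c).1 (Dn_le β hβ c).2
          have e : x + (c:ℝ)/β - α * c = x - κ * c := by rw [hκ]; ring
          rw [e] at this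
          rw [← sub_div, abs_div, abs_of_pos hc0, mul_one_div]
          gcongr
          refine this.trans ?_
          have : max 0 (x - κ * c) ≤ x := max_le hx (by nlinarith)
          linarith
      _ = (x+1) * ∑ j ∈ Ico 1 (M+1), 1/(j:ℝ) := by rw [Finset.mul_sum]; rfl
      _ ≤ _ := by gcongr
  calc _ ≤ _ := abs_sub_le _ (∑ c ∈ Icc 1 M, ((max 0 (x - κ * c))^2/2 - (max 0 (x - α * c))^2/2) / c) _
    _ ≤ (x + 1) * (1 + Real.log (M+1:ℕ)) + x * (α - κ) := add_le_add h2 h1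
    _ ≤ _ := by
      have : x * (α - κ) ≤ x * 1 := by gcongr; linarith
      linarith

end MainT


namespace MainT
open Finset

lemma sum_mu (n : ℕ) (hn : n ≠ 0) : ∑ g ∈ n.divisors, ((ArithmeticFunction.moebius g : ℤ) : ℝ) = if n = 1 then 1 else 0 := by
  have h := congrArg (fun f => f n) ArithmeticFunction.moebius_mul_coe_zeta
  simp only [ArithmeticFunction.coe_mul_zeta_apply, ArithmeticFunction.one_apply] at h
  exact_mod_cast h

lemma mu_series : HasSum (fun g : ℕ => ((ArithmeticFunction.moebius g : ℤ) : ℝ) / (g:ℝ)^2) (6/Real.pi^2) := by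
  have hs : (1:ℝ) < (2:ℂ).re := by norm_num
  have h1 := ArithmeticFunction.LSeries_zeta_mul_Lseries_moebius hs
  rw [ArithmeticFunction.LSeries_zeta_eq_riemannZeta hs, riemannZeta_two] at h1
  have h2 := (ArithmeticFunction.LSeriesSummable_moebius_iff.mpr hs).LSeriesHasSum
  have h3 : LSeries (fun n => ((ArithmeticFunction.moebius n : ℤ) : ℂ)) 2 = ((6/Real.pi^2 : ℝ) : ℂ) := by
    have hpi : (Real.pi:ℂ) ≠ 0 := by exact_mod_cast Real.pi_ne_zero
    push_cast
    field_simp at h1 ⊢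
    linear_combination h1
  rw [h3] at h2
  rw [← Complex.hasSum_ofReal]
  unfold LSeriesHasSum at h2
  convert h2 using 1
  ext g
  rcases Nat.eq_zero_or_pos g with h | h
  · simp [h]
  · rw [LSeries.term_of_ne_zero (by omega)]
    push_cast
    norm_cast

lemma mu_tail (Y : ℕ) (hY : 1 ≤ Y) : |∑ g ∈ Icc 1 Y, ((ArithmeticFunction.moebius g : ℤ) : ℝ) / (g:ℝ)^2 - 6/Real.pi^2| ≤ (1:ℝ)/Y := by
  have h1 := (Filter.tendsto_add_atTop_iff_nat 1).mpr mu_series.tendsto_sum_nat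
  have hI : ∀ n : ℕ, ∑ g ∈ range (n+1), ((ArithmeticFunction.moebius g : ℤ) : ℝ) / (g:ℝ)^2 = ∑ g ∈ Icc 1 n, ((ArithmeticFunction.moebius g : ℤ) : ℝ) / (g:ℝ)^2 := by
    intro n
    rw [Finset.range_eq_Ico, Finset.sum_eq_sum_Ico_succ_bot (by omega)]
    simp; rfl
  simp only [hI] at h1
  have h2 := (h1.const_sub (∑ g ∈ Icc 1 Y, ((ArithmeticFunction.moebius g : ℤ) : ℝ) / (g:ℝ)^2)).abs
  refine le_of_tendsto h2 ?_
  filter_upwards [Filter.eventually_ge_atTop Y] with n hn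
  have e : ∑ g ∈ Icc 1 n, ((ArithmeticFunction.moebius g : ℤ) : ℝ) / (g:ℝ)^2 = ∑ g ∈ Icc 1 Y, ((ArithmeticFunction.moebius g : ℤ) : ℝ) / (g:ℝ)^2 + ∑ g ∈ Ioc Y n, ((ArithmeticFunction.moebius g : ℤ) : ℝ) / (g:ℝ)^2 := by
    rw [← Finset.sum_union]
    · congr 1; ext j; simp; omega
    · rw [Finset.disjoint_left]; intro j; simp; omega
  rw [e, abs_sub_comm, add_sub_cancel_left]
  refine (Finset.abs_sum_le_sum_abs _ _).trans ?_
  calc _ ≤ ∑ g ∈ Ioc Y n, ((g:ℝ)^2)⁻¹ := by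
        refine Finset.sum_le_sum fun g hg => ?_
        rw [Finset.mem_Ioc] at hg
        have hg0 : (0:ℝ) < g := by have := hg.1; exact_mod_cast (by omega)
        rw [abs_div, abs_of_pos (pow_pos hg0 2), div_eq_mul_inv]
        have : |((ArithmeticFunction.moebius g : ℤ) : ℝ)| ≤ 1 := by exact_mod_cast ArithmeticFunction.abs_moebius_le_one
        have h3 : 0 ≤ ((g:ℝ)^2)⁻¹ := by positivity
        nlinarith
    _ ≤ (Y:ℝ)⁻¹ - (n:ℝ)⁻¹ := sum_Ioc_inv_sq_le_sub (by omega) hn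
    _ ≤ _ := by
      have : 0 ≤ (n:ℝ)⁻¹ := by positivity
      rw [one_div]; linarith

lemma mobius_step (x α β κ : ℝ) (hβ : 1 ≤ β) (hκ : κ = α - 1/β) (hκ0 : 0 < κ) (Y : ℕ) (hY : x ≤ κ * Y) :
   ∑ c ∈ Icc 1 Y, (∑ d ∈ (range (Dn β c)).filter (fun d => Nat.Coprime d c), max 0 (x + d - α * c)) / c
    = ∑ g ∈ Icc 1 Y, ((ArithmeticFunction.moebius g : ℤ) : ℝ) * ∑ c ∈ Icc 1 Y, (∑ d ∈ range (Dn β c), max 0 (x/g + d - α * c)) / c := by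
  set μ : ℕ → ℝ := fun g => ((ArithmeticFunction.moebius g : ℤ) : ℝ) with hμ
  set f : ℕ → ℕ → ℝ := fun c d => max 0 (x + d - α * c) / c with hf
  have hfz : ∀ c d, d < Dn β c → Y < c → f c d = 0 := by
    intro c d hd hc
    rw [mem_Dn β hβ] at hd
    have h1 : (d:ℝ) ≤ c * (1/β) := by rw [mul_one_div, le_div_iff₀ (by linarith)]; exact hd.2
    have h2 : (Y:ℝ) ≤ c := by exact_mod_cast hc.le
    have : x + d - α * c ≤ 0 := by rw [hκ] at *; nlinarith
    simp only [hf]; rw [max_eq_left this, zero_div]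
  have hfg : ∀ g c d : ℕ, 1 ≤ g → f (g*c) (g*d) = max 0 (x/g + d - α * c) / c := by
    intro g c d hg
    have hg0 : (0:ℝ) < g := by exact_mod_cast hg
    simp only [hf]
    push_cast
    have e : x + (g:ℝ) * d - α * (g * c) = g * (x / g + d - α * c) := by field_simp
    have : max 0 ((g:ℝ) * (x / g + d - α * c)) = g * max 0 (x/g+d-α*c) := by
      rw [mul_max_of_nonneg _ _ hg0.le, mul_zero]
    rw [e, this, mul_div_mul_left _ _ hg0.ne']
  have hDg : ∀ g c d : ℕ, 1 ≤ g → (g * d < Dn β (g*c) ↔ d < Dn β c) := by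
    intro g c d hg
    have hg0 : (0:ℝ) < g := by exact_mod_cast hg
    rw [mem_Dn β hβ, mem_Dn β hβ]
    push_cast
    rw [Nat.mul_lt_mul_left (by omega), mul_assoc, mul_le_mul_iff_right₀ hg0]
  -- left side
  have L : ∀ c ∈ Icc 1 Y, (∑ d ∈ (range (Dn β c)).filter (fun d => Nat.Coprime d c), max 0 (x + d - α * c)) / c
      = ∑ g ∈ Icc 1 Y, if g ∣ c then ∑ d ∈ (range (Dn β c)).filter (fun d => g ∣ d), μ g * f c d else 0 := by
    intro c hc
    rw [Finset.mem_Icc] at hc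
    rw [Finset.sum_div, Finset.sum_filter]
    have : ∀ d ∈ range (Dn β c), (if Nat.Coprime d c then max 0 (x + d - α * c) / c else 0) = ∑ g ∈ Icc 1 Y, if g ∣ c ∧ g ∣ d then μ g * f c d else 0 := by
      intro d _
      have hg : Nat.gcd d c ≠ 0 := Nat.gcd_ne_zero_right (by omega)
      have h1 := sum_mu _ hg
      have h2 : ∑ g ∈ Icc 1 Y, (if g ∣ c ∧ g ∣ d then μ g * f c d else 0) = (∑ g ∈ (Nat.gcd d c).divisors, μ g) * f c d := by
        rw [← Finset.sum_filter, Finset.sum_mul]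
        refine Finset.sum_congr ?_ fun _ _ => rfl
        ext g
        simp only [Finset.mem_filter, Finset.mem_Icc, Nat.mem_divisors, Nat.dvd_gcd_iff]
        constructor
        · rintro ⟨_, h1, h2⟩; exact ⟨⟨h2, h1⟩, hg⟩
        · rintro ⟨⟨h2, h1⟩, _⟩
          exact ⟨⟨Nat.pos_of_dvd_of_pos h1 (by omega), (Nat.le_of_dvd (by omega) h1).trans hc.2⟩, h1, h2⟩
      rw [h2, h1]
      unfold Nat.Coprime
      split_ifs <;> simp [hf]
    rw [Finset.sum_congr rfl this, Finset.sum_comm]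
    refine Finset.sum_congr rfl fun g _ => ?_
    by_cases h : g ∣ c
    · simp only [h, true_and, if_true, Finset.sum_filter]
    · simp [h]
  rw [Finset.sum_congr rfl L, Finset.sum_comm]
  refine Finset.sum_congr rfl fun g hg => ?_
  rw [Finset.mem_Icc] at hg
  have hg1 := hg.1
  rw [← Finset.sum_filter]
  have R : ∀ c, (∑ d ∈ range (Dn β c), max 0 (x/g + d - α * c)) / c = ∑ d ∈ (range (Dn β (g*c))).filter (fun d => g ∣ d), f (g*c) d := by
    intro c
    rw [Finset.sum_div]
    refine Finset.sum_nbij' (fun d => g * d) (fun d => d / g) ?_ ?_ ?_ ?_ ?_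
    · intro d hd; rw [Finset.mem_range] at hd; rw [Finset.mem_filter, Finset.mem_range, hDg g c d hg1]; exact ⟨hd, dvd_mul_right _ _⟩
    · intro d hd; rw [Finset.mem_filter, Finset.mem_range] at hd
      obtain ⟨e, rfl⟩ := hd.2
      rw [hDg g c e hg1] at hd
      rw [Finset.mem_range, Nat.mul_div_cancel_left _ (by omega)]; exact hd.1
    · intro d _; exact Nat.mul_div_cancel_left _ (by omega)
    · intro d hd; rw [Finset.mem_filter] at hd; exact Nat.mul_div_cancel' hd.2
    · intro d _; rw [hfg g c d hg1]
  rw [Finset.sum_congr rfl (fun c _ => R c)]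
  have S : ∑ c ∈ Icc 1 Y, ∑ d ∈ (range (Dn β (g*c))).filter (fun d => g ∣ d), f (g*c) d
     = ∑ c ∈ Icc 1 (Y/g), ∑ d ∈ (range (Dn β (g*c))).filter (fun d => g ∣ d), f (g*c) d := by
    symm
    refine Finset.sum_subset (Finset.Icc_subset_Icc le_rfl (Nat.div_le_self _ _)) ?_
    intro c hc hc'
    rw [Finset.mem_Icc] at hc hc'
    have : Y < g * c := by
      have : Y / g < c := by omega
      rw [Nat.div_lt_iff_lt_mul (by omega)] at this
      rw [mul_comm]; exact this
    refine Finset.sum_eq_zero fun d hd => ?_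
    rw [Finset.mem_filter, Finset.mem_range] at hd
    exact hfz _ _ hd.1 this
  rw [S, Finset.mul_sum]
  refine Finset.sum_nbij' (fun c => c / g) (fun c => g * c) ?_ ?_ ?_ ?_ ?_
  · intro c hc
    rw [Finset.mem_filter, Finset.mem_Icc] at hc
    rw [Finset.mem_Icc]
    obtain ⟨e, rfl⟩ := hc.2
    refine ⟨?_, Nat.div_le_div_right hc.1.2⟩
    rw [Nat.mul_div_cancel_left _ (by omega)]
    exact Nat.pos_of_mul_pos_left (by omega : 0 < g * e)
  · intro c hc
    rw [Finset.mem_Icc] at hc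
    rw [Finset.mem_filter, Finset.mem_Icc]
    refine ⟨⟨Nat.mul_pos (by omega) (by omega), ?_⟩, dvd_mul_right _ _⟩
    have := (Nat.le_div_iff_mul_le (by omega)).mp hc.2
    rw [mul_comm]; exact this
  · intro c hc; rw [Finset.mem_filter] at hc; exact Nat.mul_div_cancel' hc.2
  · intro c _; exact Nat.mul_div_cancel_left _ (by omega)
  · intro c hc
    rw [Finset.mem_filter] at hc
    rw [Nat.mul_div_cancel' hc.2, Finset.mul_sum]

end MainT


namespace MainT
open Finset Kloo

lemma per_c (N c : ℕ) (hc : 1 ≤ c) (α β : ℝ) (G : ℝ) (hG0 : 0 ≤ G)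
   (hG : ∀ (_ : NeZero c) (m n : ZMod c), ‖Kl (ZMod.stdAddChar : AddChar (ZMod c) ℂ) m n‖ ≤ G * Nat.gcd n.val c) :
   |∑ d ∈ range (Dn β c), (((Ico ⌈α * c⌉ ((N:ℤ) + 1 + (d:ℤ))).filter fun a : ℤ => (c:ℤ) ∣ a * d + 1).card : ℝ)
     - (∑ d ∈ (range (Dn β c)).filter (fun d => Nat.Coprime d c), max 0 ((N:ℝ) + d - α * c)) / c|
     ≤ 2 * G * c.divisors.card * (2 + Real.log c) ^ 2 + 1 := by
  have : NeZero c := ⟨by omega⟩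
  have hc0 : (0:ℝ) < c := by exact_mod_cast hc
  set A := ⌈α * c⌉ with hA
  have hA1 : α * c ≤ A := Int.le_ceil _
  have hA2 : (A:ℝ) < α * c + 1 := Int.ceil_lt_add_one _
  set D := Dn β c with hD
  have hDc : D ≤ c := min_le_left _ _
  set d0 := (A - N - 1).toNat with hd0
  have hsub : Ico d0 D ⊆ range D := by intro d; simp
  have h := Four.count_main (c := c) d0 D hDc A ((N:ℤ)+1) (by
    intro d hd; rw [Finset.mem_Ico] at hd; omega) G hG0 (hG inferInstance)
  have e1 : ∑ d ∈ Ico d0 D, (((Ico A ((N:ℤ) + 1 + (d:ℤ))).filter fun a : ℤ => (c:ℤ) ∣ a * d + 1).card : ℝ)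
     = ∑ d ∈ range D, (((Ico A ((N:ℤ) + 1 + (d:ℤ))).filter fun a : ℤ => (c:ℤ) ∣ a * d + 1).card : ℝ) := by
    refine Finset.sum_subset hsub ?_
    intro d hd hd'
    rw [Finset.mem_range] at hd
    rw [Finset.mem_Ico] at hd'
    rw [Finset.Ico_eq_empty (by omega)]
    simp
  have e2 : ∑ d ∈ (Ico d0 D).filter (fun d => Nat.Coprime d c), max 0 ((N:ℝ) + d - α * c) / c
     = ∑ d ∈ (range D).filter (fun d => Nat.Coprime d c), max 0 ((N:ℝ) + d - α * c) / c := by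
    refine Finset.sum_subset (Finset.filter_subset_filter _ hsub) ?_
    intro d hd hd'
    simp only [Finset.mem_filter, Finset.mem_range, Finset.mem_Ico] at hd hd'
    have h1 : d < d0 := by
      by_contra h; exact hd' ⟨⟨by omega, hd.1⟩, hd.2⟩
    have h2 : (N:ℤ) + d + 1 < A := by omega
    have h3 : (N:ℝ) + d + 1 < A := by exact_mod_cast h2
    rw [max_eq_left (by linarith), zero_div]
  rw [e1] at h
  rw [Finset.sum_div, ← e2]
  have h3 : |∑ d ∈ (Ico d0 D).filter (fun d => Nat.Coprime d c), (((N:ℤ) + 1 + (d:ℤ) - A : ℤ) : ℝ) / c - ∑ d ∈ (Ico d0 D).filter (fun d => Nat.Coprime d c), max 0 ((N:ℝ) + d - α * c) / c| ≤ 1 := by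
    rw [← Finset.sum_sub_distrib]
    refine (Finset.abs_sum_le_sum_abs _ _).trans ?_
    calc _ ≤ ∑ d ∈ (Ico d0 D).filter (fun d => Nat.Coprime d c), 1/(c:ℝ) := by
          refine Finset.sum_le_sum fun d hd => ?_
          rw [Finset.mem_filter, Finset.mem_Ico] at hd
          rw [← sub_div, abs_div, abs_of_pos hc0]
          gcongr
          have h4 : A ≤ (N:ℤ) + 1 + d := by omega
          have h5 : (A:ℝ) ≤ (N:ℝ) + 1 + d := by exact_mod_cast h4
          push_cast
          rcases max_cases 0 ((N:ℝ) + d - α * c) with ⟨h6, h7⟩ | ⟨h6, h7⟩ <;> rw [h6, abs_le] <;> constructor <;> linarith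
      _ ≤ ∑ d ∈ range c, 1/(c:ℝ) := by
          refine Finset.sum_le_sum_of_subset_of_nonneg ?_ (fun _ _ _ => by positivity)
          intro d hd
          simp only [Finset.mem_filter, Finset.mem_Ico, Finset.mem_range] at hd ⊢
          omega
      _ = 1 := by simp [hc0.ne']
  exact (abs_sub_le _ _ _).trans (add_le_add h h3)

/-- the counting function -/
noncomputable def Qn (α β : ℝ) (Y N : ℕ) : ℝ :=
  ∑ c ∈ Icc 1 Y, ∑ d ∈ range (Dn β c), (((Ico ⌈α * c⌉ ((N:ℤ) + 1 + (d:ℤ))).filter fun a : ℤ => (c:ℤ) ∣ a * d + 1).card : ℝ)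

lemma main_sum (N Y : ℕ) (hY1 : 1 ≤ Y) (α β κ : ℝ) (hβ : 1 ≤ β) (hκ : κ = α - 1/β) (hκ0 : 0 < κ) (hY : (N:ℝ) ≤ κ * Y) :
   |∑ c ∈ Icc 1 Y, (∑ d ∈ (range (Dn β c)).filter (fun d => Nat.Coprime d c), max 0 ((N:ℝ) + d - α * c)) / c
     - (N:ℝ)^2 * (3/Real.pi^2) * Real.log (α/κ)| ≤ (2 * κ + 1 + κ^2 * |Real.log (α/κ)|) * Y * (2 + Real.log (Y+1:ℕ))^2 := by
  set H := 2 + Real.log (Y+1:ℕ) with hH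
  set L := Real.log (α/κ) with hL
  have hlog : 0 ≤ Real.log (Y+1:ℕ) := Real.log_natCast_nonneg _
  have hH2 : 2 ≤ H := by linarith
  have hY0 : (0:ℝ) < Y := by exact_mod_cast hY1
  rw [mobius_step (N:ℝ) α β κ hβ hκ hκ0 Y hY]
  have h1 : |∑ g ∈ Icc 1 Y, ((ArithmeticFunction.moebius g : ℤ) : ℝ) * ∑ c ∈ Icc 1 Y, (∑ d ∈ range (Dn β c), max 0 ((N:ℝ)/g + d - α * c)) / c
     - ∑ g ∈ Icc 1 Y, ((ArithmeticFunction.moebius g : ℤ) : ℝ) * (((N:ℝ)/g)^2/2 * L)| ≤ (2 * κ + 1) * Y * H^2 := by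
    rw [← Finset.sum_sub_distrib]
    refine (Finset.abs_sum_le_sum_abs _ _).trans ?_
    have hh := Four.harm_le (Y+1)
    calc _ ≤ ∑ g ∈ Icc 1 Y, ((N:ℝ) * H * (1/(g:ℝ)) + (1 + Real.log (Y+1:ℕ))) := by
          refine Finset.sum_le_sum fun g hg => ?_
          rw [Finset.mem_Icc] at hg
          have hg1 : (1:ℝ) ≤ g := by exact_mod_cast hg.1
          have hx : (N:ℝ)/g ≤ N := div_le_self (by positivity) hg1
          have := U_bound ((N:ℝ)/g) α β κ (by positivity) hβ hκ hκ0 Y (hx.trans hY) hh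
          rw [← mul_sub, abs_mul]
          have hm : |((ArithmeticFunction.moebius g : ℤ) : ℝ)| ≤ 1 := by exact_mod_cast ArithmeticFunction.abs_moebius_le_one
          calc _ ≤ 1 * _ := mul_le_mul hm this (abs_nonneg _) zero_le_one
            _ = _ := by rw [hH]; ring
      _ = (N:ℝ) * H * (∑ j ∈ Ico 1 (Y+1), 1/(j:ℝ)) + Y * (1 + Real.log (Y+1:ℕ)) := by
          rw [Finset.sum_add_distrib, Finset.mul_sum]
          rw [Finset.sum_const, Nat.card_Icc, nsmul_eq_mul, Nat.add_sub_cancel]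
          rfl
      _ ≤ (κ * Y) * H * H + Y * H^2 := by
          have a1 : ∑ j ∈ Ico 1 (Y+1), 1/(j:ℝ) ≤ H := by linarith
          have a0 : 0 ≤ ∑ j ∈ Ico 1 (Y+1), 1/(j:ℝ) := Finset.sum_nonneg fun _ _ => by positivity
          have a2 : 1 + Real.log (Y+1:ℕ) ≤ H^2 := by nlinarith
          gcongr
      _ ≤ _ := by
          have : 0 ≤ κ * Y * H^2 := by positivity
          nlinarith
  have h2 : |∑ g ∈ Icc 1 Y, ((ArithmeticFunction.moebius g : ℤ) : ℝ) * (((N:ℝ)/g)^2/2 * L) - (N:ℝ)^2 * (3/Real.pi^2) * L| ≤ κ^2 * |L| * Y * H^2 := by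
    have e : ∑ g ∈ Icc 1 Y, ((ArithmeticFunction.moebius g : ℤ) : ℝ) * (((N:ℝ)/g)^2/2 * L) - (N:ℝ)^2 * (3/Real.pi^2) * L
      = ((N:ℝ)^2/2 * L) * (∑ g ∈ Icc 1 Y, ((ArithmeticFunction.moebius g : ℤ) : ℝ)/(g:ℝ)^2 - 6/Real.pi^2) := by
      rw [mul_sub, Finset.mul_sum]
      congr 1
      · refine Finset.sum_congr rfl fun g _ => ?_
        rw [div_pow]; ring
      · ring
    rw [e, abs_mul, abs_mul, abs_of_nonneg (show 0 ≤ (N:ℝ)^2/2 by positivity)]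
    calc _ ≤ (N:ℝ)^2/2 * |L| * (1/Y) := by gcongr; exact mu_tail Y hY1
      _ ≤ (κ * Y)^2/2 * |L| * (1/Y) := by gcongr
      _ = κ^2 * |L| * Y * (1/2) := by field_simp
      _ ≤ κ^2 * |L| * Y * H^2 := by gcongr; nlinarith
  calc _ ≤ _ := (abs_sub_le _ _ _).trans (add_le_add h1 h2)
    _ = _ := by ring

theorem Q_asymp (α β κ : ℝ) (hβ : 1 ≤ β) (hκ : κ = α - 1/β) (hκ0 : 0 < κ) (ε : ℝ) (hε : 0 < ε) :
    ∃ K > (0:ℝ), ∀ N : ℕ, 1 ≤ N → |Qn α β ⌈(N:ℝ)/κ⌉₊ N - (N:ℝ)^2 * (3/Real.pi^2) * Real.log (α/κ)| ≤ K * (N:ℝ)^(3/2+ε) := by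
  obtain ⟨G, hG0, hG, hGs⟩ := Four.exists_G
  obtain ⟨K1, hK1, hK⟩ := hGs ε hε
  set C := 2 * κ + 1 + κ^2 * |Real.log (α/κ)| with hC
  have hC0 : 0 < C := by positivity
  refine ⟨(K1 + 1 + C * (3 + 1/(1/4))^2) * (1/κ+1)^(3/2+ε), by positivity, fun N hN => ?_⟩
  set Y := ⌈(N:ℝ)/κ⌉₊ with hYdef
  have hN0 : (1:ℝ) ≤ N := by exact_mod_cast hN
  have hY0 : 0 < Y := Nat.ceil_pos.mpr (by positivity)
  have hY1 : (1:ℝ) ≤ Y := by exact_mod_cast hY0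
  have hYN : (N:ℝ) ≤ κ * Y := by
    have := Nat.le_ceil ((N:ℝ)/κ)
    rw [div_le_iff₀ hκ0] at this
    rw [mul_comm]; exact this
  have hYle : (Y:ℝ) ≤ (1/κ+1) * N := by
    have := (Nat.ceil_lt_add_one (show 0 ≤ (N:ℝ)/κ by positivity)).le
    calc (Y:ℝ) ≤ (N:ℝ)/κ + 1 := this
      _ ≤ (N:ℝ)/κ + N := by linarith
      _ = _ := by ring
  have h2 := main_sum N Y hY0 α β κ hβ hκ hκ0 hYN
  have h1 : |Qn α β Y N - ∑ c ∈ Icc 1 Y, (∑ d ∈ (range (Dn β c)).filter (fun d => Nat.Coprime d c), max 0 ((N:ℝ) + d - α * c)) / c| ≤ K1 * (Y:ℝ)^(3/2+ε) + (Y:ℝ) := by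
    unfold Qn
    rw [← Finset.sum_sub_distrib]
    refine (Finset.abs_sum_le_sum_abs _ _).trans ?_
    calc _ ≤ ∑ c ∈ Icc 1 Y, (2 * G c * c.divisors.card * (2 + Real.log c) ^ 2 + 1) := by
          refine Finset.sum_le_sum fun c hc => ?_
          rw [Finset.mem_Icc] at hc
          exact per_c N c hc.1 α β (G c) (hG0 c) (hG c)
      _ = ∑ c ∈ Icc 1 Y, (2 * G c * c.divisors.card * (2 + Real.log c) ^ 2) + (Y:ℝ) := by
          rw [Finset.sum_add_distrib]; simp
      _ ≤ _ := by have := hK Y hY0; linarith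
  have hlog := Four.log_bound (1/4) (by norm_num) Y hY1
  have hl0 : 0 ≤ Real.log ((Y:ℝ)+1) := Real.log_nonneg (by linarith)
  have hp : (Y:ℝ) ≤ (Y:ℝ)^(3/2+ε) := by
    conv_lhs => rw [← Real.rpow_one (Y:ℝ)]
    exact Real.rpow_le_rpow_of_exponent_le hY1 (by linarith)
  have hq : C * Y * (2 + Real.log (Y+1:ℕ))^2 ≤ C * (3 + 1/(1/4))^2 * (Y:ℝ)^(3/2+ε) := by
    push_cast
    calc _ ≤ C * Y * ((3 + 1/(1/4)) * (Y:ℝ)^(1/4:ℝ))^2 := by gcongr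
      _ = C * (3 + 1/(1/4))^2 * (((Y:ℝ)^(1/4:ℝ))^2 * Y) := by ring
      _ = C * (3 + 1/(1/4))^2 * (Y:ℝ)^(3/2:ℝ) := by
        congr 1
        rw [← Real.rpow_natCast, ← Real.rpow_mul (by linarith), ← Real.rpow_add_one (by linarith)]
        norm_num
      _ ≤ _ := by
        gcongr
        · linarith
  calc _ ≤ _ := (abs_sub_le _ _ _).trans (add_le_add h1 h2)
    _ ≤ (K1 + 1 + C * (3 + 1/(1/4))^2) * (Y:ℝ)^(3/2+ε) := by nlinarith
    _ ≤ (K1 + 1 + C * (3 + 1/(1/4))^2) * ((1/κ+1) * N)^(3/2+ε) := by gcongr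
    _ = _ := by rw [Real.mul_rpow (by positivity) (by positivity)]; ring

end MainT


namespace Dyn

/-- partial products -/
noncomputable def Pn (ω : ℝ) (n : ℕ) : Matrix (Fin 2) (Fin 2) ℤ :=
  ((List.range n).map (fun i => Mmat (1 + ⌊TB^[i] ω⌋) (-1))).prod

lemma Pn_succ (ω : ℝ) (n : ℕ) : Pn ω (n+1) = Pn ω n * Mmat (1 + ⌊TB^[n] ω⌋) (-1) := by
  unfold Pn
  rw [List.range_succ, List.map_append, List.prod_append]
  simp

lemma Pn_add (ω : ℝ) (m n : ℕ) : Pn ω (m+n) = Pn ω m * Pn (TB^[m] ω) n := by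
  induction n with
  | zero => simp [Pn]
  | succ n ih => rw [← add_assoc, Pn_succ, ih, Pn_succ, mul_assoc, ← Function.iterate_add_apply, add_comm n m]

lemma Pn_one (ω : ℝ) : Pn ω 1 = Mmat (1 + ⌊ω⌋) (-1) := by simp [Pn]

lemma Pn_mul (ω : ℝ) (n k : ℕ) (h : TB^[n] ω = ω) : Pn ω (n * k) = Pn ω n ^ k := by
  induction k with
  | zero => simp [Pn]
  | succ k ih =>
    rw [mul_add, mul_one, Pn_add, ih, pow_succ]
    have : TB^[n*k] ω = ω := by
      rw [Function.iterate_mul]; exact Function.iterate_fixed h k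
    rw [this]

lemma TB_gt (u : ℝ) (hu : Irrational u) : 1 < TB u ∧ Irrational (TB u) ∧ u * TB u = (1 + ⌊u⌋ : ℤ) * TB u - 1 := by
  have h1 := Int.floor_le u
  have h2 := Int.lt_floor_add_one u
  have h3 : (⌊u⌋:ℝ) ≠ u := fun h => hu ⟨⌊u⌋, by exact_mod_cast h⟩
  have h4 : (⌊u⌋:ℝ) < u := lt_of_le_of_ne h1 h3
  have h5 : 0 < ((1 + ⌊u⌋ : ℤ) : ℝ) - u := by push_cast; linarith
  have h6 : ((1 + ⌊u⌋ : ℤ) : ℝ) - u < 1 := by push_cast; linarith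
  refine ⟨?_, ?_, ?_⟩
  · unfold TB; rw [lt_div_iff₀ h5]; linarith
  · unfold TB
    rw [one_div]
    exact (hu.intCast_sub _).inv
  · unfold TB; field_simp; ring

lemma TB_iter (u : ℝ) (hu : Irrational u) (n : ℕ) : Irrational (TB^[n] u) := by
  induction n with
  | zero => exact hu
  | succ n ih => rw [Function.iterate_succ_apply']; exact (TB_gt _ ih).2.1

/-- eigen relation -/
lemma Pn_eig (ω : ℝ) (hω : Irrational ω) (n : ℕ) (hn : 1 ≤ n) : ∃ l : ℝ, 1 < l ∧
    ((Pn ω n 0 0 : ℤ):ℝ) * TB^[n] ω + (Pn ω n 0 1 : ℤ) = l * ω ∧ ((Pn ω n 1 0 : ℤ):ℝ) * TB^[n] ω + (Pn ω n 1 1 : ℤ) = l := by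
  induction n, hn using Nat.le_induction with
  | base =>
    obtain ⟨h1, _, h3⟩ := TB_gt ω hω
    refine ⟨TB ω, h1, ?_, ?_⟩
    · rw [Pn_one]; simp only [Mmat, Function.iterate_one]; push_cast at h3; simp; linarith
    · rw [Pn_one]; simp [Mmat]
  | succ n hn ih =>
    obtain ⟨l, hl, e1, e2⟩ := ih
    obtain ⟨h1, _, h3⟩ := TB_gt _ (TB_iter ω hω n)
    refine ⟨l * TB (TB^[n] ω), by nlinarith, ?_, ?_⟩
    · rw [Pn_succ, Function.iterate_succ_apply']
      simp only [Mmat, Matrix.mul_apply, Fin.sum_univ_two]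
      simp
      push_cast at h3
      linear_combination (TB (TB^[n] ω)) * e1 - ((Pn ω n 0 0 : ℤ):ℝ) * h3
    · rw [Pn_succ, Function.iterate_succ_apply']
      simp only [Mmat, Matrix.mul_apply, Fin.sum_univ_two]
      simp
      push_cast at h3
      linear_combination (TB (TB^[n] ω)) * e2 - ((Pn ω n 1 0 : ℤ):ℝ) * h3

lemma TB_floor (ω : ℝ) (hω : Irrational ω) (h1 : 1 < ω) (n : ℕ) : 1 ≤ ⌊TB^[n] ω⌋ := by
  rw [Int.le_floor]
  cases n with
  | zero => simpa using h1.le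
  | succ n => rw [Function.iterate_succ_apply']; have := (TB_gt _ (TB_iter ω hω n)).1; push_cast; exact this.le

/-- shape -/
lemma Pn_shape (ω : ℝ) (hω : Irrational ω) (h1 : 1 < ω) (n : ℕ) (hn : 1 ≤ n) :
    ∃ a b c d : ℤ, Pn ω n = !![a, -b; c, -d] ∧ b * c - a * d = 1 ∧ 0 ≤ d ∧ d < c := by
  induction n, hn using Nat.le_induction with
  | base => exact ⟨1 + ⌊ω⌋, 1, 1, 0, by rw [Pn_one]; simp [Mmat], by ring, le_rfl, by norm_num⟩
  | succ n hn ih =>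
    obtain ⟨a, b, c, d, h, h2, h3, h4⟩ := ih
    have hf := TB_floor ω hω h1 n
    refine ⟨a * (1 + ⌊TB^[n] ω⌋) - b, a, c * (1 + ⌊TB^[n] ω⌋) - d, c, ?_, ?_, ?_, ?_⟩
    · rw [Pn_succ, h]
      ext i j; fin_cases i <;> fin_cases j <;> simp [Mmat, Matrix.mul_apply, Fin.sum_univ_two] <;> ring
    · linear_combination h2
    · omega
    · nlinarith

lemma TB_of (a : ℤ) (z w : ℝ) (hz : 1 < z) (hw : w = a - 1/z) : ⌊w⌋ = a - 1 ∧ TB w = z := by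
  have h0 : 0 < 1/z := by positivity
  have h1 : 1/z < 1 := by rw [div_lt_one (by linarith)]; exact hz
  have hf : ⌊w⌋ = a - 1 := by
    rw [Int.floor_eq_iff]; push_cast; constructor <;> linarith
  refine ⟨hf, ?_⟩
  unfold TB
  rw [hf, hw]
  push_cast
  have : (1 + ((a:ℝ) - 1) - (a - 1/z)) = 1/z := by ring
  rw [this, one_div_one_div]

/-- descent -/
theorem descent (n : ℕ) : ∀ (a b c d : ℤ) (z w : ℝ), c.toNat ≤ n → b * c - a * d = 1 → 0 ≤ d → d < c → 1 < z →
    w * (c * z - d) = a * z - b → ∃ l : ℕ, 1 ≤ l ∧ TB^[l] w = z ∧ !![a, -b; c, -d] = Pn w l := by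
  induction n with
  | zero => intro a b c d z w h1 h2 h3 h4; omega
  | succ n ih =>
    intro a b c d z w h1 h2 h3 h4 hz hw
    have hz0 : z ≠ 0 := by linarith
    rcases (show c = 1 ∨ 2 ≤ c by omega) with hc | hc
    · have hd : d = 0 := by omega
      subst hc; subst hd
      have hb : b = 1 := by linarith
      subst hb
      have hw' : w = a - 1/z := by
        push_cast at hw; field_simp; linarith
      obtain ⟨e1, e2⟩ := TB_of a z w hz hw'
      refine ⟨1, le_rfl, e2, ?_⟩
      rw [Pn_one, e1]; simp [Mmat]
    · have hd1 : 1 ≤ d := by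
        by_contra h
        have : d = 0 := by omega
        rw [this] at h2
        have h5 : c ∣ 1 := ⟨b, by linarith⟩
        have := Int.le_of_dvd (by norm_num) h5
        omega
      obtain ⟨a1, r, hr0, hrc, ha1⟩ : ∃ a1 r : ℤ, 0 ≤ r ∧ r < c ∧ r = a1 * c - a := by
        refine ⟨-((-a)/c), (-a) % c, Int.emod_nonneg _ (by omega), Int.emod_lt_of_pos _ (by omega), ?_⟩
        have := Int.emod_add_mul_ediv (-a) c
        linarith
      obtain ⟨s, hs⟩ : ∃ s : ℤ, s = a1 * d - b := ⟨_, rfl⟩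
      have hdet : d * r - c * s = 1 := by rw [ha1, hs]; linarith
      have hr1 : 1 ≤ r := by
        by_contra h
        have : r = 0 := by omega
        rw [this] at hdet
        have h5 : c ∣ 1 := ⟨-s, by linarith⟩
        have := Int.le_of_dvd (by norm_num) h5
        omega
      have hs0 : 0 ≤ s := by
        by_contra h
        nlinarith [mul_pos (show 0 < d by omega) (show 0 < r by omega)]
      have hsr : s < r := by
        by_contra h
        nlinarith
      have hrs : r - s ≤ c - d := by
        by_contra h
        nlinarith
      have hrsR : (r:ℝ) - s ≤ c - d := by exact_mod_cast hrs
      have hrc1 : (r:ℝ) + 1 ≤ c := by exact_mod_cast hrc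
      have hsr1 : (s:ℝ) + 1 ≤ r := by exact_mod_cast hsr
      have hs0R : (0:ℝ) ≤ s := by exact_mod_cast hs0
      have hdcR : (d:ℝ) + 1 ≤ c := by exact_mod_cast h4
      have hd0R : (0:ℝ) ≤ d := by exact_mod_cast h3
      have hq : 0 < (r:ℝ) * z - s := by nlinarith
      have hp : 0 < (c:ℝ) * z - d := by nlinarith
      set z' := ((c:ℝ) * z - d) / (r * z - s) with hz'
      have hz1 : 1 < z' := by
        rw [hz', lt_div_iff₀ hq]; nlinarith
      have hw' : w = a1 - 1/z' := by
        have e : w = ((a:ℝ) * z - b) / (c * z - d) := by rw [eq_div_iff hp.ne', hw]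
        have e3 : (r:ℝ) = a1 * c - a := by exact_mod_cast ha1
        have e4 : (s:ℝ) = a1 * d - b := by exact_mod_cast hs
        rw [e, hz', one_div_div, eq_sub_iff_add_eq, ← add_div, div_eq_iff hp.ne', e3, e4]
        ring
      obtain ⟨e1, e2⟩ := TB_of a1 z' w hz1 hw'
      obtain ⟨l, hl, e3, e4⟩ := ih c d r s z z' (by omega) hdet hs0 hsr hz (by rw [hz']; exact div_mul_cancel₀ _ hq.ne')
      refine ⟨1 + l, by omega, ?_, ?_⟩
      · rw [add_comm, Function.iterate_add_apply, Function.iterate_one, e2, e3]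
      · rw [Pn_add, Function.iterate_one, e2, ← e4, Pn_one, e1]
        ext i j; fin_cases i <;> fin_cases j <;> simp [Mmat, Matrix.mul_apply, Fin.sum_univ_two] <;> linarith

end Dyn


namespace Dyn

lemma per_data (ω : ℝ) (h : ∃ l : ℕ, 1 ≤ l ∧ TB^[l] ω = ω) :
    1 ≤ perB ω ∧ TB^[perB ω] ω = ω ∧ (∀ l : ℕ, TB^[l] ω = ω → perB ω ∣ l) ∧ OmegaB ω = Pn ω (perB ω) := by
  obtain ⟨l, hl, hl2⟩ := h
  have hne : {n : ℕ | 0 < n ∧ TB^[n] ω = ω}.Nonempty := ⟨l, hl, hl2⟩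
  have hm := Nat.sInf_mem hne
  have hper : perB ω = Function.minimalPeriod TB ω := by
    apply le_antisymm
    · apply Nat.sInf_le
      have hp : Function.IsPeriodicPt TB l ω := hl2
      exact ⟨hp.minimalPeriod_pos hl, Function.isPeriodicPt_minimalPeriod TB ω⟩
    · have hp : Function.IsPeriodicPt TB (perB ω) ω := hm.2
      exact hp.minimalPeriod_le hm.1
  refine ⟨hm.1, hm.2, ?_, rfl⟩
  intro k hk
  rw [hper]
  exact Function.IsPeriodicPt.minimalPeriod_dvd hk

lemma eig_trace (a b c d : ℤ) (ω l : ℝ) (hdet : b * c - a * d = 1) (hl : 1 < l) (h1 : a * ω - b = l * ω) (h2 : c * ω - d = l) :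
    (a:ℝ) - d = l + 1/l := by
  have hd : (b:ℝ) * c - a * d = 1 := by exact_mod_cast hdet
  have : ((a:ℝ) - d) * l = l * l + 1 := by
    have e : (c:ℝ) * ω = l + d := by linarith
    have e2 : ((a:ℝ) - l) * ω = b := by linarith
    have : ((a:ℝ) - l) * (c * ω) = b * c := by rw [← e2]; ring
    rw [e] at this
    linarith
  have hl0 : l ≠ 0 := by linarith
  field_simp
  linarith

lemma spec_of (t l : ℝ) (hl : 1 < l) (h : t = l + 1/l) : (t + Real.sqrt (t^2 - 4))/2 = l := by
  have hl0 : l ≠ 0 := by linarith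
  have h1 : 1/l < l := by
    rw [div_lt_iff₀ (by linarith)]; nlinarith
  have : t^2 - 4 = (l - 1/l)^2 := by rw [h]; field_simp; ring
  rw [this, Real.sqrt_sq (by linarith), h]; ring

lemma irr_lin (ω : ℝ) (hω : Irrational ω) (p q : ℤ) (h : (p:ℝ) * ω + q = 0) : p = 0 ∧ q = 0 := by
  have hp : p = 0 := by
    by_contra hp
    have hp' : (p:ℝ) ≠ 0 := by exact_mod_cast hp
    apply hω
    refine ⟨-(q:ℚ)/p, ?_⟩
    push_cast
    field_simp
    linarith
  refine ⟨hp, ?_⟩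
  rw [hp] at h
  simpa using h

lemma conj_root (ω ω' : ℝ) (h : IsConjPair ω ω') (p q r : ℤ) (hr : (p:ℝ) * ω^2 + q * ω + r = 0) :
    (p:ℝ) * ω'^2 + q * ω' + r = 0 ∧ (p:ℝ) * (ω + ω') = - q := by
  obtain ⟨hω, A, B, C, hA, _, h1, h2, h3⟩ := h
  have hA' : (A:ℝ) ≠ 0 := by exact_mod_cast hA.ne'
  have := irr_lin ω hω (p * B - A * q) (p * C - A * r) (by push_cast; linear_combination (p:ℝ) * h1 - A * hr)
  have e1 : (p:ℝ) * B = A * q := by have := this.1; exact_mod_cast (by linarith : p * B = A * q)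
  have e2 : (p:ℝ) * C = A * r := by have := this.2; exact_mod_cast (by linarith : p * C = A * r)
  constructor
  · have : (A:ℝ) * ((p:ℝ) * ω'^2 + q * ω' + r) = 0 := by
      linear_combination (p:ℝ) * h2 - e1 * ω' - e2
    exact (mul_eq_zero.mp this).resolve_left hA'
  · have e3 : (ω - ω') * ((A:ℝ) * (ω + ω') + B) = 0 := by linear_combination h1 - h2
    have e4 := (mul_eq_zero.mp e3).resolve_left (sub_ne_zero.mpr (Ne.symm h3))
    have : (A:ℝ) * ((p:ℝ) * (ω + ω') + q) = 0 := by linear_combination (p:ℝ) * e4 - e1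
    have := (mul_eq_zero.mp this).resolve_left hA'
    linarith

lemma periodic (ω ω' : ℝ) (h : IsConjPair ω ω') (h1 : 1 < ω) (h2 : 0 < ω') (h3 : ω' < 1) : ∃ l : ℕ, 1 ≤ l ∧ TB^[l] ω = ω := by
  obtain ⟨hω, A, B, C, hA, _, e1, e2, e3⟩ := h
  have hA' : (0:ℝ) < A := by exact_mod_cast hA
  have e4 : (A:ℝ) * (ω + ω') + B = 0 := by
    have : (ω - ω') * ((A:ℝ) * (ω + ω') + B) = 0 := by linear_combination e1 - e2
    exact (mul_eq_zero.mp this).resolve_left (sub_ne_zero.mpr (Ne.symm e3))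
  have hD : ((B^2 - 4 * A * C : ℤ) : ℝ) = (A * (ω - ω'))^2 := by
    push_cast
    have hB : (B:ℝ) = - (A * (ω + ω')) := by linarith
    have hC : (C:ℝ) = A * ω * ω' := by rw [hB] at e1; linear_combination e1
    rw [hB, hC]; ring
  have hs : 0 < (A:ℝ) * (ω - ω') := mul_pos hA' (by linarith)
  have hDpos : 0 < B^2 - 4 * A * C := by
    have : (0:ℝ) < ((B^2 - 4 * A * C : ℤ) : ℝ) := by rw [hD]; positivity
    exact_mod_cast this
  have hns : ¬ IsSquare (B^2 - 4 * A * C) := by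
    rintro ⟨r, hr⟩
    have h5 : (A * (ω - ω'))^2 = ((|r| : ℤ):ℝ)^2 := by
      rw [← hD, hr]; push_cast; rw [sq_abs]; ring
    have h6 : (A:ℝ) * (ω - ω') = ((|r| : ℤ):ℝ) := by
      apply (pow_left_inj₀ hs.le (by positivity) (two_ne_zero)).mp h5
    have := irr_lin ω hω (2 * A) (B - |r|) (by push_cast at h6 ⊢; linarith)
    omega
  obtain ⟨x, y, hxy, hy⟩ := Pell.exists_of_not_isSquare hDpos hns
  -- normalise signs
  obtain ⟨x, y, hxy, hx, hy⟩ : ∃ x y : ℤ, x^2 - (B^2 - 4 * A * C) * y^2 = 1 ∧ 0 < x ∧ 0 < y := by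
    refine ⟨|x|, |y|, by rw [sq_abs, sq_abs]; exact hxy, abs_pos.mpr ?_, abs_pos.mpr hy⟩
    rintro rfl
    nlinarith [mul_nonneg hDpos.le (sq_nonneg y)]
  have hyR : (1:ℝ) ≤ y := by exact_mod_cast hy
  have hxR : (1:ℝ) ≤ x := by exact_mod_cast hx
  have hxyR : (x:ℝ)^2 - (A * (ω - ω'))^2 * y^2 = 1 := by rw [← hD]; exact_mod_cast hxy
  have hprod : ((x:ℝ) + y * (A * (ω - ω'))) * (x - y * (A * (ω - ω'))) = 1 := by linarith
  have hlam : 1 < (x:ℝ) + y * (A * (ω - ω')) := by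
    have : 0 < (y:ℝ) * (A * (ω - ω')) := by positivity
    linarith
  have hlam' : 0 < (x:ℝ) - y * (A * (ω - ω')) ∧ (x:ℝ) - y * (A * (ω - ω')) < 1 := by
    constructor
    · by_contra hh; nlinarith
    · by_contra hh; nlinarith
  have hBR : (B:ℝ) = - (A * (ω + ω')) := by linarith
  have dR : (((-(B * y) - x : ℤ)) : ℝ) = 2 * A * y * ω' - (x - y * (A * (ω - ω'))) := by
    push_cast; rw [hBR]; ring
  obtain ⟨l, hl, h5, _⟩ := descent (2 * A * y).toNat (x - B * y) (2 * C * y) (2 * A * y) (-(B * y) - x) ω ω le_rfl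
    (by linear_combination hxy)
    (by
      have : (-1:ℝ) < ((-(B * y) - x : ℤ) : ℝ) := by
        rw [dR]; have : 0 < 2 * A * y * ω' := by positivity
        linarith [hlam'.2]
      have : (-1:ℤ) < (-(B * y) - x : ℤ) := by exact_mod_cast this
      omega)
    (by
      have : ((-(B * y) - x : ℤ) : ℝ) < ((2 * A * y : ℤ):ℝ) := by
        rw [dR]; push_cast
        have : 0 < 2 * A * y * (1 - ω') := by have : 0 < 1 - ω' := by linarith
                                              positivity
        nlinarith [hlam'.1]
      exact_mod_cast this) h1
    (by push_cast; linear_combination 2 * y * e1)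
  exact ⟨l, hl, h5⟩

theorem reduced_data (ω ω' : ℝ) (h : IsConjPair ω ω') (h1 : 1 < ω) (h2 : 0 < ω') (h3 : ω' < 1) :
    ∃ a b c d : ℤ, ∃ l : ℝ, OmegaB ω = !![a, -b; c, -d] ∧ b * c - a * d = 1 ∧ 0 ≤ d ∧ d < c ∧ 1 < l ∧ a * ω - b = l * ω ∧
      c * ω = d + l ∧ c * ω' = d + 1/l ∧ (a:ℝ) - d = l + 1/l ∧ specRad (OmegaB ω) = l := by
  have hω := h.1
  obtain ⟨p1, p2, p3, p4⟩ := per_data ω (periodic ω ω' h h1 h2 h3)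
  obtain ⟨a, b, c, d, s1, s2, s3, s4⟩ := Pn_shape ω hω h1 (perB ω) p1
  obtain ⟨l, hl, e1, e2⟩ := Pn_eig ω hω (perB ω) p1
  rw [p2, s1] at e1 e2
  simp at e1 e2
  have f1 : a * ω - b = l * ω := by linarith
  have f2 : c * ω - d = l := by linarith
  have ht := eig_trace a b c d ω l s2 hl f1 f2
  refine ⟨a, b, c, d, l, by rw [p4, s1], s2, s3, s4, hl, f1, by linarith, ?_, ht, ?_⟩
  · have hc := conj_root ω ω' h c (-(a + d)) b (by push_cast; linear_combination ω * f2 - f1)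
    have h5 := hc.2
    push_cast at h5
    linarith
  · have : ((OmegaB ω).trace : ℝ) = l + 1/l := by
      rw [p4, s1, Matrix.trace_fin_two]; simp; simp at ht; linarith
    unfold specRad
    exact spec_of _ l hl this

theorem fix_data (ω : ℝ) (h1 : 1 < ω) (a b c d : ℤ) (hdet : b * c - a * d = 1) (hd : 0 ≤ d) (hdc : d < c)
    (hq : (c:ℝ) * ω^2 - (a + d) * ω + b = 0) : ∃ k : ℕ, 1 ≤ k ∧ !![a, -b; c, -d] = OmegaB ω ^ k := by
  obtain ⟨l, hl, e1, e2⟩ := descent c.toNat a b c d ω ω le_rfl hdet hd hdc h1 (by linarith)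
  obtain ⟨p1, p2, p3, p4⟩ := per_data ω ⟨l, hl, e1⟩
  obtain ⟨k, hk⟩ := p3 l e1
  refine ⟨k, ?_, ?_⟩
  · rcases Nat.eq_zero_or_pos k with h | h
    · rw [h] at hk; omega
    · exact h
  · rw [e2, hk, p4, Pn_mul _ _ _ p2]

lemma pow_eig (M : Matrix (Fin 2) (Fin 2) ℤ) (ω l : ℝ) (h1 : (M 0 0 : ℝ) * ω + M 0 1 = l * ω) (h2 : (M 1 0 : ℝ) * ω + M 1 1 = l) (k : ℕ) :
    ((M^k) 0 0 : ℝ) * ω + (M^k) 0 1 = l^k * ω ∧ ((M^k) 1 0 : ℝ) * ω + (M^k) 1 1 = l^k := by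
  induction k with
  | zero => simp
  | succ k ih =>
    rw [pow_succ]
    simp only [Matrix.mul_apply, Fin.sum_univ_two]
    push_cast
    constructor
    · linear_combination ((M^k) 0 0 : ℝ) * h1 + ((M^k) 0 1 : ℝ) * h2 + l * ih.1
    · linear_combination ((M^k) 1 0 : ℝ) * h1 + ((M^k) 1 1 : ℝ) * h2 + l * ih.2

/-- eigenvalue from trace -/
noncomputable def lam (t : ℤ) : ℝ := ((t:ℝ) + Real.sqrt ((t:ℝ)^2 - 4))/2

lemma lam_spec (t : ℤ) (ht : 3 ≤ t) : 1 < lam t ∧ lam t + 1 / lam t = t ∧ Irrational (lam t) := by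
  have htR : (3:ℝ) ≤ t := by exact_mod_cast ht
  have hs := Real.sqrt_nonneg ((t:ℝ)^2 - 4)
  have hsq := Real.sq_sqrt (show 0 ≤ (t:ℝ)^2 - 4 by nlinarith)
  have h1 : 1 < lam t := by unfold lam; linarith
  refine ⟨h1, ?_, ?_⟩
  · have : lam t * lam t + 1 = t * lam t := by unfold lam; linear_combination hsq/4
    have h0 : lam t ≠ 0 := by linarith
    field_simp
    linarith
  · have hirr : Irrational (Real.sqrt ((t:ℝ)^2 - 4)) := by
      have e : (t:ℝ)^2 - 4 = ((t^2 - 4 : ℤ) : ℝ) := by push_cast; ring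
      rw [e, irrational_sqrt_intCast_iff]
      refine ⟨?_, by nlinarith⟩
      rintro ⟨r, hr⟩
      have e1 : |r| < t := by
        by_contra h; have h5 : t ≤ |r| := by omega
        nlinarith [abs_mul_abs_self r]
      have e2 : t - 1 < |r| := by
        by_contra h; have h5 : |r| ≤ t - 1 := by omega
        nlinarith [abs_mul_abs_self r, abs_nonneg r]
      omega
    unfold lam
    have := (hirr.intCast_add t).div_natCast (m := 2) (by norm_num)
    exact_mod_cast this

theorem om_data (a b c d : ℤ) (hdet : b * c - a * d = 1) (hd : 0 ≤ d) (hdc : d < c) (ht : 3 ≤ a - d) :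
    IsConjPair ((d + lam (a-d))/c) ((d + 1/lam (a-d))/c) ∧ (c:ℝ) * ((d + lam (a-d))/c)^2 - (a + d) * ((d + lam (a-d))/c) + b = 0 ∧
    0 < ((d:ℝ) + 1/lam (a-d))/c ∧ ((d:ℝ) + 1/lam (a-d))/c < 1 := by
  obtain ⟨h1, h2, h3⟩ := lam_spec _ ht
  set l := lam (a-d) with hl
  have hc0 : (0:ℝ) < c := by exact_mod_cast (by omega)
  have hd0 : (0:ℝ) ≤ d := by exact_mod_cast hd
  have hl0 : l ≠ 0 := by linarith
  have hil : 0 < 1/l := by positivity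
  have hil1 : 1/l < 1 := by rw [div_lt_one (by linarith)]; exact h1
  have hdcR : (d:ℝ) + 1 ≤ c := by exact_mod_cast hdc
  have hdetR : (b:ℝ) * c - a * d = 1 := by exact_mod_cast hdet
  push_cast at h2
  have q0 : ∀ m : ℝ, m * m + 1 = (a - d) * m → (c:ℝ) * ((d + m)/c)^2 - (a + d) * ((d + m)/c) + b = 0 := by
    intro m hm
    field_simp
    linear_combination hm + hdetR
  have q1 : l * l + 1 = (a - d) * l := by rw [← h2]; field_simp
  have q2 : (1/l) * (1/l) + 1 = (a - d) * (1/l) := by rw [← h2]; field_simp; ring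
  have hirr : Irrational ((d + l)/c) := by
    have := (h3.intCast_add d).div_intCast (m := c) (by omega)
    exact this
  refine ⟨⟨hirr, ?_⟩, q0 l q1, by positivity, by rw [div_lt_one hc0]; linarith⟩
  set g : ℤ := ((Int.gcd (Int.gcd c (-(a+d)) : ℤ) b : ℕ) : ℤ) with hg
  have hgc : g ∣ c := (Int.gcd_dvd_left _ _).trans (Int.gcd_dvd_left _ _)
  have hga : g ∣ -(a+d) := (Int.gcd_dvd_left _ _).trans (Int.gcd_dvd_right _ _)
  have hgb : g ∣ b := Int.gcd_dvd_right _ _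
  have hg0 : 0 < g := by
    rw [hg]
    have : Int.gcd (Int.gcd c (-(a+d)) : ℤ) b ≠ 0 := by
      intro h
      rw [Int.gcd_eq_zero_iff] at h
      have h6 : Int.gcd c (-(a+d)) = 0 := by exact_mod_cast h.1
      rw [Int.gcd_eq_zero_iff] at h6
      omega
    omega
  obtain ⟨A, hA⟩ := hgc
  obtain ⟨B, hB⟩ := hga
  obtain ⟨C, hC⟩ := hgb
  have hgR : (g:ℝ) ≠ 0 := by exact_mod_cast hg0.ne'
  have hAR : (c:ℝ) = g * A := by exact_mod_cast hA
  have hBR : -((a:ℝ)+d) = g * B := by exact_mod_cast hB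
  have hCR : (b:ℝ) = g * C := by exact_mod_cast hC
  refine ⟨A, B, C, ?_, ?_, ?_, ?_, ?_⟩
  · by_contra h; nlinarith
  · have h5 : Int.gcd (Int.gcd (g*A) (g*B) : ℤ) (g*C) = g.natAbs * Int.gcd (Int.gcd A B : ℤ) C := by
      rw [Int.gcd_mul_left, Nat.cast_mul]
      have : ((g.natAbs : ℕ) : ℤ) = g := by omega
      rw [this, Int.gcd_mul_left]
    rw [← hA, ← hB, ← hC] at h5
    have h6 : g = g * (Int.gcd (Int.gcd A B : ℤ) C : ℤ) := by
      have : (g.natAbs:ℤ) = g := by omega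
      conv_lhs => rw [hg, h5, Nat.cast_mul, this]
    have h7 : g * 1 = g * (Int.gcd (Int.gcd A B : ℤ) C : ℤ) := by linarith
    have := mul_left_cancel₀ hg0.ne' h7
    exact_mod_cast this.symm
  · have := q0 l q1
    have h5 : (g:ℝ) * ((A:ℝ) * ((d + l)/c) ^ 2 + B * ((d + l)/c) + C) = 0 := by
      linear_combination this - ((d + l)/c)^2 * hAR - ((d + l)/c) * hBR - hCR
    exact (mul_eq_zero.mp h5).resolve_left hgR
  · have := q0 (1/l) q2
    have h5 : (g:ℝ) * ((A:ℝ) * ((d + 1/l)/c) ^ 2 + B * ((d + 1/l)/c) + C) = 0 := by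
      linear_combination this - ((d + 1/l)/c)^2 * hAR - ((d + 1/l)/c) * hBR - hCR
    exact (mul_eq_zero.mp h5).resolve_left hgR
  · intro h
    rw [div_left_inj' hc0.ne'] at h
    linarith

end Dyn


namespace Cnt
open Finset Dyn MainT

/-- the triples `(c,d,a)` -/
noncomputable def Qfin (α β : ℝ) (Y N : ℕ) : Finset (Σ _ : ℕ, Σ _ : ℕ, ℤ) :=
  (Icc 1 Y).sigma fun c => (range (Dn β c)).sigma fun d => (Ico ⌈α * c⌉ ((N:ℤ) + 1 + (d:ℤ))).filter fun a : ℤ => (c:ℤ) ∣ a * d + 1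

lemma Qfin_card (α β : ℝ) (Y N : ℕ) : ((Qfin α β Y N).card : ℝ) = Qn α β Y N := by
  unfold Qfin Qn
  rw [Finset.card_sigma]
  push_cast
  refine Finset.sum_congr rfl fun c _ => ?_
  rw [Finset.card_sigma]
  push_cast
  rfl

lemma mem_Qfin (α β κ : ℝ) (hβ : 1 ≤ β) (hκ : κ = α - 1/β) (hκ0 : 0 < κ) (Y N : ℕ) (hY : (N:ℝ) ≤ κ * Y) (x : Σ _ : ℕ, Σ _ : ℕ, ℤ) :
    x ∈ Qfin α β Y N ↔ 1 ≤ x.1 ∧ x.2.1 < x.1 ∧ (x.2.1:ℝ) * β ≤ x.1 ∧ α * x.1 ≤ x.2.2 ∧ x.2.2 ≤ N + x.2.1 ∧ (x.1:ℤ) ∣ x.2.2 * x.2.1 + 1 := by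
  obtain ⟨c, d, a⟩ := x
  simp only [Qfin, Finset.mem_sigma, Finset.mem_Icc, Finset.mem_range, mem_Dn β hβ, Finset.mem_filter, Finset.mem_Ico, Int.ceil_le]
  constructor
  · rintro ⟨⟨h1, h2⟩, ⟨h3, h4⟩, ⟨h5, h6⟩, h7⟩
    exact ⟨h1, h3, h4, h5, by omega, h7⟩
  · rintro ⟨h1, h3, h4, h5, h6, h7⟩
    refine ⟨⟨h1, ?_⟩, ⟨h3, h4⟩, ⟨h5, by omega⟩, h7⟩
    have h8 : (a:ℝ) ≤ N + d := by exact_mod_cast h6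
    have h9 : (d:ℝ) ≤ c * (1/β) := by rw [mul_one_div, le_div_iff₀ (by linarith)]; exact h4
    have : κ * c ≤ κ * Y := by rw [hκ] at *; nlinarith
    have := le_of_mul_le_mul_left this hκ0
    exact_mod_cast this

/-- triple attached to a reduced number -/
noncomputable def Phi (ω : ℝ) : Σ _ : ℕ, Σ _ : ℕ, ℤ := ⟨(OmegaB ω 1 0).toNat, ⟨(-(OmegaB ω 1 1)).toNat, OmegaB ω 0 0⟩⟩

/-- number attached to a triple -/
noncomputable def om (x : Σ _ : ℕ, Σ _ : ℕ, ℤ) : ℝ := (((x.2.1:ℤ):ℝ) + lam (x.2.2 - x.2.1)) / ((x.1:ℤ):ℝ)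

/-- admissible reduced numbers -/
def Rdc (α β ω : ℝ) : Prop := 1 < ω ∧ α ≤ ω ∧ ∃ ω' : ℝ, IsConjPair ω ω' ∧ 0 < ω' ∧ ω' < 1 ∧ ω' ≤ 1 / β

lemma Phi_data (α β ω : ℝ) (hβ : 1 ≤ β) (h : Rdc α β ω) :
    ∃ (x : Σ _ : ℕ, Σ _ : ℕ, ℤ) (b : ℤ) (l : ℝ), Phi ω = x ∧ om x = ω ∧ OmegaB ω = !![x.2.2, -b; (x.1:ℤ), -(x.2.1:ℤ)] ∧ b * x.1 - x.2.2 * x.2.1 = 1 ∧ 1 < l ∧ 3 ≤ x.2.2 - x.2.1 ∧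
      ((x.2.2:ℝ) - x.2.1 = l + 1/l) ∧ specRad (OmegaB ω) = l ∧ 1 ≤ x.1 ∧ x.2.1 < x.1 ∧ (x.2.1:ℝ) * β ≤ x.1 ∧ α * x.1 ≤ x.2.2 ∧ (x.1:ℤ) ∣ x.2.2 * x.2.1 + 1
      ∧ ((OmegaB ω 0 0 : ℝ) * ω + OmegaB ω 0 1 = l * ω) ∧ ((OmegaB ω 1 0 : ℝ) * ω + OmegaB ω 1 1 = l) := by
  obtain ⟨h1, h2, ω', h3, h4, h5, h6⟩ := h
  obtain ⟨a, b, c, d, l, e1, e2, e3, e4, e5, e6, e7, e8, e9, e10⟩ := reduced_data ω ω' h3 h1 h4 h5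
  obtain ⟨c, rfl⟩ : ∃ n : ℕ, c = n := ⟨c.toNat, by omega⟩
  obtain ⟨d, rfl⟩ : ∃ n : ℕ, d = n := ⟨d.toNat, by omega⟩
  have hc0 : (0:ℝ) < c := by exact_mod_cast (by omega : 0 < c)
  have hl0 : l ≠ 0 := by linarith
  have hil : 0 < 1/l := by positivity
  push_cast at e7 e8 e9
  have ht : 3 ≤ a - d := by
    have : (2:ℝ) < ((a - d : ℤ):ℝ) := by
      push_cast; rw [e9]
      have : l + 1/l - 2 = (l-1)^2/l := by field_simp; ring
      have h7 : 0 < (l-1)^2/l := by have : 0 < l - 1 := by linarith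
                                    positivity
      linarith
    have : 2 < a - d := by exact_mod_cast this
    omega
  have hlam : lam (a - d) = l := by
    unfold lam; apply spec_of _ l e5; push_cast; exact e9
  refine ⟨⟨c, d, a⟩, b, l, ?_, ?_, ?_, ?_, e5, ht, ?_, e10, ?_, ?_, ?_, ?_, ?_, ?_, ?_⟩
  · unfold Phi; rw [e1]; simp
  · simp only [om]; rw [hlam]; push_cast; rw [← e7]; field_simp
  · exact e1
  · exact e2
  · push_cast; exact e9
  · show 1 ≤ c
    omega
  · show d < c
    omega
  · show (d:ℝ) * β ≤ c
    rw [le_div_iff₀ (by linarith)] at h6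
    have h8 : (d:ℝ) ≤ c * ω' := by linarith
    calc (d:ℝ) * β ≤ c * ω' * β := by gcongr
      _ = c * (ω' * β) := by ring
      _ ≤ c * 1 := by gcongr
      _ = c := mul_one _
  · show α * (c:ℝ) ≤ a
    nlinarith
  · exact ⟨b, by linarith⟩
  · rw [e1]; simp; linarith
  · rw [e1]; simp; linarith

lemma Phi_mem (α β κ ω : ℝ) (hβ : 1 ≤ β) (hκ : κ = α - 1/β) (hκ0 : 0 < κ) (h : Rdc α β ω) (Y N : ℕ) (hY : (N:ℝ) ≤ κ * Y) 
   (ht : (Phi ω).2.2 - (Phi ω).2.1 ≤ N) : Phi ω ∈ Qfin α β Y N ∧ om (Phi ω) = ω := by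
  obtain ⟨x, b, l, e0, e1, e2, e3, e4, e5, e6, e7, e8, e9, e10, e11, e12, _⟩ := Phi_data α β ω hβ h
  rw [e0] at ht ⊢
  refine ⟨?_, e1⟩
  rw [mem_Qfin α β κ hβ hκ hκ0 Y N hY]
  exact ⟨e8, e9, e10, e11, by omega, e12⟩

lemma rho_iff (α β ω : ℝ) (hβ : 1 ≤ β) (h : Rdc α β ω) (R : ℝ) (hR : 0 < R) :
    rhoB ω ≤ R ↔ (Phi ω).2.2 - (Phi ω).2.1 ≤ (⌊Real.exp (R/2) + 1/Real.exp (R/2)⌋₊ : ℤ) := by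
  obtain ⟨x, b, l, e0, e1, e2, e3, e4, e5, e6, e7, _⟩ := Phi_data α β ω hβ h
  rw [e0]
  set X := Real.exp (R/2) with hX
  have hX1 : 1 < X := by rw [hX]; exact Real.one_lt_exp_iff.mpr (by linarith)
  have h1 : rhoB ω ≤ R ↔ l ≤ X := by
    unfold rhoB
    rw [e7, hX, ← Real.log_le_iff_le_exp (by linarith)]
    constructor <;> intro h <;> linarith
  have hX0 : X ≠ 0 := by linarith
  have hl0 : l ≠ 0 := by linarith
  have hd : X + 1/X - (l + 1/l) = (X - l) * (1 - 1/(X*l)) := by field_simp; ring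
  have hp : 0 < 1 - 1/(X*l) := by
    have : 1/(X*l) < 1 := by rw [div_lt_one (by positivity)]; nlinarith
    linarith
  have h2 : l ≤ X ↔ l + 1/l ≤ X + 1/X := by
    constructor
    · intro h; have := mul_nonneg (sub_nonneg.mpr h) hp.le; linarith
    · intro h; by_contra h'
      have := mul_neg_of_neg_of_pos (show X - l < 0 by linarith) hp
      linarith
  rw [h1, h2, ← e6]
  obtain ⟨t, ht⟩ : ∃ t : ℕ, x.2.2 - x.2.1 = t := ⟨(x.2.2 - x.2.1).toNat, by omega⟩
  have ht' : (x.2.2:ℝ) - x.2.1 = t := by exact_mod_cast ht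
  rw [ht, ht', Int.ofNat_le, Nat.le_floor_iff (by positivity)]

end Cnt


namespace Cnt
open Finset Dyn MainT

lemma B2_card (α β κ : ℝ) (hβ : 1 ≤ β) (hκ : κ = α - 1/β) (hκ0 : 0 < κ) (Y N : ℕ) (hY : (N:ℝ) ≤ κ * Y) :
    ((Qfin α β Y N).filter fun x => (x.2.2:ℝ) < α * x.1 + 1).card ≤ Y := by
  have : Y = (Icc 1 Y).card := by simp
  conv_rhs => rw [this]
  apply Finset.card_le_card_of_injOn (fun x => x.1)
  · intro x hx
    have hx := (Finset.mem_filter.mp hx).1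
    exact (Finset.mem_sigma.mp hx).1
  · rintro ⟨c, d, a⟩ hx ⟨c', d', a'⟩ hy h
    obtain ⟨hx, hx2⟩ := Finset.mem_filter.mp hx
    obtain ⟨hy, hy2⟩ := Finset.mem_filter.mp hy
    rw [mem_Qfin α β κ hβ hκ hκ0 Y N hY] at hx hy
    obtain ⟨x1, x2, x3, x4, x5, x6⟩ := hx
    obtain ⟨y1, y2, y3, y4, y5, y6⟩ := hy
    dsimp only at *
    subst h
    have ha : a = a' := by
      have h1 : (a:ℝ) < a' + 1 := by linarith
      have h2 : (a':ℝ) < a + 1 := by linarith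
      have h1 : a < a' + 1 := by exact_mod_cast h1
      have h2 : a' < a + 1 := by exact_mod_cast h2
      omega
    subst ha
    have h3 : (c:ℤ) ∣ d - d' := by
      have h4 : (d:ℤ) - d' = d * (a * d' + 1) - d' * (a * d + 1) := by ring
      rw [h4]
      exact dvd_sub (Dvd.dvd.mul_left y6 _) (Dvd.dvd.mul_left x6 _)
    have h5 : (d:ℤ) - d' = 0 := Int.eq_zero_of_abs_lt_dvd h3 (by rw [abs_lt]; omega)
    have : d = d' := by omega
    subst this
    rfl

lemma B3_card (α β κ : ℝ) (hα : 1 ≤ α) (hβ : 1 ≤ β) (hκ : κ = α - 1/β) (hκ0 : 0 < κ) (Y N : ℕ) (hY : (N:ℝ) ≤ κ * Y) :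
    ((Qfin α β Y N).filter fun x => (x.1:ℝ) < (x.2.1 + 1) * β).card ≤ ∑ c ∈ Icc 1 Y, (N / c + 1) := by
  have : ∑ c ∈ Icc 1 Y, (N / c + 1) = ((Icc 1 Y).sigma fun c => range (N / c + 1)).card := by
    rw [Finset.card_sigma]; simp
  rw [this]
  apply Finset.card_le_card_of_injOn (fun x => (⟨x.1, ((x.2.2 - ⌈α * x.1⌉) / (x.1:ℤ)).toNat⟩ : Σ _ : ℕ, ℕ))
  · intro x hx
    have hx := (Finset.mem_filter.mp hx).1
    have hx0 := (Finset.mem_sigma.mp hx).1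
    rw [mem_Qfin α β κ hβ hκ hκ0 Y N hY] at hx
    obtain ⟨x1, x2, x3, x4, x5, x6⟩ := hx
    simp only [Finset.coe_sigma, Set.mem_sigma_iff, Finset.mem_coe, Finset.mem_range]
    refine ⟨hx0, ?_⟩
    have h1 : (x.1:ℤ) ≤ ⌈α * x.1⌉ := by
      have : (x.1:ℝ) ≤ ⌈α * x.1⌉ := le_trans (by nlinarith [(Nat.cast_nonneg x.1 : (0:ℝ) ≤ x.1)]) (Int.le_ceil _)
      exact_mod_cast this
    have h2 : x.2.2 - ⌈α * x.1⌉ ≤ N := by omega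
    have h3 : (x.2.2 - ⌈α * x.1⌉) / (x.1:ℤ) ≤ (N:ℤ) / (x.1:ℤ) := Int.ediv_le_ediv (by omega) h2
    have h4 : (N:ℤ) / (x.1:ℤ) = ((N / x.1 : ℕ) : ℤ) := by simp
    have h5 : 0 ≤ (N:ℤ) / (x.1:ℤ) := Int.ediv_nonneg (by omega) (by omega)
    omega
  · rintro ⟨c, d, a⟩ hx ⟨c', d', a'⟩ hy h
    obtain ⟨hx, hx2⟩ := Finset.mem_filter.mp hx
    obtain ⟨hy, hy2⟩ := Finset.mem_filter.mp hy
    rw [mem_Qfin α β κ hβ hκ hκ0 Y N hY] at hx hy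
    obtain ⟨x1, x2, x3, x4, x5, x6⟩ := hx
    obtain ⟨y1, y2, y3, y4, y5, y6⟩ := hy
    dsimp only at *
    have hc : c = c' := congrArg (fun z : (Σ _ : ℕ, ℕ) => z.1) h
    have hq := congrArg (fun z : (Σ _ : ℕ, ℕ) => z.2) h
    subst hc
    dsimp only at hq
    have hd : d = d' := by
      have h1 : (d:ℝ) < d' + 1 := lt_of_mul_lt_mul_right (lt_of_le_of_lt x3 hy2) (by linarith)
      have h2 : (d':ℝ) < d + 1 := lt_of_mul_lt_mul_right (lt_of_le_of_lt y3 hx2) (by linarith)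
      have h1 : d < d' + 1 := by exact_mod_cast h1
      have h2 : d' < d + 1 := by exact_mod_cast h2
      omega
    subst hd
    have h3 : (c:ℤ) ∣ a - a' := by
      have h4 : a - a' = a * (a' * d + 1) - a' * (a * d + 1) := by ring
      rw [h4]
      exact dvd_sub (Dvd.dvd.mul_left y6 _) (Dvd.dvd.mul_left x6 _)
    have g1 : 0 ≤ a - ⌈α * c⌉ := by have := Int.ceil_le.mpr x4; omega
    have g2 : 0 ≤ a' - ⌈α * c⌉ := by have := Int.ceil_le.mpr y4; omega
    have hq2 : (a - ⌈α * c⌉) / (c:ℤ) = (a' - ⌈α * c⌉) / (c:ℤ) := by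
      have k1 := Int.ediv_nonneg g1 (by omega : (0:ℤ) ≤ c)
      have k2 := Int.ediv_nonneg g2 (by omega : (0:ℤ) ≤ c)
      omega
    have hm : (a - ⌈α * c⌉) % (c:ℤ) = (a' - ⌈α * c⌉) % (c:ℤ) := by
      apply Int.emod_emod_of_dvd _ (dvd_refl _) |>.symm.trans
      rw [Int.emod_emod]
      apply Int.emod_eq_emod_iff_emod_sub_eq_zero.mpr
      apply Int.emod_eq_zero_of_dvd
      convert h3 using 1
      ring
    have e1 := Int.mul_ediv_add_emod (a - ⌈α * c⌉) c
    have e2 := Int.mul_ediv_add_emod (a' - ⌈α * c⌉) c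
    rw [hq2, hm] at e1
    have : a = a' := by linarith
    subst this
    rfl

lemma sq_le_two_pow (k : ℕ) : k ^ 2 ≤ 2 ^ (k+1) := by
  rcases Nat.lt_or_ge k 3 with h | h
  · interval_cases k <;> norm_num
  · induction k, h using Nat.le_induction with
    | base => norm_num
    | succ n hn ih =>
      rw [pow_succ 2 (n+1)]
      nlinarith

/-- triple of a power -/
noncomputable def Gp (p : (Σ _ : ℕ, Σ _ : ℕ, ℤ) × ℕ) : Σ _ : ℕ, Σ _ : ℕ, ℤ :=
  ⟨(((OmegaB (om p.1)) ^ p.2) 1 0).toNat, ⟨(-(((OmegaB (om p.1)) ^ p.2) 1 1)).toNat, ((OmegaB (om p.1)) ^ p.2) 0 0⟩⟩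

set_option maxHeartbeats 1000000 in
lemma B4_mem (α β κ : ℝ) (hα : 1 ≤ α) (hβ : 1 ≤ β) (hκ : κ = α - 1/β) (hκ0 : 0 < κ) (Y N : ℕ) (hY : (N:ℝ) ≤ κ * Y)
    (Y2 : ℕ) (hY2 : ((Nat.sqrt N + 1 : ℕ):ℝ) ≤ κ * Y2)
    (x : Σ _ : ℕ, Σ _ : ℕ, ℤ) (hx : x ∈ Qfin α β Y N) (ht : 3 ≤ x.2.2 - x.2.1) (h2 : α * x.1 + 1 ≤ x.2.2) (h3 : ((x.2.1:ℝ) + 1) * β ≤ x.1) :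
    (∃ ω, Rdc α β ω ∧ (Phi ω).2.2 - (Phi ω).2.1 ≤ N ∧ Phi ω = x) ∨ x ∈ ((Qfin α β Y2 (Nat.sqrt N + 1)) ×ˢ range (Nat.sqrt (2*N) + 1)).image Gp := by
  obtain ⟨c, d, a⟩ := x
  rw [mem_Qfin α β κ hβ hκ hκ0 Y N hY] at hx
  obtain ⟨x1, x2, x3, x4, x5, b, x6⟩ := hx
  dsimp only at *
  have hdet : b * c - a * d = 1 := by linarith
  obtain ⟨o1, o2, o3, o4⟩ := om_data a b c d hdet (by omega) (by omega) ht
  obtain ⟨l1, l2, l3⟩ := lam_spec (a - d) ht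
  have hom : om ⟨c, d, a⟩ = (((d:ℤ):ℝ) + lam (a - d)) / ((c:ℤ):ℝ) := rfl
  rw [← hom] at o1 o2
  set ω := om ⟨c, d, a⟩ with hω
  set L := lam (a - d) with hL
  have hc0 : (0:ℝ) < c := by exact_mod_cast (by omega : 0 < c)
  have hiL : 1 / L < 1 := by rw [div_lt_one (by linarith)]; exact l1
  have hiL0 : 0 < 1/L := by positivity
  push_cast at l2 hom o2 o3 o4
  have hcω : (c:ℝ) * ω = d + L := by rw [hom]; field_simp
  have hge : α ≤ ω := by
    have : α * c ≤ ω * c := by nlinarith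
    exact le_of_mul_le_mul_right this hc0
  have hgt : 1 < ω := by
    rcases lt_or_eq_of_le (le_trans hα hge) with h | h
    · exact h
    · exact absurd h.symm (by have := o1.1.ne_int 1; simpa using this)
  have hR : Rdc α β ω := by
    refine ⟨hgt, hge, _, o1, ?_, ?_, ?_⟩
    · push_cast; exact o3
    · push_cast; exact o4
    · push_cast
      rw [div_le_div_iff₀ hc0 (by linarith)]
      calc ((d:ℝ) + 1/L) * β ≤ (d + 1) * β := by gcongr
        _ ≤ 1 * c := by linarith
  obtain ⟨k, hk1, hk⟩ := fix_data ω hgt a b c d hdet (by omega) (by omega) (by push_cast; linarith)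
  obtain ⟨y, b', l, e0, e1, e2, e3, e4, e5, e6, e7, e8, e9, e10, e11, e12, e13, e14⟩ := Phi_data α β ω hβ hR
  rcases Nat.lt_or_ge 1 k with hk2 | hk2
  swap
  · left
    have : k = 1 := by omega
    subst this
    rw [pow_one] at hk
    have hP : Phi ω = ⟨c, d, a⟩ := by
      unfold Phi; rw [← hk]; simp
    refine ⟨ω, hR, ?_, hP⟩
    rw [hP]
    show a - d ≤ N
    omega
  · right
    have hpe := (pow_eig (OmegaB ω) ω l e13 e14 k).2
    rw [← hk] at hpe
    simp at hpe
    have hlk : l ^ k = L := by linarith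
    have hl2 : 2 < l := by
      have h5 : (3:ℝ) ≤ (y.2.2:ℝ) - y.2.1 := by exact_mod_cast e5
      have : 1/l < 1 := by rw [div_lt_one (by linarith)]; exact e4
      linarith
    have hLN : L < N := by
      have : ((a - d : ℤ):ℝ) ≤ N := by exact_mod_cast (by omega : a - d ≤ N)
      push_cast at this
      linarith
    rw [Finset.mem_image]
    refine ⟨(y, k), ?_, ?_⟩
    · rw [Finset.mem_product]
      constructor
      · show y ∈ _
        rw [← e0]
        refine (Phi_mem α β κ ω hβ hκ hκ0 hR Y2 _ hY2 ?_).1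
        rw [e0]
        obtain ⟨t, ht⟩ : ∃ t : ℕ, y.2.2 - y.2.1 = t + 1 := ⟨(y.2.2 - y.2.1 - 1).toNat, by omega⟩
        have ht' : (y.2.2:ℝ) - y.2.1 = t + 1 := by exact_mod_cast ht
        have : 1/l < 1 := by rw [div_lt_one (by linarith)]; exact e4
        have htl : (t:ℝ) ≤ l := by linarith
        have hl2N : l ^ 2 ≤ L := by rw [← hlk]; exact pow_le_pow_right₀ (by linarith) hk2
        have : (t:ℝ) * t ≤ N := by nlinarith [(Nat.cast_nonneg t : (0:ℝ) ≤ t)]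
        have : t * t ≤ N := by exact_mod_cast this
        have := Nat.le_sqrt.mpr this
        push_cast
        omega
      · show k ∈ _
        rw [Finset.mem_range, Nat.lt_succ_iff, Nat.le_sqrt]
        have h2k : (2:ℝ) ^ k ≤ N := by
          have h8 : (2:ℝ) ^ k ≤ l ^ k := pow_le_pow_left₀ (by norm_num) hl2.le k
          exact (h8.trans hlk.le).trans hLN.le
        have h2k : 2 ^ k ≤ N := by exact_mod_cast h2k
        have h9 := sq_le_two_pow k
        rw [pow_succ 2 k, pow_two] at h9
        generalize 2 ^ k = z at h9 h2k
        generalize k * k = w at h9 ⊢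
        omega
    · unfold Gp
      dsimp only
      rw [e1, ← hk]; simp

open Classical in
theorem count_bound (α β κ : ℝ) (hα : 1 ≤ α) (hβ : 1 ≤ β) (hκ : κ = α - 1/β) (hκ0 : 0 < κ) (Y N : ℕ) (hY : (N:ℝ) ≤ κ * Y)
    (Y2 : ℕ) (hY2 : ((Nat.sqrt N + 1 : ℕ):ℝ) ≤ κ * Y2) (Y1 : ℕ) (hY1 : ((2:ℕ):ℝ) ≤ κ * Y1) (S : Set ℝ)
    (hS : ∀ ω, ω ∈ S ↔ Rdc α β ω ∧ (Phi ω).2.2 - (Phi ω).2.1 ≤ N) :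
    S.ncard ≤ (Qfin α β Y N).card ∧ (Qfin α β Y N).card ≤ S.ncard + (Qfin α β Y1 2).card + Y + ∑ c ∈ Icc 1 Y, (N / c + 1) +
      (Qfin α β Y2 (Nat.sqrt N + 1)).card * (Nat.sqrt (2*N) + 1) := by
  have hinj : Set.InjOn Phi S := by
    intro u hu v hv h
    obtain ⟨hu1, hu2⟩ := (hS u).mp hu
    obtain ⟨hv1, hv2⟩ := (hS v).mp hv
    rw [← (Phi_mem α β κ u hβ hκ hκ0 hu1 Y N hY hu2).2, ← (Phi_mem α β κ v hβ hκ hκ0 hv1 Y N hY hv2).2, h]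
  have hI : Phi '' S = (((Qfin α β Y N).filter fun x => x ∈ Phi '' S : Finset _) : Set _) := by
    ext x
    simp only [Finset.coe_filter, Set.mem_ofPred_eq]
    constructor
    · intro h
      refine ⟨?_, h⟩
      obtain ⟨u, hu, rfl⟩ := h
      obtain ⟨hu1, hu2⟩ := (hS u).mp hu
      exact (Phi_mem α β κ u hβ hκ hκ0 hu1 Y N hY hu2).1
    · exact fun h => h.2
  have hcard : S.ncard = ((Qfin α β Y N).filter fun x => x ∈ Phi '' S).card := by
    rw [← hinj.ncard_image, ← Set.ncard_coe_finset, ← hI]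
  refine ⟨by rw [hcard]; exact Finset.card_filter_le _ _, ?_⟩
  have hsub : Qfin α β Y N ⊆ ((((Qfin α β Y N).filter fun x => x ∈ Phi '' S) ∪ Qfin α β Y1 2) ∪ ((Qfin α β Y N).filter fun x => (x.2.2:ℝ) < α * x.1 + 1)
      ∪ ((Qfin α β Y N).filter fun x => (x.1:ℝ) < (x.2.1 + 1) * β)) ∪ ((Qfin α β Y2 (Nat.sqrt N + 1)) ×ˢ range (Nat.sqrt (2*N) + 1)).image Gp := by
    intro x hx
    simp only [Finset.mem_union, Finset.mem_filter, hx, true_and]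
    by_cases h1 : 3 ≤ x.2.2 - x.2.1
    swap
    · left; left; left; right
      rw [mem_Qfin α β κ hβ hκ hκ0 Y N hY] at hx
      rw [mem_Qfin α β κ hβ hκ hκ0 Y1 2 hY1]
      obtain ⟨x1, x2, x3, x4, x5, x6⟩ := hx
      exact ⟨x1, x2, x3, x4, by push_cast; omega, x6⟩
    by_cases h2 : (x.2.2:ℝ) < α * x.1 + 1
    · left; left; right; exact h2
    by_cases h3 : (x.1:ℝ) < (x.2.1 + 1) * β
    · left; right; exact h3
    rcases B4_mem α β κ hα hβ hκ hκ0 Y N hY Y2 hY2 x hx h1 (not_lt.mp h2) (not_lt.mp h3) with ⟨ω, g1, g2, g3⟩ | h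
    · left; left; left; left
      exact ⟨ω, (hS ω).mpr ⟨g1, g2⟩, g3⟩
    · right; exact h
  refine (Finset.card_le_card hsub).trans ?_
  refine (Finset.card_union_le _ _).trans ?_
  refine add_le_add ((Finset.card_union_le _ _).trans (add_le_add ((Finset.card_union_le _ _).trans (add_le_add ((Finset.card_union_le _ _).trans ?_) ?_)) ?_)) ?_
  · rw [hcard]
  · exact B2_card α β κ hβ hκ hκ0 Y N hY
  · exact B3_card α β κ hα hβ hκ hκ0 Y N hY
  · refine Finset.card_image_le.trans ?_
    rw [Finset.card_product, Finset.card_range]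

end Cnt


namespace Cnt
open Finset Dyn MainT

lemma harm_part (κ : ℝ) (hκ0 : 0 < κ) (N Y : ℕ) (hN : 1 ≤ N) (hY1 : 1 ≤ Y) (hY : (Y:ℝ) ≤ (1/κ+1) * N) :
    ((∑ c ∈ Icc 1 Y, (N / c + 1) : ℕ) : ℝ) ≤ (5 * (1/κ+1) + (1/κ+1)) * (Real.sqrt N)^3 := by
  set s := Real.sqrt N with hs
  have hN1 : (1:ℝ) ≤ N := by exact_mod_cast hN
  have hs1 : 1 ≤ s := by rw [hs]; exact Real.one_le_sqrt.mpr hN1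
  have hs2 : s^2 = N := Real.sq_sqrt (by linarith)
  have hY1' : (1:ℝ) ≤ Y := by exact_mod_cast hY1
  set C := 1/κ+1 with hC
  have hC1 : 1 ≤ C := by have : 0 < 1/κ := by positivity
                         linarith
  have h1 : ((∑ c ∈ Icc 1 Y, (N / c + 1) : ℕ) : ℝ) ≤ N * ∑ c ∈ Icc 1 Y, 1/(c:ℝ) + Y := by
    rw [Finset.mul_sum]
    push_cast
    rw [Finset.sum_add_distrib]
    apply add_le_add
    · refine Finset.sum_le_sum fun c _ => ?_
      rw [mul_one_div]; exact Nat.cast_div_le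
    · simp
  have h2 := Four.harm_le (Y+1)
  have hI : Ico 1 (Y+1) = Icc 1 Y := by ext; simp
  rw [hI] at h2
  push_cast at h2
  have h3 := Four.log_bound (1/2) (by norm_num) Y hY1'
  rw [← Real.sqrt_eq_rpow] at h3
  have h4 : Real.sqrt Y ≤ C * s := by
    rw [Real.sqrt_le_left (by positivity)]
    rw [mul_pow, hs2]
    refine hY.trans ?_
    gcongr
    nlinarith
  have h5 : ∑ c ∈ Icc 1 Y, 1/(c:ℝ) ≤ 5 * (C * s) := by
    norm_num at h3 h2 ⊢
    linarith
  have h6 : (N:ℝ) * ∑ c ∈ Icc 1 Y, 1/(c:ℝ) ≤ N * (5 * (C * s)) := by gcongr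
  have h7 : (Y:ℝ) ≤ C * s^3 := by
    refine hY.trans ?_
    rw [← hs2]
    gcongr
    norm_num
  calc _ ≤ (N:ℝ) * (5 * (C * s)) + C * s^3 := by linarith
    _ = _ := by rw [← hs2]; ring

theorem err_bound (α β κ : ℝ) (hα : 1 ≤ α) (hβ : 1 ≤ β) (hκ : κ = α - 1/β) (hκ0 : 0 < κ) :
    ∃ C > (0:ℝ), ∀ N : ℕ, 1 ≤ N → ∀ S : Set ℝ, (∀ ω, ω ∈ S ↔ Rdc α β ω ∧ (Phi ω).2.2 - (Phi ω).2.1 ≤ N) →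
      |(S.ncard : ℝ) - Qn α β ⌈(N:ℝ)/κ⌉₊ N| ≤ C * (Real.sqrt N)^3 := by
  obtain ⟨K, hK, hQ⟩ := Q_asymp α β κ hβ hκ hκ0 (1/2) (by norm_num)
  set A := ((Qfin α β ⌈(2:ℝ)/κ⌉₊ 2).card : ℝ) with hA
  set D := K + |(3/Real.pi^2) * Real.log (α/κ)| with hD
  have hD0 : 0 < D := by positivity
  refine ⟨A + (1/κ+1) + (5 * (1/κ+1) + (1/κ+1)) + 12 * D, by positivity, fun N hN S hS => ?_⟩
  set s := Real.sqrt N with hs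
  have hN1 : (1:ℝ) ≤ N := by exact_mod_cast hN
  have hs1 : 1 ≤ s := by rw [hs]; exact Real.one_le_sqrt.mpr hN1
  have hs2 : s^2 = N := Real.sq_sqrt (by linarith)
  have hs3 : 1 ≤ s^3 := one_le_pow₀ hs1
  set Y := ⌈(N:ℝ)/κ⌉₊ with hYd
  have hYc : ∀ z : ℝ, z ≤ κ * (⌈z/κ⌉₊ : ℝ) := fun z => by
    have := Nat.le_ceil (z/κ)
    rw [div_le_iff₀ hκ0] at this
    linarith
  have hY1 : 1 ≤ Y := Nat.ceil_pos.mpr (by positivity)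
  have hYle : (Y:ℝ) ≤ (1/κ+1) * N := by
    have := Nat.ceil_lt_add_one (show 0 ≤ (N:ℝ)/κ by positivity)
    rw [← hYd] at this
    have e : (N:ℝ)/κ = 1/κ * N := by ring
    rw [e] at this
    linarith
  obtain ⟨c1, c2⟩ := count_bound α β κ hα hβ hκ hκ0 Y N (hYc _) ⌈((Nat.sqrt N + 1 : ℕ):ℝ)/κ⌉₊ (hYc _) ⌈(2:ℝ)/κ⌉₊ (by exact_mod_cast hYc 2) S hS
  have c1' : (S.ncard:ℝ) ≤ Qn α β Y N := by rw [← Qfin_card]; exact_mod_cast c1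
  have c2' : Qn α β Y N ≤ S.ncard + A + Y + ((∑ c ∈ Icc 1 Y, (N / c + 1) : ℕ):ℝ) + 
     Qn α β ⌈((Nat.sqrt N + 1 : ℕ):ℝ)/κ⌉₊ (Nat.sqrt N + 1) * (((Nat.sqrt (2*N) : ℕ):ℝ) + 1) := by
    rw [← Qfin_card, ← Qfin_card, hA]; exact_mod_cast c2
  have h1 := harm_part κ hκ0 N Y hN hY1 hYle
  have hYle3 : (Y:ℝ) ≤ (1/κ+1) * s^3 := by
    refine hYle.trans ?_
    rw [← hs2]
    gcongr
    norm_num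
  have hsq : ((Nat.sqrt N + 1 : ℕ):ℝ) ≤ 2 * s := by
    have : ((Nat.sqrt N : ℕ):ℝ) ≤ s := Real.nat_sqrt_le_real_sqrt
    push_cast; linarith
  have hsq2 : ((Nat.sqrt (2*N) : ℕ):ℝ) + 1 ≤ 3 * s := by
    have h : ((Nat.sqrt (2*N) : ℕ):ℝ) ≤ Real.sqrt ((2*N:ℕ):ℝ) := Real.nat_sqrt_le_real_sqrt
    have h' : Real.sqrt ((2*N:ℕ):ℝ) ≤ 2 * s := by
      rw [Real.sqrt_le_left (by positivity)]
      push_cast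
      rw [mul_pow, hs2]; linarith
    linarith
  have hq := hQ (Nat.sqrt N + 1) (by omega)
  set n2 := Nat.sqrt N + 1 with hn2
  set Q2 := Qn α β ⌈((n2 : ℕ):ℝ)/κ⌉₊ n2 with hQ2
  have hQ20 : 0 ≤ Q2 := by rw [hQ2, ← Qfin_card]; positivity
  have hq2 : Q2 ≤ D * (n2:ℝ)^2 := by
    have e : (3/2 + 1/2 : ℝ) = (2:ℕ) := by norm_num
    rw [e, Real.rpow_natCast] at hq
    have := (abs_le.mp hq).2
    have h3 := le_abs_self ((3/Real.pi^2) * Real.log (α/κ))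
    have h4 := mul_le_mul_of_nonneg_left h3 (sq_nonneg (n2:ℝ))
    rw [hD]
    nlinarith
  have hq3 : Q2 * (((Nat.sqrt (2*N) : ℕ):ℝ) + 1) ≤ 12 * D * s^3 := by
    calc _ ≤ (D * (2 * s)^2) * (3 * s) := by
          apply mul_le_mul _ hsq2 (by positivity) (by positivity)
          refine hq2.trans ?_
          gcongr
      _ = _ := by ring
  have hA0 : 0 ≤ A := by positivity
  have hA3 : A ≤ A * s^3 := le_mul_of_one_le_right hA0 hs3
  rw [abs_le]
  constructor
  · have : (A + (1/κ+1) + (5 * (1/κ+1) + (1/κ+1)) + 12 * D) * s^3 = A * s^3 + (1/κ+1) * s^3 + (5 * (1/κ+1) + (1/κ+1)) * s^3 + 12 * D * s^3 := by ring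
    rw [this]
    linarith
  · have : 0 ≤ (A + (1/κ+1) + (5 * (1/κ+1) + (1/κ+1)) + 12 * D) * s^3 := by positivity
    linarith

theorem final (α β : ℝ) (hα : 1 ≤ α) (hβ : 1 ≤ β) (hne : (α, β) ≠ (1, 1)) (ε : ℝ) (hε : 0 < ε) :
    ∃ K > (0 : ℝ), ∀ R > (0 : ℝ),
      |({ω : ℝ | 1 < ω ∧ α ≤ ω ∧ rhoB ω ≤ R ∧
          ∃ ω' : ℝ, IsConjPair ω ω' ∧ 0 < ω' ∧ ω' < 1 ∧ ω' ≤ 1 / β}.ncard : ℝ) -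
        Real.exp R / (2 * (Real.pi ^ 2 / 6)) * Real.log (α * β / (α * β - 1))|
      ≤ K * Real.exp ((3 / 4 + ε) * R) := by
  have hβ0 : 0 < β := by linarith
  obtain ⟨κ, hκ⟩ : ∃ κ, κ = α - 1/β := ⟨_, rfl⟩
  have hab : 1 < α * β := by
    rcases lt_or_eq_of_le hα with h | h
    · nlinarith
    · rcases lt_or_eq_of_le hβ with h' | h'
      · nlinarith
      · exact absurd (by rw [← h, ← h']) hne
  have hκ0 : 0 < κ := by
    rw [hκ, sub_pos, div_lt_iff₀ hβ0]; exact hab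
  have hlog : α * β / (α * β - 1) = α/κ := by
    have h1 : α * β - 1 ≠ 0 := by linarith
    rw [div_eq_div_iff h1 hκ0.ne', hκ]
    field_simp
  obtain ⟨C, hC, hE⟩ := err_bound α β κ hα hβ hκ hκ0
  obtain ⟨K, hK, hQ⟩ := Q_asymp α β κ hβ hκ hκ0 (2*ε) (by positivity)
  set m := (3/Real.pi^2) * Real.log (α/κ) with hm
  refine ⟨(C + K) * 2^(3/2+2*ε) + 3 * |m|, by positivity, fun R hR => ?_⟩
  set X := Real.exp (R/2) with hX
  have hX1 : 1 < X := by rw [hX]; exact Real.one_lt_exp_iff.mpr (by linarith)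
  have hiX : 1/X < 1 := by rw [div_lt_one (by linarith)]; exact hX1
  have hiX0 : 0 < 1/X := by positivity
  set N := ⌊X + 1/X⌋₊ with hN
  have hN1 : 1 ≤ N := by rw [hN, Nat.le_floor_iff (by positivity)]; push_cast; linarith
  have hNu : (N:ℝ) ≤ X + 1/X := Nat.floor_le (by positivity)
  have hNl : X + 1/X < N + 1 := Nat.lt_floor_add_one _
  have hN1' : (1:ℝ) ≤ N := by exact_mod_cast hN1
  have hset : {ω : ℝ | 1 < ω ∧ α ≤ ω ∧ rhoB ω ≤ R ∧
          ∃ ω' : ℝ, IsConjPair ω ω' ∧ 0 < ω' ∧ ω' < 1 ∧ ω' ≤ 1 / β} = {ω : ℝ | Rdc α β ω ∧ (Phi ω).2.2 - (Phi ω).2.1 ≤ N} := by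
    ext ω
    constructor
    · rintro ⟨h1, h2, h3, h4⟩
      have hr : Rdc α β ω := ⟨h1, h2, h4⟩
      exact ⟨hr, (rho_iff α β ω hβ hr R hR).mp h3⟩
    · rintro ⟨hr, h⟩
      exact ⟨hr.1, hr.2.1, (rho_iff α β ω hβ hr R hR).mpr h, hr.2.2⟩
  rw [hset, hlog]
  have e1 := hE N hN1 {ω : ℝ | Rdc α β ω ∧ (Phi ω).2.2 - (Phi ω).2.1 ≤ N} (fun ω => Iff.rfl)
  have e2 := hQ N hN1
  set S := {ω : ℝ | Rdc α β ω ∧ (Phi ω).2.2 - (Phi ω).2.1 ≤ N}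
  set Q := Qn α β ⌈(N:ℝ)/κ⌉₊ N
  have hmain : Real.exp R / (2 * (Real.pi ^ 2 / 6)) * Real.log (α/κ) = X^2 * m := by
    have : Real.exp R = X^2 := by rw [hX, ← Real.exp_nat_mul]; congr 1; push_cast; ring
    rw [this, hm]
    have := Real.pi_pos.ne'
    field_simp
    ring
  rw [hmain]
  have hs3 : (Real.sqrt N)^3 ≤ (N:ℝ)^(3/2+2*ε) := by
    rw [Real.sqrt_eq_rpow, ← Real.rpow_natCast, ← Real.rpow_mul (by positivity)]
    apply Real.rpow_le_rpow_of_exponent_le hN1'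
    push_cast; linarith
  have hNp : (N:ℝ)^(3/2+2*ε) ≤ 2^(3/2+2*ε) * Real.exp ((3/4+ε)*R) := by
    calc (N:ℝ)^(3/2+2*ε) ≤ (2*X)^(3/2+2*ε) := by
          apply Real.rpow_le_rpow (by positivity) (by linarith) (by positivity)
      _ = _ := by
          rw [Real.mul_rpow (by norm_num) (by positivity), hX, ← Real.exp_mul]
          congr 2; ring
  have hXe : X ≤ Real.exp ((3/4+ε)*R) := by
    rw [hX]; apply Real.exp_le_exp.mpr; nlinarith
  have e3 : |(N:ℝ)^2 * m - X^2 * m| ≤ 3 * X * |m| := by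
    rw [← sub_mul, abs_mul]
    gcongr
    have : (N:ℝ)^2 - X^2 = (N - X) * (N + X) := by ring
    rw [this, abs_mul]
    have a1 : |(N:ℝ) - X| ≤ 1 := by rw [abs_le]; constructor <;> linarith
    have a2 : |(N:ℝ) + X| ≤ 3 * X := by rw [abs_of_pos (by positivity)]; linarith
    calc _ ≤ 1 * (3 * X) := mul_le_mul a1 a2 (abs_nonneg _) (by norm_num)
      _ = _ := one_mul _
  rw [mul_assoc, ← hm] at e2
  calc |(S.ncard:ℝ) - X^2 * m| = |((S.ncard:ℝ) - Q) + (Q - (N:ℝ)^2 * m) + ((N:ℝ)^2 * m - X^2 * m)| := by congr 1; ring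
    _ ≤ |(S.ncard:ℝ) - Q| + |Q - (N:ℝ)^2 * m| + |(N:ℝ)^2 * m - X^2 * m| := abs_add_three _ _ _
    _ ≤ C * (N:ℝ)^(3/2+2*ε) + K * (N:ℝ)^(3/2+2*ε) + 3 * X * |m| := by
        gcongr
        exact e1.trans (by gcongr)
    _ ≤ C * (2^(3/2+2*ε) * Real.exp ((3/4+ε)*R)) + K * (2^(3/2+2*ε) * Real.exp ((3/4+ε)*R)) + 3 * Real.exp ((3/4+ε)*R) * |m| := by
        gcongr
    _ = _ := by ring

end Cnt

theorem stmt3 (α β : ℝ) (hα : 1 ≤ α) (hβ : 1 ≤ β) (hne : (α, β) ≠ (1, 1)) :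
    ∀ ε > (0 : ℝ), ∃ K > (0 : ℝ), ∀ R > (0 : ℝ),
      |({ω : ℝ | 1 < ω ∧ α ≤ ω ∧ rhoB ω ≤ R ∧
          ∃ ω' : ℝ, IsConjPair ω ω' ∧ 0 < ω' ∧ ω' < 1 ∧ ω' ≤ 1 / β}.ncard : ℝ) -
        Real.exp R / (2 * (Real.pi ^ 2 / 6)) * Real.log (α * β / (α * β - 1))|
      ≤ K * Real.exp ((3 / 4 + ε) * R) := by
  intro ε hε
  exact Cnt.final α β hα hβ hne ε hε
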